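/- Fix integers k and d with 1 ≤ d < k/2, and suppose that either 0.42·k ≤ d, or (k,d) = (12,5), or (k,d) = (17,7). Then there exists n₀ such that for all n ≥ n₀ with k dividing n: every k-uniform hypergraph H on n vertices with δ_d(H) ≥ δ(n,k,d) + 1 contains a perfect matching, and moreover there exists a k-uniform hypergraph H on n vertices with δ_d(H) = δ(n,k,d) containing no perfect matching. In other words, m_d(k,n) = δ(n,k,d) + 1. -/

import Mathlib

/-- The minimum `d`-degree of a `k`-graph `H` on `Fin n`: the minimum over all `d`-sets `S` of
the number of edges of `H` containing `S`. -/
noncomputable def minDeg {n : ℕ} (H : Finset (Finset (Fin n))) (d : ℕ) : ℕ :=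
  sInf { m | ∃ S : Finset (Fin n), S.card = d ∧ (H.filter fun e => S ⊆ e).card = m }

/-- The extremal family `H_ext(n,k)`: all `k`-graphs `B̄(A,B)` (edges meeting `A` in an even
number of vertices) with `A, B = Aᶜ` a partition into nonempty sets and `|A|` odd, together with
all `k`-graphs `B(A,B)` (edges meeting `A` in an odd number of vertices) with `|A| - n/k` odd. -/
def Hext (n k : ℕ) : Set (Finset (Finset (Fin n))) :=
  { H | ∃ A : Finset (Fin n), A.Nonempty ∧ Aᶜ.Nonempty ∧
      ((Odd A.card ∧
          H = (Finset.univ.powersetCard k).filter fun e => Even (e ∩ A).card) ∨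
       (Odd ((A.card : ℤ) - (n / k : ℕ)) ∧
          H = (Finset.univ.powersetCard k).filter fun e => Odd (e ∩ A).card)) }

/-- `δ(n,k,d)`: the maximum of the minimum `d`-degrees among the hypergraphs in `H_ext(n,k)`. -/
noncomputable def deltaExt (n k d : ℕ) : ℕ :=
  sSup { m | ∃ H ∈ Hext n k, minDeg H d = m }

/-- `H` has a perfect matching: a set of pairwise disjoint edges covering all vertices. -/
def HasPerfectMatching {n : ℕ} (H : Finset (Finset (Fin n))) : Prop :=
  ∃ M ⊆ H, (M : Set (Finset (Fin n))).PairwiseDisjoint id ∧ M.biUnion id = Finset.univ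


namespace PMx

open Finset
set_option linter.unusedSectionVars false
set_option linter.unusedVariables false

open Classical in
noncomputable def ind (p : Prop) : ℝ := if p then 1 else 0

lemma ind_true {p : Prop} (h : p) : ind p = 1 := by simp [ind, h]
lemma ind_false {p : Prop} (h : ¬ p) : ind p = 0 := by simp [ind, h]
lemma ind_nonneg (p : Prop) : 0 ≤ ind p := by unfold ind; split_ifs <;> norm_num
lemma ind_le_one (p : Prop) : ind p ≤ 1 := by unfold ind; split_ifs <;> norm_num
lemma ind_mono {p q : Prop} (h : p → q) : ind p ≤ ind q := by
  by_cases hp : p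
  · rw [ind_true hp, ind_true (h hp)]
  · rw [ind_false hp]; exact ind_nonneg q
lemma ind_congr {p q : Prop} (h : p ↔ q) : ind p = ind q := by
  rw [propext h]
lemma ind_and (p q : Prop) : ind (p ∧ q) = ind p * ind q := by
  by_cases hp : p <;> by_cases hq : q <;> simp [ind, hp, hq]
lemma ind_not (p : Prop) : ind (¬ p) = 1 - ind p := by
  by_cases hp : p <;> simp [ind, hp]

/-- average over a finite type -/
noncomputable def ex {Ω : Type*} [Fintype Ω] (f : Ω → ℝ) : ℝ := (∑ ω, f ω) / Fintype.card Ω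

noncomputable def pr {Ω : Type*} [Fintype Ω] (P : Ω → Prop) : ℝ := ex fun ω => ind (P ω)

section
variable {Ω Ω' : Type*} [Fintype Ω] [Fintype Ω']

lemma ex_add (f g : Ω → ℝ) : ex (fun ω => f ω + g ω) = ex f + ex g := by
  simp [ex, Finset.sum_add_distrib, add_div]

lemma ex_sub (f g : Ω → ℝ) : ex (fun ω => f ω - g ω) = ex f - ex g := by
  simp [ex, Finset.sum_sub_distrib, sub_div]

lemma ex_mul_left (c : ℝ) (f : Ω → ℝ) : ex (fun ω => c * f ω) = c * ex f := by
  simp [ex, ← Finset.mul_sum, mul_div_assoc]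

lemma ex_mul_right (c : ℝ) (f : Ω → ℝ) : ex (fun ω => f ω * c) = ex f * c := by
  simp only [mul_comm _ c]; exact ex_mul_left c f

lemma ex_sum {ι : Type*} (s : Finset ι) (f : ι → Ω → ℝ) :
    ex (fun ω => ∑ i ∈ s, f i ω) = ∑ i ∈ s, ex (f i) := by
  unfold ex; rw [Finset.sum_comm, Finset.sum_div]

lemma ex_mono {f g : Ω → ℝ} (h : ∀ ω, f ω ≤ g ω) : ex f ≤ ex g := by
  unfold ex
  exact div_le_div_of_nonneg_right (Finset.sum_le_sum fun i _ => h i) (Nat.cast_nonneg _)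

lemma ex_nonneg {f : Ω → ℝ} (h : ∀ ω, 0 ≤ f ω) : 0 ≤ ex f := by
  unfold ex
  exact div_nonneg (Finset.sum_nonneg fun i _ => h i) (Nat.cast_nonneg _)

lemma ex_const [Nonempty Ω] (c : ℝ) : ex (fun _ : Ω => c) = c := by
  unfold ex
  have : (Fintype.card Ω : ℝ) ≠ 0 := Nat.cast_ne_zero.mpr Fintype.card_ne_zero
  simp

lemma ex_congr {f g : Ω → ℝ} (h : ∀ ω, f ω = g ω) : ex f = ex g := by
  congr 1; exact funext h

lemma ex_equiv (e : Ω ≃ Ω') (f : Ω' → ℝ) : ex (fun ω => f (e ω)) = ex f := by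
  unfold ex
  rw [Equiv.sum_comp e f, Fintype.card_congr e]

lemma ex_prod (f : Ω × Ω' → ℝ) : ex f = ex fun a => ex fun b => f (a, b) := by
  unfold ex
  rw [Fintype.sum_prod_type, ← Finset.sum_div, Fintype.card_prod, Nat.cast_mul, div_div, mul_comm]

lemma ex_comm (f : Ω → Ω' → ℝ) :
    (ex fun a => ex fun b => f a b) = ex fun b => ex fun a => f a b := by
  have h1 := ex_prod (fun p : Ω × Ω' => f p.1 p.2)
  have h2 := ex_prod (fun p : Ω' × Ω => f p.2 p.1)
  rw [← h1, ← h2]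
  exact (ex_equiv (Equiv.prodComm Ω Ω') (fun p : Ω' × Ω => f p.2 p.1))

lemma exists_le_ex [Nonempty Ω] (f : Ω → ℝ) : ∃ ω, f ω ≤ ex f := by
  by_contra h
  push Not at h
  have hc : (0:ℝ) < Fintype.card Ω := Nat.cast_pos.mpr Fintype.card_pos
  have : ∑ ω : Ω, ex f < ∑ ω, f ω := Finset.sum_lt_sum_of_nonempty univ_nonempty (fun i _ => h i)
  simp only [sum_const, card_univ, nsmul_eq_mul] at this
  unfold ex at this
  rw [mul_div_cancel₀ _ hc.ne'] at this
  exact lt_irrefl _ this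

lemma pr_nonneg (P : Ω → Prop) : 0 ≤ pr P := ex_nonneg fun _ => ind_nonneg _

lemma pr_le_one (P : Ω → Prop) : pr P ≤ 1 := by
  unfold pr ex
  rcases isEmpty_or_nonempty Ω with h | h
  · simp
  · have hc : (0:ℝ) < Fintype.card Ω := Nat.cast_pos.mpr Fintype.card_pos
    rw [div_le_one hc]
    calc ∑ ω, ind (P ω) ≤ ∑ ω : Ω, (1:ℝ) := Finset.sum_le_sum fun i _ => ind_le_one _
      _ = _ := by simp

lemma pr_mono {P Q : Ω → Prop} (h : ∀ ω, P ω → Q ω) : pr P ≤ pr Q :=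
  ex_mono fun ω => ind_mono (h ω)

lemma pr_congr {P Q : Ω → Prop} (h : ∀ ω, P ω ↔ Q ω) : pr P = pr Q :=
  ex_congr fun ω => ind_congr (h ω)

lemma pr_not [Nonempty Ω] (P : Ω → Prop) : pr (fun ω => ¬ P ω) = 1 - pr P := by
  unfold pr
  simp only [ind_not]
  rw [ex_sub, ex_const]

lemma pr_or_le (P Q : Ω → Prop) : pr (fun ω => P ω ∨ Q ω) ≤ pr P + pr Q := by
  unfold pr
  rw [← ex_add]
  refine ex_mono fun ω => ?_
  by_cases hp : P ω <;> by_cases hq : Q ω <;> simp [ind, hp, hq]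

/-- `pr P - pr Q ≤ pr (P ∧ ¬ Q)` -/
lemma pr_and_not_ge (P Q : Ω → Prop) : pr P - pr Q ≤ pr (fun ω => P ω ∧ ¬ Q ω) := by
  unfold pr
  rw [← ex_sub]
  refine ex_mono fun ω => ?_
  by_cases hp : P ω <;> by_cases hq : Q ω <;> simp [ind, hp, hq]

lemma pr_exists_le {ι : Type*} [Fintype ι] (P : ι → Ω → Prop) :
    pr (fun ω => ∃ i, P i ω) ≤ ∑ i, pr (P i) := by
  unfold pr
  rw [← ex_sum]
  refine ex_mono fun ω => ?_
  by_cases h : ∃ i, P i ω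
  · obtain ⟨i, hi⟩ := h
    rw [ind_true ⟨i, hi⟩, ← ind_true hi]
    exact Finset.single_le_sum (f := fun i => ind (P i ω)) (fun j _ => ind_nonneg _) (mem_univ i)
  · rw [ind_false h]; exact Finset.sum_nonneg fun j _ => ind_nonneg _

lemma pr_equiv (e : Ω ≃ Ω') (P : Ω' → Prop) : pr (fun ω => P (e ω)) = pr P :=
  ex_equiv e fun ω => ind (P ω)

lemma pr_prod (P : Ω × Ω' → Prop) : pr P = ex fun a => pr fun b => P (a, b) :=
  ex_prod _

open Classical in
lemma pr_eq_card (P : Ω → Prop) : pr P = ((univ.filter P).card : ℝ) / Fintype.card Ω := by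
  unfold pr ex ind
  simp

/-- Conditional lower bound for a product. -/
lemma pr_prod_ge {P : Ω → Prop} {Q : Ω → Ω' → Prop} {a b : ℝ} (hb : 0 ≤ b)
    (hP : a ≤ pr P) (hQ : ∀ ω, P ω → b ≤ pr (Q ω)) :
    a * b ≤ pr fun x : Ω × Ω' => P x.1 ∧ Q x.1 x.2 := by
  rw [pr_prod]
  calc a * b ≤ pr P * b := mul_le_mul_of_nonneg_right hP hb
    _ = ex (fun ω => ind (P ω) * b) := by rw [ex_mul_right]; rfl
    _ ≤ _ := by
      refine ex_mono fun ω => ?_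
      by_cases h : P ω
      · rw [ind_true h, one_mul]
        exact (hQ ω h).trans (pr_mono fun x hx => ⟨h, hx⟩)
      · rw [ind_false h, zero_mul]; exact pr_nonneg _

end

section pi
variable {ι : Type*} [Fintype ι] [DecidableEq ι] {Ω : Type*} [Fintype Ω]

lemma ex_pi_prod (f : ι → Ω → ℝ) :
    ex (fun ω : ι → Ω => ∏ i, f i (ω i)) = ∏ i, ex (f i) := by
  unfold ex
  rw [Finset.prod_div_distrib, Fintype.prod_sum]
  simp

lemma ind_forall (P : ι → Prop) : ind (∀ i, P i) = ∏ i, ind (P i) := by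
  by_cases h : ∀ i, P i
  · rw [ind_true h]; symm; apply Finset.prod_eq_one; intro i _; exact ind_true (h i)
  · rw [ind_false h]; push Not at h; obtain ⟨i, hi⟩ := h
    exact (Finset.prod_eq_zero (mem_univ i) (ind_false hi)).symm

lemma pr_pi (P : ι → Ω → Prop) : pr (fun ω : ι → Ω => ∀ i, P i (ω i)) = ∏ i, pr (P i) := by
  unfold pr
  simp only [ind_forall]
  exact ex_pi_prod fun i x => ind (P i x)

lemma ex_coord [Nonempty Ω] (i : ι) (g : Ω → ℝ) : ex (fun ω : ι → Ω => g (ω i)) = ex g := by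
  have h := ex_pi_prod (Ω := Ω) (fun j => if j = i then g else fun _ => 1)
  have h1 : ∀ ω : ι → Ω, (∏ j, (if j = i then g else fun _ => 1) (ω j)) = g (ω i) := by
    intro ω
    rw [Finset.prod_eq_single i]
    · simp
    · intro b _ hb; simp [hb]
    · simp
  simp only [h1] at h
  rw [h, Finset.prod_eq_single i]
  · simp
  · intro b _ hb; simp only [hb, if_false]; exact ex_const _
  · simp

lemma pr_coord [Nonempty Ω] (i : ι) (P : Ω → Prop) : pr (fun ω : ι → Ω => P (ω i)) = pr P :=
  ex_coord i fun x => ind (P x)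

lemma pr_mem (X : Finset Ω) : pr (fun x => x ∈ X) = (X.card : ℝ) / Fintype.card Ω := by
  classical
  rw [pr_eq_card]; congr 2
  simp

/-- hitting a fixed set -/
lemma pr_hit_le [Nonempty Ω] (X : Finset Ω) :
    pr (fun ω : ι → Ω => ∃ i, ω i ∈ X) ≤ Fintype.card ι * X.card / Fintype.card Ω := by
  refine (pr_exists_le _).trans ?_
  simp only [pr_coord, pr_mem, sum_const, card_univ, nsmul_eq_mul]
  rw [mul_div_assoc]

lemma pr_coll [Nonempty Ω] {i j : ι} (hij : i ≠ j) :
    pr (fun ω : ι → Ω => ω i = ω j) ≤ 1 / Fintype.card Ω := by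
  have h : ∀ ω : ι → Ω, ind (ω i = ω j) = ∑ v, ind (ω i = v) * ind (ω j = v) := by
    intro ω
    by_cases h : ω i = ω j
    · rw [ind_true h, Finset.sum_eq_single (ω i)]
      · rw [ind_true rfl, ind_true h.symm]; norm_num
      · intro b _ hb; rw [ind_false (Ne.symm hb), zero_mul]
      · simp
    · rw [ind_false h]; symm; apply Finset.sum_eq_zero; intro v _
      by_cases h1 : ω i = v
      · rw [ind_false (p := ω j = v), mul_zero]; intro h2; exact h (h1.trans h2.symm)
      · rw [ind_false h1, zero_mul]
  have h2 : ∀ v : Ω, ex (fun ω : ι → Ω => ind (ω i = v) * ind (ω j = v))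
      = (1 / Fintype.card Ω) * (1 / Fintype.card Ω) := by
    intro v
    have hv : pr (fun x : Ω => x = v) = 1 / Fintype.card Ω := by
      have := pr_mem ({v} : Finset Ω); simpa using this
    have := ex_pi_prod (Ω := Ω) (fun l => if l = i then (fun x => ind (x = v)) else
      if l = j then (fun x => ind (x = v)) else fun _ => 1)
    have h3 : ∀ ω : ι → Ω, (∏ l, (if l = i then (fun x => ind (x = v)) else
      if l = j then (fun x => ind (x = v)) else fun _ => 1) (ω l)) = ind (ω i = v) * ind (ω j = v) := by
      intro ω
      rw [← Finset.mul_prod_erase _ _ (mem_univ i), ← Finset.mul_prod_erase _ _ (mem_erase.mpr ⟨hij.symm, mem_univ j⟩)]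
      rw [Finset.prod_eq_one]
      · simp [hij.symm]
      · intro l hl; simp only [mem_erase] at hl; simp [hl.1, hl.2.1]
    simp only [h3] at this
    rw [this]
    rw [← Finset.mul_prod_erase _ _ (mem_univ i), ← Finset.mul_prod_erase _ _ (mem_erase.mpr ⟨hij.symm, mem_univ j⟩)]
    rw [Finset.prod_eq_one]
    · simp only [if_true, hij.symm, if_false, mul_one]
      change pr _ * pr _ = _
      rw [hv]
    · intro l hl; simp only [mem_erase] at hl; simp only [hl.1, hl.2.1, if_false]; exact ex_const _
  unfold pr
  simp only [h]
  rw [ex_sum]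
  simp only [h2, sum_const, card_univ, nsmul_eq_mul]
  have : (Fintype.card Ω : ℝ) ≠ 0 := Nat.cast_ne_zero.mpr Fintype.card_ne_zero
  apply le_of_eq; field_simp

lemma pr_not_inj_le [Nonempty Ω] :
    pr (fun ω : ι → Ω => ¬ Function.Injective ω) ≤ (Fintype.card ι : ℝ)^2 / Fintype.card Ω := by
  have h1 : pr (fun ω : ι → Ω => ¬ Function.Injective ω) ≤
      pr (fun ω : ι → Ω => ∃ p : ι × ι, p.1 ≠ p.2 ∧ ω p.1 = ω p.2) := by
    refine pr_mono fun ω h => ?_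
    unfold Function.Injective at h
    push Not at h
    obtain ⟨a, b, h1, h2⟩ := h
    exact ⟨(a, b), h2, h1⟩
  refine h1.trans ((pr_exists_le _).trans ?_)
  have : ∀ p : ι × ι, pr (fun ω : ι → Ω => p.1 ≠ p.2 ∧ ω p.1 = ω p.2) ≤ 1 / Fintype.card Ω := by
    intro p
    by_cases hp : p.1 = p.2
    · simp only [hp, ne_eq, not_true, false_and]
      unfold pr; simp only [ind_false not_false]
      rw [ex_const]; positivity
    · exact (pr_mono fun ω h => h.2).trans (pr_coll hp)
  refine (Finset.sum_le_sum fun p _ => this p).trans ?_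
  simp only [sum_const, card_univ, nsmul_eq_mul, Fintype.card_prod]
  apply le_of_eq; push_cast; ring

end pi

end PMx


namespace PMx

open Finset
set_option linter.unusedSectionVars false
set_option linter.unusedVariables false

section han
variable {V : Type} [Fintype V] [DecidableEq V]

lemma exists_top (y : V → ℝ) (s : ℕ) (hs : s ≤ Fintype.card V) :
    ∃ T : Finset V, T.card = s ∧ ∀ x ∈ T, ∀ z ∉ T, y z ≤ y x := by
  induction s with
  | zero => exact ⟨∅, by simp, by simp⟩
  | succ s ih =>
    obtain ⟨T, hT, hTop⟩ := ih (by omega)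
    have hne : (Tᶜ).Nonempty := by
      rw [← Finset.card_pos, Finset.card_compl]; omega
    obtain ⟨a, ha, hmax⟩ := Finset.exists_max_image Tᶜ y hne
    rw [mem_compl] at ha
    refine ⟨insert a T, by rw [card_insert_of_notMem ha, hT], ?_⟩
    intro x hx z hz
    simp only [mem_insert, not_or] at hx hz
    rcases hx with rfl | hx
    · exact hmax z (mem_compl.mpr hz.2)
    · exact hTop x hx z hz.2

lemma ex_insert {M : ℕ} (i : Fin (M+1)) (F : V → (Fin M → V) → ℝ) :
    ex (fun x : Fin (M+1) → V => F (x i) (fun j => x (i.succAbove j))) =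
      ex fun v => ex fun g => F v g := by
  rw [← ex_prod (fun p : V × (Fin M → V) => F p.1 p.2)]
  rw [← ex_equiv (Fin.insertNthEquiv (fun _ => V) i)]
  refine ex_congr fun p => ?_
  simp [Fin.insertNthEquiv]

lemma ex_prod_coord {ι : Type*} [Fintype ι] [DecidableEq ι] (a y : V → ℝ) (j : ι) :
    ex (fun ω : ι → V => (∏ i, a (ω i)) * y (ω j)) =
      ex (fun v => a v * y v) * (ex a) ^ (Fintype.card ι - 1) := by
  have h := ex_pi_prod (Ω := V) (fun i : ι => if i = j then (fun v => a v * y v) else a)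
  have h3 : ∀ ω : ι → V, (∏ l, (if l = j then (fun v => a v * y v) else a) (ω l)) =
      (∏ i, a (ω i)) * y (ω j) := by
    intro ω
    rw [← Finset.mul_prod_erase _ _ (mem_univ j), ← Finset.mul_prod_erase univ _ (mem_univ j)]
    simp only [if_true]
    rw [Finset.prod_congr rfl (g := fun l => a (ω l))]
    · ring
    · intro l hl; simp [ne_of_mem_erase hl]
  simp only [h3] at h
  rw [h, ← Finset.mul_prod_erase _ _ (mem_univ j)]
  simp only [if_true]
  congr 1
  rw [Finset.prod_congr rfl (g := fun l => ex a)]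
  · simp [card_erase_of_mem]
  · intro l hl; simp [ne_of_mem_erase hl]

theorem han_aux (k d M s : ℕ) (hk : k = d + (M+1)) (hM : 1 ≤ M) (hdM : d ≤ M)
    (hcard : Fintype.card V = k * s) (hs : 0 < s) (y : V → ℝ) (hy0 : ∀ v, 0 ≤ y v)
    (hmean : ex y ≤ 1) :
    pr (fun x : Fin (M+1) → V => (k:ℝ) ≤ ∑ i, y (x i)) ≤
      1 - (1 - 1/(k:ℝ))^(M+1) + (M+1) * ((M:ℝ) - d) * (1 - 1/(k:ℝ))^(M-1) / k^2 := by
  have hk0 : 0 < k := by omega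
  have hkR : (0:ℝ) < k := Nat.cast_pos.mpr hk0
  have hsR : (0:ℝ) < s := Nat.cast_pos.mpr hs
  have hkge : s ≤ Fintype.card V := by rw [hcard]; exact Nat.le_mul_of_pos_left s hk0
  obtain ⟨T, hTc, hTop⟩ := exists_top y s hkge
  have hcV : 0 < Fintype.card V := by rw [hcard]; positivity
  haveI : Nonempty V := Fintype.card_pos_iff.mp hcV
  have hTne : T.Nonempty := by rw [← card_pos, hTc]; exact hs
  obtain ⟨v0, hv0, hmin⟩ := Finset.exists_min_image T y hTne
  set t := y v0 with ht
  set θ : ℝ := 1 - 1/(k:ℝ) with hθ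
  have hθ0 : 0 ≤ θ := by
    rw [hθ, sub_nonneg, div_le_one hkR]; exact_mod_cast hk0
  have hrest : ∀ z ∉ T, y z ≤ t := fun z hz => hTop v0 hv0 z hz
  have hprT : pr (fun v => v ∈ T) = 1/(k:ℝ) := by
    rw [pr_mem, hTc, hcard]; push_cast; field_simp
  have hprT' : ex (fun v => ind (v ∉ T)) = θ := by
    have := pr_not (fun v => v ∈ T)
    rw [hprT] at this; exact this
  set r : ℝ := ex (fun v => ind (v ∉ T) * y v) with hr
  have hr0 : 0 ≤ r := ex_nonneg fun v => mul_nonneg (ind_nonneg _) (hy0 v)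
  set τ : ℝ := ex (fun v => ind (v ∈ T) * y v) with hτ
  have hsum : τ + r ≤ 1 := by
    rw [hτ, hr, ← ex_add]
    refine le_trans (le_of_eq (ex_congr fun v => ?_)) hmean
    rw [ind_not]; ring
  have hτt : t / k ≤ τ := by
    have : ex (fun v => ind (v ∈ T) * t) ≤ τ := by
      refine ex_mono fun v => ?_
      by_cases h : v ∈ T
      · rw [ind_true h]; simpa using hmin v h
      · rw [ind_false h]; simp
    rw [ex_mul_right] at this
    change pr _ * t ≤ _ at this
    rw [hprT] at this
    calc t / k = 1 / k * t := by ring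
      _ ≤ _ := this
  set c : ℝ := k - t with hc
  have hrc : r ≤ c / k := by
    have : c / k = 1 - t / k := by rw [hc]; field_simp
    rw [this]; linarith
  set q : ℝ := pr (fun g : Fin M → V => (∀ j, g j ∉ T) ∧ (k:ℝ) ≤ t + ∑ j, y (g j)) with hq
  have hq0 : 0 ≤ q := pr_nonneg _
  set P0 : ℝ := pr (fun x : Fin (M+1) → V => (∀ i, x i ∉ T) ∧ (k:ℝ) ≤ ∑ i, y (x i)) with hP0
  set P1 : ℝ := ex (fun v => ex fun g : Fin M → V =>
    ind (v ∈ T ∧ (∀ j, g j ∉ T) ∧ y v + ∑ j, y (g j) < k)) with hP1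
  -- step (i)
  have h1 : k * P0 ≤ (M+1) * (r * q) := by
    have : k * P0 ≤ ex (fun x : Fin (M+1) → V => ∑ i, (ind (x i ∉ T) * y (x i)) *
        ind ((∀ j, x (i.succAbove j) ∉ T) ∧ (k:ℝ) ≤ t + ∑ j, y (x (i.succAbove j)))) := by
      rw [hP0, pr, ← ex_mul_left]
      refine ex_mono fun x => ?_
      by_cases h : (∀ i, x i ∉ T) ∧ (k:ℝ) ≤ ∑ i, y (x i)
      · rw [ind_true h, mul_one]
        refine h.2.trans (Finset.sum_le_sum fun i _ => ?_)
        rw [ind_true (h.1 i), ind_true, one_mul, mul_one]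
        refine ⟨fun j => h.1 _, h.2.trans ?_⟩
        rw [Fin.sum_univ_succAbove _ i]
        have := hrest _ (h.1 i)
        linarith
      · rw [ind_false h, mul_zero]
        exact Finset.sum_nonneg fun i _ => mul_nonneg (mul_nonneg (ind_nonneg _) (hy0 _)) (ind_nonneg _)
    refine this.trans (le_of_eq ?_)
    rw [ex_sum]
    have : ∀ i : Fin (M+1), ex (fun x : Fin (M+1) → V => (ind (x i ∉ T) * y (x i)) *
        ind ((∀ j, x (i.succAbove j) ∉ T) ∧ (k:ℝ) ≤ t + ∑ j, y (x (i.succAbove j)))) = r * q := by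
      intro i
      rw [ex_insert i (fun v g => (ind (v ∉ T) * y v) *
        ind ((∀ j, g j ∉ T) ∧ (k:ℝ) ≤ t + ∑ j, y (g j)))]
      simp only [ex_mul_left]
      rw [ex_mul_right]; rfl
    simp only [this]
    simp
  -- step (ii)
  have hav : ex (fun g : Fin M → V => ind (∀ j, g j ∉ T)) = θ^M := by
    have := pr_pi (ι := Fin M) (fun _ v => v ∉ T)
    unfold pr at this
    rw [this, hprT']; simp
  have hW : ex (fun g : Fin M → V => ind (∀ j, g j ∉ T) * ∑ j, y (g j)) = M * (r * θ^(M-1)) := by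
    simp only [Finset.mul_sum]
    rw [ex_sum]
    have : ∀ j : Fin M, ex (fun g : Fin M → V => ind (∀ j, g j ∉ T) * y (g j)) = r * θ^(M-1) := by
      intro j
      simp only [ind_forall]
      rw [ex_prod_coord (fun v => ind (v ∉ T)) y j, hprT']; simp [hr]
    simp only [this]; simp
  have hcq : c * q ≤ M * (r * θ^(M-1)) := by
    rw [← hW, hq, pr, ← ex_mul_left]
    refine ex_mono fun g => ?_
    have hs0 : 0 ≤ ∑ j, y (g j) := Finset.sum_nonneg fun j _ => hy0 _
    by_cases h : (∀ j, g j ∉ T) ∧ (k:ℝ) ≤ t + ∑ j, y (g j)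
    · rw [ind_true h, ind_true h.1]; linarith [h.2]
    · rw [ind_false h, mul_zero]; exact mul_nonneg (ind_nonneg _) hs0
  have hP1ge : c ≥ 0 → θ^(M-1) * r * d / k ≤ c * P1 := by
    intro hc0
    have hpt : ∀ v, ∀ g : Fin M → V, ind (v ∈ T) * ind (∀ j, g j ∉ T) * (k - y v)
        - ind (v ∈ T) * (ind (∀ j, g j ∉ T) * ∑ j, y (g j)) ≤
        c * ind (v ∈ T ∧ (∀ j, g j ∉ T) ∧ y v + ∑ j, y (g j) < k) := by
      intro v g
      have hs0 : 0 ≤ ∑ j, y (g j) := Finset.sum_nonneg fun j _ => hy0 _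
      by_cases h : v ∈ T
      · by_cases h' : ∀ j, g j ∉ T
        · rw [ind_true h, ind_true h']
          have := hmin v h
          by_cases h3 : y v + ∑ j, y (g j) < k
          · rw [ind_true ⟨h, h', h3⟩]; linarith
          · rw [ind_false (fun h4 => h3 h4.2.2)]; linarith
        · rw [ind_false h']; simp only [mul_zero, zero_mul, sub_zero]
          exact mul_nonneg hc0 (ind_nonneg _)
      · rw [ind_false h]; simp only [zero_mul, sub_zero]
        exact mul_nonneg hc0 (ind_nonneg _)
    have h2 : ex (fun v => ex fun g : Fin M → V => ind (v ∈ T) * ind (∀ j, g j ∉ T) * (k - y v)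
        - ind (v ∈ T) * (ind (∀ j, g j ∉ T) * ∑ j, y (g j))) ≤ c * P1 := by
      rw [hP1, ← ex_mul_left]
      refine ex_mono fun v => ?_
      rw [← ex_mul_left]
      exact ex_mono fun g => hpt v g
    refine le_trans ?_ h2
    simp only [ex_sub, ex_mul_right, ex_mul_left, hav, hW]
    have h3 : ex (fun v => ind (v ∈ T) * θ^M * (k - y v)) = θ^M * (1 - τ) := by
      have : ∀ v, ind (v ∈ T) * θ^M * (k - y v) = θ^M * (ind (v ∈ T) * k - ind (v ∈ T) * y v) := by
        intro v; ring
      simp only [this, ex_mul_left, ex_sub, ex_mul_right]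
      change _ * (pr _ * _ - _) = _
      rw [hprT, ← hτ]; field_simp
    have h4 : ex (fun v => ind (v ∈ T)) = 1/(k:ℝ) := hprT
    rw [h3, h4]
    have h5 : θ^M = θ^(M-1) * θ := by rw [← pow_succ]; congr 1; omega
    have h6 : (d:ℝ) = k - (M+1) := by rw [hk]; push_cast; ring
    have h7 : θ^M * r ≤ θ^M * (1 - τ) := mul_le_mul_of_nonneg_left (by linarith) (pow_nonneg hθ0 _)
    have h8 : θ^(M-1) * r * d / k = θ^M * r - 1/k * (M * (r * θ^(M-1))) := by
      rw [h5, h6, hθ]; field_simp; ring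
    rw [h8]; linarith
  -- pointwise decomposition
  have hdec : pr (fun x : Fin (M+1) → V => (k:ℝ) ≤ ∑ i, y (x i)) ≤ 1 - θ^(M+1) + P0 - (M+1) * P1 := by
    have hno : ex (fun x : Fin (M+1) → V => ind (∀ j, x j ∉ T)) = θ^(M+1) := by
      have := pr_pi (ι := Fin (M+1)) (fun _ v => v ∉ T)
      unfold pr at this
      rw [this, hprT']; simp
    have hP1s : (M+1) * P1 = ex (fun x : Fin (M+1) → V => ∑ i, ind (x i ∈ T ∧
        (∀ j, x (i.succAbove j) ∉ T) ∧ y (x i) + ∑ j, y (x (i.succAbove j)) < k)) := by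
      rw [ex_sum]
      have : ∀ i : Fin (M+1), ex (fun x : Fin (M+1) → V => ind (x i ∈ T ∧
        (∀ j, x (i.succAbove j) ∉ T) ∧ y (x i) + ∑ j, y (x (i.succAbove j)) < k)) = P1 := fun i =>
        ex_insert i (fun v g => ind (v ∈ T ∧ (∀ j, g j ∉ T) ∧ y v + ∑ j, y (g j) < k))
      simp only [this]; simp
    rw [hP1s, ← hno, hP0, pr, pr, ← ex_const (Ω := Fin (M+1) → V) 1, ← ex_sub, ← ex_add, ← ex_sub]
    refine ex_mono fun x => ?_
    have hsplit : ∀ i : Fin (M+1), y (x i) + ∑ j, y (x (i.succAbove j)) = ∑ i, y (x i) :=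
      fun i => (Fin.sum_univ_succAbove (fun l => y (x l)) i).symm
    simp only [hsplit]
    by_cases hF : (k:ℝ) ≤ ∑ i, y (x i)
    · rw [Finset.sum_eq_zero (fun i _ => ind_false (fun h => (not_lt.mpr hF) h.2.2)), ind_true hF]
      by_cases h : ∀ i, x i ∉ T
      · rw [ind_true h, ind_true ⟨h, hF⟩]; norm_num
      · rw [ind_false h]; linarith [ind_nonneg ((∀ i, x i ∉ T) ∧ (k:ℝ) ≤ ∑ i, y (x i))]
    · rw [ind_false hF, ind_false (p := (∀ i, x i ∉ T) ∧ (k:ℝ) ≤ ∑ i, y (x i)) (fun h => hF h.2)]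
      by_cases h : ∀ i, x i ∉ T
      · rw [ind_true h, Finset.sum_eq_zero (fun i _ => ind_false (fun h' => h i h'.1))]; norm_num
      · rw [ind_false h]
        by_cases h' : ∃ i, x i ∈ T ∧ (∀ j, x (i.succAbove j) ∉ T) ∧ ∑ i, y (x i) < k
        · obtain ⟨i, hi⟩ := h'
          rw [Finset.sum_eq_single i]
          · rw [ind_true hi]; norm_num
          · intro b _ hb
            apply ind_false
            intro h5
            obtain ⟨j, hj⟩ := Fin.exists_succAbove_eq hb
            exact hi.2.1 j (hj ▸ h5.1)
          · simp
        · push Not at h'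
          rw [Finset.sum_eq_zero (fun i _ => ind_false ?_)]
          · norm_num
          · intro h5; exact absurd h5.2.2 (not_lt.mpr (h' i h5.1 h5.2.1))
  have hP1nn : 0 ≤ P1 := ex_nonneg fun v => ex_nonneg fun g => ind_nonneg _
  have hfin : P0 - (M+1) * P1 ≤ (M+1) * ((M:ℝ) - d) * θ^(M-1) / k^2 := by
    have hMd : (0:ℝ) ≤ (M:ℝ) - d := sub_nonneg.mpr (by exact_mod_cast hdM)
    have hMR : (1:ℝ) ≤ M := by exact_mod_cast hM
    have hθp : 0 ≤ θ^(M-1) := pow_nonneg hθ0 _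
    rcases le_or_gt c 0 with hc0 | hc0
    · have hr00 : r = 0 := le_antisymm (hrc.trans (div_nonpos_of_nonpos_of_nonneg hc0 hkR.le)) hr0
      rw [hr00] at h1
      have : P0 ≤ 0 := by
        by_contra hcon; push Not at hcon
        have := mul_pos hkR hcon; linarith
      have h3 : 0 ≤ (M+1) * ((M:ℝ) - d) * θ^(M-1) / k^2 := by positivity
      have h4 : 0 ≤ (M+1) * P1 := by positivity
      linarith
    · have hqb : q ≤ M * θ^(M-1) / k := by
        have : c * q ≤ c * (M * θ^(M-1) / k) := by
          refine hcq.trans ?_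
          calc M * (r * θ^(M-1)) ≤ M * (c / k * θ^(M-1)) := by gcongr
            _ = _ := by ring
        exact le_of_mul_le_mul_left this hc0
      have hP1b : q * d / (k * M) ≤ P1 := by
        have h2 := hP1ge hc0.le
        have : c * (q * d / (k * M)) ≤ c * P1 := by
          refine le_trans ?_ h2
          calc c * (q * d / (k * M)) = (c * q) * (d / (k * M)) := by ring
            _ ≤ M * (r * θ^(M-1)) * (d / (k * M)) := by gcongr
            _ = θ^(M-1) * r * d / k := by field_simp
        exact le_of_mul_le_mul_left this hc0
      have ht0 : 0 ≤ t := hy0 v0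
      have hr1 : r ≤ 1 := hrc.trans (by rw [div_le_one hkR, hc]; linarith)
      have hP0b : P0 ≤ (M+1) * q / k := by
        rw [le_div_iff₀ hkR, mul_comm]
        refine h1.trans ?_
        have : r * q ≤ 1 * q := by gcongr
        nlinarith
      calc P0 - (M+1) * P1 ≤ (M+1) * q / k - (M+1) * (q * d / (k * M)) := by gcongr
        _ = (M+1) * ((M - d) / (k * M)) * q := by field_simp
        _ ≤ (M+1) * ((M - d) / (k * M)) * (M * θ^(M-1) / k) := by gcongr
        _ = _ := by field_simp
  linarith

/-- Homogeneous form. -/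
theorem han (k d M s : ℕ) (hk : k = d + (M+1)) (hM : 1 ≤ M) (hdM : d ≤ M)
    (hcard : Fintype.card V = k * s) (hs : 0 < s) (y : V → ℝ) (hy0 : ∀ v, 0 ≤ y v) (μ : ℝ)
    (hmean : ex y ≤ μ) :
    pr (fun x : Fin (M+1) → V => k * μ < ∑ i, y (x i)) ≤
      1 - (1 - 1/(k:ℝ))^(M+1) + (M+1) * ((M:ℝ) - d) * (1 - 1/(k:ℝ))^(M-1) / k^2 := by
  have hk0 : 0 < k := by omega
  have hkR : (0:ℝ) < k := Nat.cast_pos.mpr hk0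
  have hcV : 0 < Fintype.card V := by rw [hcard]; positivity
  have hcR : (0:ℝ) < Fintype.card V := Nat.cast_pos.mpr hcV
  rcases (ex_nonneg hy0).trans hmean |>.eq_or_lt with h0 | hpos
  · have hz : ∀ v, y v = 0 := by
      have h1 : ∑ v, y v = 0 := by
        have : ex y = 0 := le_antisymm (h0 ▸ hmean) (ex_nonneg hy0)
        unfold ex at this
        rcases div_eq_zero_iff.mp this with h | h
        · exact h
        · exact absurd h hcR.ne'
      intro v
      exact (Finset.sum_eq_zero_iff_of_nonneg (fun v _ => hy0 v)).mp h1 v (mem_univ v)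
    have h2 := han_aux k d M s hk hM hdM hcard hs (fun _ => (0:ℝ)) (fun _ => le_rfl) (by simp [ex])
    refine le_trans (pr_mono ?_) h2
    intro x hx
    simp [hz, ← h0] at hx
  · have h2 := han_aux k d M s hk hM hdM hcard hs (fun v => y v / μ) (fun v => div_nonneg (hy0 v) hpos.le)
      (by
        have : ex (fun v => y v / μ) = ex y / μ := by simp only [div_eq_mul_inv]; exact ex_mul_right _ _
        rw [this, div_le_one hpos]; exact hmean)
    refine le_trans (pr_mono ?_) h2
    intro x hx
    rw [← Finset.sum_div, le_div_iff₀ hpos]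
    exact hx.le

end han
end PMx


namespace PMx

open Finset
set_option linter.unusedSectionVars false
set_option linter.unusedVariables false

lemma exp58 : Real.exp (0.58) < 1.8 := by
  have h1 : Real.exp 0.58 ^ 50 = Real.exp 1 ^ 29 := by
    rw [← Real.exp_nat_mul, ← Real.exp_nat_mul]; norm_num
  have h2 : Real.exp 1 ^ 29 < 2.7182818286 ^ 29 :=
    pow_lt_pow_left₀ Real.exp_one_lt_d9 (Real.exp_pos _).le (by norm_num)
  have h3 : Real.exp 0.58 ^ 50 < 1.8 ^ 50 := by
    rw [h1]; refine h2.trans ?_; norm_num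
  exact lt_of_pow_lt_pow_left₀ 50 (by norm_num) h3

lemma numC (y : ℝ) (hy0 : 0 < y) (hy6 : y ≤ 1/6) :
    1/2 < (1/1.8 * (1 - 0.29 * y - 0.58 * y^2)) * (0.9072 + 0.3944 * y + 0.4872 * y^2) := by
  have hy2 : y^2 ≤ y * (1/6) := by
    rw [pow_two]; exact mul_le_mul_of_nonneg_left hy6 hy0.le
  have hy3 : y^3 ≤ y^2 * (1/6) := by
    rw [pow_succ]; exact mul_le_mul_of_nonneg_left hy6 (by positivity)
  have hy4 : y^4 ≤ y^3 * (1/6) := by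
    rw [pow_succ]; exact mul_le_mul_of_nonneg_left hy6 (by positivity)
  have e : (1/1.8 * (1 - 0.29 * y - 0.58 * y^2)) * (0.9072 + 0.3944 * y + 0.4872 * y^2) =
    1/1.8 * (0.9072 + (0.3944 - 0.29*0.9072) * y + (0.4872 - 0.29*0.3944 - 0.58*0.9072)*y^2
      - (0.29*0.4872+0.58*0.3944) * y^3 - 0.58*0.4872*y^4) := by ring
  rw [e]
  norm_num
  norm_num at hy2 hy3 hy4
  linarith

lemma numeric_main (k d M : ℕ) (hd : 1 ≤ d) (hdk : 2 * d < k) (hk : k = d + (M+1))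
    (h42 : 0.42 * (k : ℝ) ≤ (d : ℝ)) :
    (1 - (1 - 1/(k:ℝ))^(M+1)) + (M+1) * ((M:ℝ) - d) * (1 - 1/(k:ℝ))^(M-1) / k^2 < 1/2 := by
  have hk7 : 7 ≤ k := by
    by_contra hcon
    have h5 : (42:ℝ) * k ≤ 100 * d := by linarith
    have h6 : 42 * k ≤ 100 * d := by exact_mod_cast h5
    omega
  have hM : 1 ≤ M := by omega
  have hkR : (7:ℝ) ≤ k := by exact_mod_cast hk7
  have hMd : (M:ℝ) + 1 = k - d := by rw [hk]; push_cast; ring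
  have hm : (M:ℝ) + 1 ≤ 0.58 * k := by rw [hMd]; linarith
  have hmd : (M:ℝ) - d ≤ 0.16 * k - 1 := by linarith
  have hMd0 : (0:ℝ) ≤ (M:ℝ) - d := by
    have : d ≤ M := by omega
    have : (d:ℝ) ≤ M := by exact_mod_cast this
    linarith
  set x : ℝ := 1/(k:ℝ) with hx
  set y : ℝ := 1/((k:ℝ)-1) with hy
  have hx0 : 0 < x := by positivity
  have hk1 : (0:ℝ) < (k:ℝ) - 1 := by linarith
  have hy0 : 0 < y := by positivity
  have hxy : x ≤ y := by
    rw [hx, hy]; apply one_div_le_one_div_of_le hk1; linarith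
  have hy6 : y ≤ 1/6 := by
    rw [hy]; apply one_div_le_one_div_of_le <;> linarith
  have hx1 : x < 1 := by linarith
  set θ : ℝ := 1 - x with hθ
  have hθ0 : 0 < θ := by rw [hθ]; linarith
  have hθk : θ * k = k - 1 := by rw [hθ, hx]; field_simp
  -- rewrite
  have hrew : (M+1) * ((M:ℝ) - d) * θ^(M-1) / k^2 = θ^(M+1) * ((M+1) * ((M:ℝ) - d) * y^2) := by
    have h1 : θ^(M+1) = θ^(M-1) * θ^2 := by rw [← pow_add]; congr 1; omega
    have h2 : θ^2 * y^2 = 1/k^2 := by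
      have : θ = (k-1)/k := by rw [eq_div_iff (by positivity)]; exact hθk
      rw [this, hy]; field_simp
    rw [h1]
    calc (M+1) * ((M:ℝ) - d) * θ^(M-1) / k^2 = (M+1) * ((M:ℝ) - d) * θ^(M-1) * (1/k^2) := by ring
      _ = _ := by rw [← h2]; ring
  rw [hrew]
  have hh : (M+1) * ((M:ℝ) - d) * y^2 ≤ 0.0928 - 0.3944 * y - 0.4872 * y^2 := by
    have h1 : (M+1) * ((M:ℝ) - d) ≤ (0.58 * k) * (0.16 * k - 1) := by
      apply mul_le_mul hm hmd hMd0; positivity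
    calc (M+1) * ((M:ℝ) - d) * y^2 ≤ ((0.58 * k) * (0.16 * k - 1)) * y^2 := by gcongr
      _ = _ := by
        have : (k:ℝ) * y = 1 + y := by rw [hy]; field_simp; ring
        have h3 : ((0.58 * k) * (0.16 * k - 1)) * y^2 = 0.58 * (k*y) * (0.16 * (k*y) - y) := by ring
        rw [h3, this]; ring
  have hlog : -(x + x^2/2 + x^3/(1-x)) ≤ Real.log θ := by
    have := Real.abs_log_sub_add_sum_range_le (x := x) (by rw [abs_of_pos hx0]; exact hx1) 2
    rw [abs_of_pos hx0] at this
    have h2 := (abs_le.mp this).1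
    simp [Finset.sum_range_succ] at h2
    norm_num at h2
    rw [hθ]; linarith
  have hpow : Real.exp (-0.58) * (1 - 0.29 * y - 0.58 * y^2) ≤ θ^(M+1) := by
    have h1 : θ^(M+1) = Real.exp ((M+1) * Real.log θ) := by
      have : ((M:ℝ)+1) = ((M+1 : ℕ) : ℝ) := by push_cast; ring
      rw [this, Real.exp_nat_mul, Real.exp_log hθ0]
    have h2 : (M+1) * Real.log θ ≥ -0.58 + (- 0.29 * y - 0.58 * y^2) := by
      have h3 : (M+1) * Real.log θ ≥ -((M+1) * (x + x^2/2 + x^3/(1-x))) := by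
        have : (0:ℝ) ≤ M + 1 := by positivity
        nlinarith
      have h1x : 0 < 1 - x := hθ0
      have h4 : (M+1) * (x + x^2/2 + x^3/(1-x)) ≤ 0.58 * k * (x + x^2/2 + x^3/(1-x)) := by
        apply mul_le_mul_of_nonneg_right hm; positivity
      have h5 : 0.58 * k * (x + x^2/2 + x^3/(1-x)) = 0.58 + 0.29 * x + 0.58 * (x * y) := by
        have hkx : k * x = 1 := by rw [hx]; field_simp
        have hyx : x / (1-x) = y := by
          rw [hx, hy]; field_simp
        have : 0.58 * k * (x + x^2/2 + x^3/(1-x)) = 0.58 * (k*x) * (1 + x/2 + x * (x/(1-x))) := by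
          field_simp
        rw [this, hkx, hyx]; ring
      have h6 : x * y ≤ y^2 := by nlinarith
      linarith
    rw [h1]
    calc Real.exp (-0.58) * (1 - 0.29 * y - 0.58 * y^2)
        ≤ Real.exp (-0.58) * Real.exp (- 0.29 * y - 0.58 * y^2) := by
          apply mul_le_mul_of_nonneg_left _ (Real.exp_pos _).le
          have := Real.add_one_le_exp (- 0.29 * y - 0.58 * y^2)
          linarith
      _ = Real.exp (-0.58 + (- 0.29 * y - 0.58 * y^2)) := by rw [Real.exp_add]
      _ ≤ _ := Real.exp_le_exp.mpr h2
  have hE : 1/1.8 < Real.exp (-0.58) := by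
    rw [Real.exp_neg, ← one_div]
    exact one_div_lt_one_div_of_lt (Real.exp_pos _) exp58
  have hpos : 0 < 1 - 0.29 * y - 0.58 * y^2 := by nlinarith
  have hpow2 : 1/1.8 * (1 - 0.29 * y - 0.58 * y^2) ≤ θ^(M+1) :=
    (mul_le_mul_of_nonneg_right hE.le hpos.le).trans hpow
  have hA : 0.9072 + 0.3944 * y + 0.4872 * y^2 ≤ 1 - (M+1) * ((M:ℝ) - d) * y^2 := by linarith
  have hB : (1/1.8 * (1 - 0.29 * y - 0.58 * y^2)) * (0.9072 + 0.3944 * y + 0.4872 * y^2) ≤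
      θ^(M+1) * (1 - (M+1) * ((M:ℝ) - d) * y^2) := by
    apply mul_le_mul hpow2 hA
    · positivity
    · positivity
  have hC : 1/2 < (1/1.8 * (1 - 0.29 * y - 0.58 * y^2)) * (0.9072 + 0.3944 * y + 0.4872 * y^2) := by
    exact numC y hy0 hy6
  linarith

lemma numeric (k d M : ℕ) (hd : 1 ≤ d) (hdk : 2 * d < k) (hk : k = d + (M+1))
    (hcase : (0.42 * (k : ℝ) ≤ (d : ℝ)) ∨ (k = 12 ∧ d = 5) ∨ (k = 17 ∧ d = 7)) :
    (1 - (1 - 1/(k:ℝ))^(M+1)) + (M+1) * ((M:ℝ) - d) * (1 - 1/(k:ℝ))^(M-1) / k^2 < 1/2 := by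
  rcases hcase with h | ⟨rfl, rfl⟩ | ⟨rfl, rfl⟩
  · exact numeric_main k d M hd hdk hk h
  · obtain rfl : M = 6 := by omega
    norm_num
  · obtain rfl : M = 9 := by omega
    norm_num

end PMx


namespace PMx

open Finset
set_option linter.unusedSectionVars false
set_option linter.unusedVariables false

section defs
variable {V : Type} [Fintype V] [DecidableEq V]

/-- the tuple `f` spans an edge -/
def Ed (H : Finset (Finset V)) {ι : Type} [Fintype ι] (f : ι → V) : Prop := univ.image f ∈ H

def DegC (H : Finset (Finset V)) (d m : ℕ) (γ : ℝ) : Prop :=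
  ∀ s : Fin d → V, Function.Injective s →
    1/2 - γ ≤ pr (fun x : Fin m → V => Ed H (Sum.elim s x))

end defs

section frac
variable {V : Type} [Fintype V] [DecidableEq V] {Ω : Type} [Fintype Ω]

lemma sum_mul_ind {α : Type*} [Fintype α] [DecidableEq α] (F : α → ℝ) (a : α) :
    ∑ v, ind (a = v) * F v = F a := by
  rw [Finset.sum_eq_single a]
  · rw [ind_true rfl, one_mul]
  · intro b _ hb; rw [ind_false (fun h => hb h.symm), zero_mul]
  · simp

/-- LP duality by Hahn-Banach. -/
lemma lp_dual [Nonempty V] [Nonempty Ω] (E : Ω → Prop) (c : Ω → V → ℝ) (k B : ℝ)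
    (hc : ∀ ω, ∑ v, c ω v = k)
    (hyp : ∀ F : V → ℝ, ex F = 0 → ∃ g : Ω → ℝ, (∀ ω, 0 ≤ g ω ∧ g ω ≤ B * ind (E ω)) ∧ ex g = 1 ∧
      ex (fun ω => g ω * ∑ v, c ω v * F v) ≤ 0) :
    ∃ g : Ω → ℝ, (∀ ω, 0 ≤ g ω ∧ g ω ≤ B * ind (E ω)) ∧ ex g = 1 ∧
      ∀ v, ex (fun ω => g ω * c ω v) = k / Fintype.card V := by
  set n : ℝ := ((Fintype.card V : ℕ) : ℝ) with hn
  have hn0 : 0 < n := Nat.cast_pos.mpr Fintype.card_pos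
  let K : Set (Ω → ℝ) := {g | (∀ ω, 0 ≤ g ω ∧ g ω ≤ B * ind (E ω)) ∧ ex g = 1}
  have hcont : Continuous (fun g : Ω → ℝ => ex g) := by unfold ex; fun_prop
  have hK : K = (Set.pi Set.univ fun ω => Set.Icc 0 (B * ind (E ω))) ∩ (fun g => ex g) ⁻¹' {1} := by
    ext g; simp only [K, Set.mem_ofPred_eq, Set.mem_inter_iff, Set.mem_pi, Set.mem_univ, true_imp_iff, Set.mem_Icc, Set.mem_preimage, Set.mem_singleton_iff]
  have hKc : IsCompact K := by
    rw [hK]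
    exact (isCompact_univ_pi fun ω => isCompact_Icc).inter_right (isClosed_singleton.preimage hcont)
  have hKconv : Convex ℝ K := by
    intro g hg g' hg' a b ha hb hab
    refine ⟨fun ω => ⟨?_, ?_⟩, ?_⟩
    · have := (hg.1 ω).1; have := (hg'.1 ω).1
      simp only [Pi.add_apply, Pi.smul_apply, smul_eq_mul]; positivity
    · have h1 := mul_le_mul_of_nonneg_left (hg.1 ω).2 ha
      have h2 := mul_le_mul_of_nonneg_left (hg'.1 ω).2 hb
      simp only [Pi.add_apply, Pi.smul_apply, smul_eq_mul]
      calc a * g ω + b * g' ω ≤ (a + b) * (B * ind (E ω)) := by linarith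
        _ = _ := by rw [hab, one_mul]
    · have : ex (a • g + b • g') = a * ex g + b * ex g' := by
        rw [← ex_mul_left, ← ex_mul_left, ← ex_add]; rfl
      rw [this, hg.2, hg'.2]; linarith
  let Λ : (Ω → ℝ) →ₗ[ℝ] (V → ℝ) :=
    { toFun := fun g v => ex (fun ω => g ω * c ω v) - k / n * ex g
      map_add' := by
        intro g g'; funext v
        have h1 : ex (g + g') = ex g + ex g' := ex_add g g'
        simp only [Pi.add_apply, add_mul, ex_add, h1]; ring
      map_smul' := by
        intro a g; funext v
        have h1 : ex (a • g) = a * ex g := ex_mul_left a g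
        simp only [Pi.smul_apply, smul_eq_mul, mul_assoc, ex_mul_left, h1, RingHom.id_apply]; ring }
  by_cases h0 : (0 : V → ℝ) ∈ Λ '' K
  · obtain ⟨g, hg, hg0⟩ := h0
    refine ⟨g, hg.1, hg.2, fun v => ?_⟩
    have := congrFun hg0 v
    simp only [Λ, LinearMap.coe_mk, AddHom.coe_mk, Pi.zero_apply, hg.2] at this
    linarith
  · exfalso
    have hcl : IsClosed (Λ '' K) := (hKc.image Λ.continuous_of_finiteDimensional).isClosed
    have hcv : Convex ℝ (Λ '' K) := hKconv.linear_image Λ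
    obtain ⟨f, u, hu, hb⟩ := geometric_hahn_banach_point_closed hcv hcl h0
    rw [map_zero] at hu
    let F0 : V → ℝ := fun v => f (Pi.single v 1)
    have hf : ∀ b : V → ℝ, f b = ∑ v, F0 v * b v := by
      intro b
      conv_lhs => rw [pi_eq_sum_univ' b]
      rw [map_sum]
      refine Finset.sum_congr rfl fun v _ => ?_
      have : (fun j => if v = j then (1:ℝ) else 0) = Pi.single v 1 := by
        funext j; simp [Pi.single_apply, eq_comm]
      rw [map_smul, smul_eq_mul]
      simp only [F0]
      rw [mul_comm]
    let F : V → ℝ := fun v => F0 v - ex F0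
    have hF : ex F = 0 := by
      have : ex F = ex F0 - ex (fun _ : V => ex F0) := ex_sub _ _
      rw [this, ex_const]; ring
    obtain ⟨g, hg1, hg2, hg3⟩ := hyp F hF
    have h1 := hb (Λ g) ⟨g, ⟨hg1, hg2⟩, rfl⟩
    rw [hf] at h1
    have h2 : ∑ v, F0 v * (Λ g) v = ex (fun ω => g ω * ∑ v, c ω v * F v) := by
      have e1 : ∀ ω, g ω * ∑ v, c ω v * F v =
          ∑ v, F0 v * (g ω * c ω v) - (k * ex F0) * g ω := by
        intro ω
        have : ∑ v, c ω v * F v = ∑ v, c ω v * F0 v - k * ex F0 := by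
          simp only [F, mul_sub, Finset.sum_sub_distrib, ← Finset.sum_mul, hc]
        rw [this, mul_sub, Finset.mul_sum]
        congr 1
        · refine Finset.sum_congr rfl fun v _ => ?_; ring
        · ring
      simp only [e1, ex_sub, ex_sum, ex_mul_left, hg2]
      have e2 : ∀ v, (Λ g) v = ex (fun ω => g ω * c ω v) - k / n := by
        intro v; simp only [Λ, LinearMap.coe_mk, AddHom.coe_mk, hg2, mul_one]
      simp only [e2, mul_sub, Finset.sum_sub_distrib, ← Finset.sum_mul]
      congr 1
      unfold ex; rw [← hn]; ring
    rw [h2] at h1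
    linarith
end frac
end PMx


namespace PMx

open Finset
set_option linter.unusedSectionVars false
set_option linter.unusedVariables false

section frac
variable {V : Type} [Fintype V] [DecidableEq V]

lemma ex_push {J Ω : Type} [Fintype J] [Fintype Ω] [Nonempty J] [Nonempty Ω] (Λ : J → Ω)
    (hΛ : Function.Injective Λ) (φ : Ω → ℝ) :
    ex (fun s => ind (∃ j, Λ j = s) * φ s) =
      ((Fintype.card J : ℝ) / Fintype.card Ω) * ex (fun j => φ (Λ j)) := by
  classical
  have hJ : (Fintype.card J : ℝ) ≠ 0 := Nat.cast_ne_zero.mpr Fintype.card_ne_zero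
  have h1 : ∑ s, ind (∃ j, Λ j = s) * φ s = ∑ j, φ (Λ j) := by
    rw [← Finset.sum_image (s := univ) (g := Λ) (f := φ) (fun a _ b _ h => hΛ h)]
    rw [← Finset.sum_filter_add_sum_filter_not univ (fun s => s ∈ univ.image Λ)]
    have h2 : ∑ x with x ∉ univ.image Λ, ind (∃ j, Λ j = x) * φ x = 0 := by
      apply Finset.sum_eq_zero
      intro x hx
      rw [ind_false, zero_mul]
      simpa using hx
    rw [h2, add_zero]
    apply Finset.sum_congr
    · ext x; simp
    · intro x hx
      rw [ind_true, one_mul]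
      simpa using hx
  unfold ex
  rw [h1]; field_simp

lemma frac_test (k d M s ℓ : ℕ) (hk : k = d + (M+1)) (hM : 1 ≤ M) (hdM : d ≤ M) (hd : 1 ≤ d)
    (hcard : Fintype.card V = k * s) (hs : 0 < s) (hℓ : 0 < ℓ) (hℓn : d * ℓ ≤ k * s)
    (H : Finset (Finset V)) (γ η : ℝ) (hη : 0 < η) (hDeg : DegC H d (M+1) γ)
    (hG : η + (1 - (1 - 1/(k:ℝ))^(M+1) + (M+1) * ((M:ℝ) - d) * (1 - 1/(k:ℝ))^(M-1) / k^2) + γ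
      + (M+1) * (d * ℓ) / (k*s) ≤ 1/2) (F : V → ℝ) (hF : ex F = 0) :
    ∃ g : (Fin d → V) × (Fin (M+1) → V) → ℝ,
      (∀ ω, 0 ≤ g ω ∧ g ω ≤ (((k*s:ℝ)/ℓ)^d/η) * ind (Ed H (Sum.elim ω.1 ω.2))) ∧ ex g = 1 ∧
      ex (fun ω => g ω * (∑ i, F (ω.1 i) + ∑ i, F (ω.2 i))) ≤ 0 := by
  classical
  have hk0 : 0 < k := by omega
  have hcV : 0 < Fintype.card V := by rw [hcard]; positivity
  have : Nonempty V := Fintype.card_pos_iff.mp hcV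
  have : Nonempty (Fin ℓ) := ⟨⟨0, hℓ⟩⟩
  have : Nonempty (Fin d) := ⟨⟨0, hd⟩⟩
  have hcR : (Fintype.card V : ℝ) = k * s := by rw [hcard]; push_cast; ring
  have hksR : (0:ℝ) < k * s := by positivity
  obtain ⟨L, hL, hbot⟩ := exists_top (fun v => - F v) (d*ℓ) (by rw [hcard]; exact hℓn)
  have hLF : ∀ x ∈ L, ∀ z ∉ L, F x ≤ F z := fun x hx z hz => by
    have := hbot x hx z hz; linarith
  have hcL : Fintype.card (Fin d × Fin ℓ) = Fintype.card L := by simp [hL]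
  let e : (Fin d × Fin ℓ) ≃ L := Fintype.equivOfCardEq hcL
  let lam : Fin d × Fin ℓ → V := fun p => e p
  have hlamL : ∀ p, lam p ∈ L := fun p => (e p).2
  have hlamI : Function.Injective lam := fun p q h => e.injective (Subtype.ext h)
  set a : ℝ := ex (fun p => F (lam p)) with ha
  have hdl : (0:ℝ) < d * ℓ := by positivity
  have hsumL : ∑ v ∈ L, F v = d * ℓ * a := by
    have h1 : ∑ v ∈ L, F v = ∑ p, F (lam p) := by
      rw [← Finset.sum_coe_sort L F, ← Equiv.sum_comp e]
    rw [h1, ha]; unfold ex; simp; field_simp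
  have haz : ∀ z ∉ L, a ≤ F z := by
    intro z hz
    rw [ha, ← ex_const (Ω := Fin d × Fin ℓ) (F z)]
    exact ex_mono fun p => hLF _ (hlamL p) z hz
  have hsumF : ∑ v, F v = 0 := by
    unfold ex at hF
    rcases div_eq_zero_iff.mp hF with h | h
    · exact h
    · rw [hcR] at h; exact absurd h hksR.ne'
  let y : V → ℝ := fun v => if v ∈ L then 0 else F v - a
  have hy0 : ∀ v, 0 ≤ y v := by
    intro v; simp only [y]; split_ifs with h
    · exact le_rfl
    · linarith [haz v h]
  have hy : ex y = - a := by
    have h1 : ∑ v, y v = - (k * s * a) := by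
      have h2 : ∑ v, y v = ∑ v, (F v - a) - ∑ v ∈ L, (F v - a) := by
        rw [← Finset.sum_sdiff (subset_univ L)]
        rw [← Finset.sum_sdiff (subset_univ L) (f := fun v => F v - a)]
        have h3 : ∑ v ∈ L, y v = 0 := Finset.sum_eq_zero fun v hv => by simp [y, hv]
        have h4 : ∑ v ∈ univ \ L, y v = ∑ v ∈ univ \ L, (F v - a) :=
          Finset.sum_congr rfl fun v hv => by simp [y, (mem_sdiff.mp hv).2]
        rw [h3, h4]; ring
      rw [h2, Finset.sum_sub_distrib, Finset.sum_sub_distrib, hsumF, hsumL]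
      simp only [sum_const, card_univ, nsmul_eq_mul, hL, hcR]
      push_cast; ring
    unfold ex; rw [h1, hcR]; field_simp
  have hhan := han k d M s hk hM hdM hcard hs y hy0 (-a) hy.le
  set G := (1 - (1 - 1/(k:ℝ))^(M+1) + (M+1) * ((M:ℝ) - d) * (1 - 1/(k:ℝ))^(M-1) / k^2) with hGdef
  let Λ : (Fin d → Fin ℓ) → (Fin d → V) := fun j i => lam (i, j i)
  have hΛI : Function.Injective Λ := by
    intro j j' h
    funext i
    have := hlamI (congrFun h i)
    exact (Prod.mk.inj this).2
  have hΛinj : ∀ j, Function.Injective (Λ j) := by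
    intro j i i' h
    exact (Prod.mk.inj (hlamI h)).1
  let Ev : (Fin d → V) → (Fin (M+1) → V) → Prop := fun s x =>
    Ed H (Sum.elim s x) ∧ d * a + ∑ i, F (x i) ≤ 0
  have hEv : ∀ j, η ≤ pr (Ev (Λ j)) := by
    intro j
    have h1 := hDeg (Λ j) (hΛinj j)
    have h2 := pr_hit_le (ι := Fin (M+1)) L
    have h3 := pr_and_not_ge (fun x : Fin (M+1) → V => Ed H (Sum.elim (Λ j) x))
      (fun x => (k * (-a) < ∑ i, y (x i)) ∨ ∃ i, x i ∈ L)
    have h4 := pr_or_le (fun x : Fin (M+1) → V => k * (-a) < ∑ i, y (x i)) (fun x => ∃ i, x i ∈ L)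
    have h5 : pr (fun x : Fin (M+1) → V => Ed H (Sum.elim (Λ j) x) ∧
        ¬ ((k * (-a) < ∑ i, y (x i)) ∨ ∃ i, x i ∈ L)) ≤ pr (Ev (Λ j)) := by
      refine pr_mono fun x hx => ⟨hx.1, ?_⟩
      have h6 := hx.2
      push Not at h6
      obtain ⟨h7, h8⟩ := h6
      have h9 : ∑ i, y (x i) = ∑ i, F (x i) - (M+1) * a := by
        have : ∀ i, y (x i) = F (x i) - a := fun i => by simp [y, h8 i]
        simp only [this, Finset.sum_sub_distrib]; simp
      rw [h9] at h7
      have : (k:ℝ) = d + (M+1) := by rw [hk]; push_cast; ring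
      rw [this] at h7
      linarith
    rw [hcR, hL] at h2
    simp only [Fintype.card_fin] at h2
    push_cast at h2
    linarith
  set Cn : ℝ := ((Fintype.card (Fin d → V) : ℕ) : ℝ) with hCn
  set Cl : ℝ := ((Fintype.card (Fin d → Fin ℓ) : ℕ) : ℝ) with hCl
  have hCn0 : 0 < Cn := Nat.cast_pos.mpr Fintype.card_pos
  have hCl0 : 0 < Cl := Nat.cast_pos.mpr Fintype.card_pos
  have hratio : Cn / Cl = ((k*s:ℝ)/ℓ)^d := by
    rw [hCn, hCl]; simp [hcard, div_pow]
  let g : (Fin d → V) × (Fin (M+1) → V) → ℝ := fun ω =>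
    ind (∃ j, Λ j = ω.1) * ((Cn / Cl) * (ind (Ev ω.1 ω.2) / pr (Ev ω.1)))
  refine ⟨g, ?_, ?_, ?_⟩
  · intro ω
    have h0 : 0 ≤ pr (Ev ω.1) := pr_nonneg _
    refine ⟨mul_nonneg (ind_nonneg _) (mul_nonneg (by positivity) (div_nonneg (ind_nonneg _) h0)), ?_⟩
    rw [← hratio]
    simp only [g]
    have hR : 0 ≤ Cn / Cl / η * ind (Ed H (Sum.elim ω.1 ω.2)) := mul_nonneg (by positivity) (ind_nonneg _)
    by_cases hj : ∃ j, Λ j = ω.1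
    · by_cases hE : Ev ω.1 ω.2
      · rw [ind_true hj, ind_true hE, ind_true hE.1]
        obtain ⟨j, hj⟩ := hj
        have := hEv j
        rw [hj] at this
        rw [one_mul, mul_one, div_eq_mul_inv (Cn/Cl) η, ← one_div]
        gcongr
      · rw [ind_false hE]; simpa using hR
    · rw [ind_false hj]; simpa using hR
  · rw [ex_prod]
    have h1 : ∀ s, ex (fun x => g (s, x)) = ind (∃ j, Λ j = s) * ((Cn / Cl) *
        (pr (Ev s) / pr (Ev s))) := by
      intro s
      simp only [g]
      rw [ex_mul_left, ex_mul_left]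
      simp only [div_eq_mul_inv]
      rw [ex_mul_right]; rfl
    simp only [h1]
    rw [ex_push Λ hΛI]
    have h2 : ∀ j, Cn / Cl * (pr (Ev (Λ j)) / pr (Ev (Λ j))) = Cn / Cl := by
      intro j
      rw [div_self (hη.trans_le (hEv j)).ne', mul_one]
    simp only [h2, ex_const]
    rw [← hCn, ← hCl]; field_simp
  · rw [ex_prod]
    have h1 : ∀ s, ex (fun x => g (s, x) * (∑ i, F (s i) + ∑ i, F (x i))) ≤
        ind (∃ j, Λ j = s) * ((Cn / Cl) * (∑ i, F (s i) - d * a)) := by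
      intro s
      by_cases hj : ∃ j, Λ j = s
      · have hp : η ≤ pr (Ev s) := by obtain ⟨j, rfl⟩ := hj; exact hEv j
        have hp0 : 0 < pr (Ev s) := hη.trans_le hp
        simp only [g]
        rw [ind_true hj]
        have h2 : ∀ x : Fin (M+1) → V, 1 * (Cn / Cl * (ind (Ev s x) / pr (Ev s))) *
            (∑ i, F (s i) + ∑ i, F (x i)) ≤ (Cn / Cl * (∑ i, F (s i) - d * a) / pr (Ev s)) * ind (Ev s x) := by
          intro x
          by_cases hE : Ev s x
          · rw [ind_true hE]
            have h5 : ∑ i, F (s i) + ∑ i, F (x i) ≤ ∑ i, F (s i) - d * a := by linarith [hE.2]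
            have h3 : 0 ≤ Cn / Cl / pr (Ev s) := by positivity
            have h4 := mul_le_mul_of_nonneg_left h5 h3
            calc _ = Cn / Cl / pr (Ev s) * (∑ i, F (s i) + ∑ i, F (x i)) := by ring
              _ ≤ _ := h4
              _ = _ := by ring
          · rw [ind_false hE]; simp
        refine (ex_mono h2).trans (le_of_eq ?_)
        rw [ex_mul_left]
        change _ * pr (Ev s) = _
        field_simp
      · simp only [g]
        rw [ind_false hj]
        simp [ex]
    refine (ex_mono h1).trans ?_
    rw [ex_push Λ hΛI, ex_mul_left, ex_sub, ex_const, ex_sum]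
    have h2 : ∀ i : Fin d, ex (fun j : Fin d → Fin ℓ => F (Λ j i)) = ex (fun l => F (lam (i, l))) := by
      intro i
      exact ex_coord i (fun l => F (lam (i, l)))
    simp only [h2]
    have h3 : ∑ i : Fin d, ex (fun l => F (lam (i, l))) = d * a := by
      rw [ha, ex_prod]
      conv_rhs => unfold ex
      simp only [Fintype.card_fin]
      have : (d:ℝ) ≠ 0 := by positivity
      unfold ex
      field_simp
      simp
    rw [h3]; simp
end frac
end PMx


namespace PMx

open Finset
set_option linter.unusedSectionVars false
set_option linter.unusedVariables false

lemma frac_matching (k d M : ℕ) (hk : k = d + (M+1)) (hM : 1 ≤ M) (hdM : d ≤ M) (hd : 1 ≤ d)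
    (hG : (1 - (1 - 1/(k:ℝ))^(M+1) + (M+1) * ((M:ℝ) - d) * (1 - 1/(k:ℝ))^(M-1) / k^2) < 1/2) :
    ∃ γ : ℝ, 0 < γ ∧ ∃ D : ℝ, 0 < D ∧ ∃ s₀ : ℕ, ∀ (V : Type) [Fintype V] [DecidableEq V] (s : ℕ),
      s₀ ≤ s → Fintype.card V = k * s → ∀ H : Finset (Finset V), (∀ e ∈ H, e.card = k) →
      DegC H d (M+1) γ → ∃ w : Finset V → ℝ, (∀ e, 0 ≤ w e) ∧ (∀ e, e ∉ H → w e = 0) ∧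
        (∀ v, ∑ e with v ∈ e, w e = 1) ∧
        (∀ u v, u ≠ v → ∑ e with (u ∈ e ∧ v ∈ e), w e ≤ D / Fintype.card V) := by
  set G := (1 - (1 - 1/(k:ℝ))^(M+1) + (M+1) * ((M:ℝ) - d) * (1 - 1/(k:ℝ))^(M-1) / k^2) with hGdef
  have hk0 : 0 < k := by omega
  have hkR : (1:ℝ) ≤ k := by exact_mod_cast hk0
  set g0 : ℝ := min (1/2 - G) 1 with hg0
  have hg0p : 0 < g0 := lt_min (by linarith) one_pos
  have hg01 : g0 ≤ 1 := min_le_right _ _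
  have hg0G : g0 ≤ 1/2 - G := min_le_left _ _
  have hMd0 : (1:ℝ) ≤ (M+1) * d := by
    have h1 : (1:ℝ) ≤ d := by exact_mod_cast hd
    have h2 : (1:ℝ) ≤ (M:ℝ)+1 := by linarith [Nat.cast_nonneg (α := ℝ) M]
    nlinarith
  have hdR : (1:ℝ) ≤ d := by exact_mod_cast hd
  set ε : ℝ := g0 / (2 * ((M+1) * d)) with hε
  have hε0 : 0 < ε := by positivity
  set B : ℝ := (2*k/ε)^d/(g0/4) with hB
  have hB0 : 0 < B := by positivity
  refine ⟨g0/4, by positivity, k * B, by positivity, ⌈2/ε⌉₊ + 1, ?_⟩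
  intro V _ _ s hs hcard H hunif hDeg
  have hs1 : 0 < s := by omega
  have hsR : 2/ε ≤ s := by
    have : (⌈2/ε⌉₊ : ℝ) ≤ s := by exact_mod_cast (by omega : ⌈2/ε⌉₊ ≤ s)
    exact (Nat.le_ceil _).trans this
  have hsR0 : (0:ℝ) < s := by positivity
  have hεs : 2 ≤ ε * s := by
    rw [div_le_iff₀ hε0] at hsR; linarith
  set ℓ := ⌊ε * s⌋₊ with hℓ
  have hℓle : (ℓ:ℝ) ≤ ε * s := Nat.floor_le (by positivity)
  have hℓge : ε * s / 2 ≤ ℓ := by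
    have := Nat.lt_floor_add_one (ε * s)
    rw [← hℓ] at this
    linarith
  have hℓ0 : 0 < ℓ := by
    have : (0:ℝ) < ℓ := by linarith
    exact_mod_cast this
  have hℓ0R : (0:ℝ) < ℓ := by exact_mod_cast hℓ0
  have hεd : (M+1) * (d * ε) = g0 / 2 := by rw [hε]; field_simp
  have hkey : (M+1) * (d * ℓ) / (k * s) ≤ g0 / 2 := by
    rw [div_le_iff₀ (by positivity)]
    calc (M+1) * ((d:ℝ) * ℓ) ≤ (M+1) * (d * (ε * s)) := by gcongr
      _ = g0 / 2 * (1 * s) := by rw [← hεd]; ring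
      _ ≤ _ := by gcongr
  have hℓn : d * ℓ ≤ k * s := by
    have h1 : (d:ℝ) * ℓ ≤ k * s := by
      have h2 : (1:ℝ) ≤ M + 1 := by linarith [Nat.cast_nonneg (α := ℝ) M]
      have h3 : (d:ℝ) * ε ≤ 1 := by nlinarith
      calc (d:ℝ) * ℓ ≤ d * (ε * s) := by gcongr
        _ = (d * ε) * s := by ring
        _ ≤ k * s := by gcongr; linarith
    exact_mod_cast h1
  have hcV : 0 < Fintype.card V := by rw [hcard]; positivity
  have hne : Nonempty V := Fintype.card_pos_iff.mp hcV
  set n : ℝ := ((Fintype.card V : ℕ) : ℝ) with hn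
  have hn0 : 0 < n := Nat.cast_pos.mpr hcV
  let Ω := (Fin d → V) × (Fin (M+1) → V)
  let τ : Ω → (Fin d ⊕ Fin (M+1)) → V := fun ω => Sum.elim ω.1 ω.2
  let c : Ω → V → ℝ := fun ω v => ∑ i, ind (τ ω i = v)
  have hcF : ∀ ω, ∀ F : V → ℝ, ∑ v, c ω v * F v = ∑ i, F (ω.1 i) + ∑ i, F (ω.2 i) := by
    intro ω F
    simp only [c, Finset.sum_mul]
    rw [Finset.sum_comm]
    simp only [sum_mul_ind]
    simp [τ]
  obtain ⟨g, hg1, hg2, hg3⟩ := lp_dual (Ω := Ω) (fun ω => Ed H (τ ω)) c k B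
    (by
      intro ω
      have := hcF ω (fun _ => 1)
      simp only [mul_one] at this
      rw [this, hk]; simp)
    (by
      intro F hF
      obtain ⟨g, h1, h2, h3⟩ := frac_test k d M s ℓ hk hM hdM hd hcard hs1 hℓ0 hℓn H (g0/4) (g0/4)
        (by positivity) hDeg (by rw [← hGdef]; linarith) F hF
      refine ⟨g, fun ω => ⟨(h1 ω).1, (h1 ω).2.trans ?_⟩, h2, ?_⟩
      · apply mul_le_mul_of_nonneg_right _ (ind_nonneg _)
        rw [hB]
        have : (k*s:ℝ)/ℓ ≤ 2*k/ε := by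
          rw [div_le_div_iff₀ hℓ0R hε0]
          nlinarith
        gcongr
      · simp only [hcF]; exact h3)
  have hpos : 0 < n / k := by positivity
  have hτcard : Fintype.card (Fin d ⊕ Fin (M+1)) = k := by simp [hk]
  have hτinj : ∀ ω, Ed H (τ ω) → Function.Injective (τ ω) := by
    intro ω h
    have h1 := hunif _ h
    rw [← Set.injOn_univ]
    have : (univ : Finset (Fin d ⊕ Fin (M+1))).card = k := by rw [card_univ, hτcard]
    rw [← Finset.coe_univ]
    exact Finset.card_image_iff.mp (h1.trans this.symm)
  have hgz : ∀ ω, ¬ Ed H (τ ω) → g ω = 0 := by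
    intro ω h
    have := hg1 ω
    rw [ind_false h, mul_zero] at this
    exact le_antisymm this.2 this.1
  have hgB : ∀ ω, g ω ≤ B := by
    intro ω
    exact (hg1 ω).2.trans (mul_le_of_le_one_right hB0.le (ind_le_one _))
  let w : Finset V → ℝ := fun e => (n / k) * ex (fun ω => ind (univ.image (τ ω) = e) * g ω)
  have hwsum : ∀ P : Finset V → Prop, [DecidablePred P] → ∑ e with P e, w e =
      (n / k) * ex (fun ω => ind (P (univ.image (τ ω))) * g ω) := by
    intro P _
    simp only [w]
    rw [← Finset.mul_sum, ← ex_sum]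
    congr 1
    refine ex_congr fun ω => ?_
    rw [← Finset.sum_mul]
    congr 1
    by_cases h : P (univ.image (τ ω))
    · rw [ind_true h, Finset.sum_eq_single (univ.image (τ ω))]
      · exact ind_true rfl
      · intro b _ hb; exact ind_false (fun h => hb h.symm)
      · intro h'; exact absurd (by simp [h]) h'
    · rw [ind_false h]
      apply Finset.sum_eq_zero
      intro e he
      apply ind_false
      rintro rfl
      exact h (mem_filter.mp he).2
  refine ⟨w, ?_, ?_, ?_, ?_⟩
  · intro e
    exact mul_nonneg hpos.le (ex_nonneg fun ω => mul_nonneg (ind_nonneg _) (hg1 ω).1)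
  · intro e he
    simp only [w]
    have : ∀ ω, ind (univ.image (τ ω) = e) * g ω = 0 := by
      intro ω
      by_cases h : univ.image (τ ω) = e
      · rw [hgz ω (fun h' => he (h ▸ h')), mul_zero]
      · rw [ind_false h, zero_mul]
    simp [this, ex]
  · intro v
    rw [hwsum]
    have h1 : ex (fun ω => ind (v ∈ univ.image (τ ω)) * g ω) = k / n := by
      rw [hn, ← hg3 v]
      refine ex_congr fun ω => ?_
      by_cases hE : Ed H (τ ω)
      · rw [mul_comm]; congr 1
        simp only [c]
        by_cases hv : v ∈ univ.image (τ ω)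
        · rw [ind_true hv]
          obtain ⟨i, _, rfl⟩ := mem_image.mp hv
          rw [Finset.sum_eq_single i]
          · rw [ind_true rfl]
          · intro b _ hb; exact ind_false (fun h => hb (hτinj ω hE h))
          · simp
        · rw [ind_false hv]; symm
          apply Finset.sum_eq_zero
          intro i _
          apply ind_false
          rintro rfl
          exact hv (mem_image_of_mem _ (mem_univ i))
      · rw [hgz ω hE]; simp
    rw [h1]; field_simp
  · intro u v huv
    rw [hwsum]
    have h1 : ex (fun ω => ind (u ∈ univ.image (τ ω) ∧ v ∈ univ.image (τ ω)) * g ω) ≤ (k^2/n^2) * B := by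
      have h2 : ex (fun ω => ind (u ∈ univ.image (τ ω) ∧ v ∈ univ.image (τ ω)) * g ω) ≤
          pr (fun ω => u ∈ univ.image (τ ω) ∧ v ∈ univ.image (τ ω)) * B := by
        unfold pr
        rw [← ex_mul_right]
        exact ex_mono fun ω => mul_le_mul_of_nonneg_left (hgB ω) (ind_nonneg _)
      refine h2.trans (mul_le_mul_of_nonneg_right ?_ hB0.le)
      let I := Fin d ⊕ Fin (M+1)
      have h3 : pr (fun ω : Ω => u ∈ univ.image (τ ω) ∧ v ∈ univ.image (τ ω)) =
          pr (fun f : I → V => u ∈ univ.image f ∧ v ∈ univ.image f) :=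
        pr_equiv (Equiv.sumArrowEquivProdArrow (Fin d) (Fin (M+1)) V).symm
          (fun f : I → V => u ∈ univ.image f ∧ v ∈ univ.image f)
      rw [h3]
      have h4 : pr (fun f : I → V => u ∈ univ.image f ∧ v ∈ univ.image f) ≤
          ∑ p : I × I, pr (fun f : I → V => p.1 ≠ p.2 ∧ f p.1 = u ∧ f p.2 = v) := by
        refine le_trans (pr_mono ?_) (pr_exists_le _)
        intro f ⟨hu, hv⟩
        obtain ⟨i, _, hi⟩ := mem_image.mp hu
        obtain ⟨j, _, hj⟩ := mem_image.mp hv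
        exact ⟨(i, j), fun h => huv (by rw [← hi, ← hj]; exact congrArg f h), hi, hj⟩
      refine h4.trans ?_
      have h5 : ∀ p : I × I, pr (fun f : I → V => p.1 ≠ p.2 ∧ f p.1 = u ∧ f p.2 = v) ≤ 1/n^2 := by
        intro p
        by_cases hp : p.1 = p.2
        · have : pr (fun f : I → V => p.1 ≠ p.2 ∧ f p.1 = u ∧ f p.2 = v) ≤ pr (fun f : I → V => False) :=
            pr_mono fun f h => h.1 hp
          refine this.trans ?_
          have : pr (fun f : I → V => False) = 0 := by unfold pr; simp [ind, ex]
          rw [this]; positivity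
        · let Q : I → V → Prop := fun i x => (i = p.1 → x = u) ∧ (i = p.2 → x = v)
          have h6 : pr (fun f : I → V => p.1 ≠ p.2 ∧ f p.1 = u ∧ f p.2 = v) ≤
              pr (fun f : I → V => ∀ i, Q i (f i)) := by
            refine pr_mono fun f h i => ⟨?_, ?_⟩
            · rintro rfl; exact h.2.1
            · rintro rfl; exact h.2.2
          refine h6.trans ?_
          rw [pr_pi]
          have h7 : ∏ i, pr (Q i) ≤ ∏ i, (if i = p.1 then 1/n else 1) * (if i = p.2 then 1/n else 1) := by
            apply Finset.prod_le_prod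
            · intro i _; exact pr_nonneg _
            · intro i _
              by_cases h1 : i = p.1
              · have h2 : i ≠ p.2 := fun h => hp (h1.symm.trans h)
                rw [if_pos h1, if_neg h2, mul_one]
                have := pr_mem ({u} : Finset V)
                rw [card_singleton, ← hn, Nat.cast_one] at this
                rw [← this]
                exact pr_mono fun x hx => by simpa using hx.1 h1
              · by_cases h2 : i = p.2
                · rw [if_neg h1, if_pos h2, one_mul]
                  have := pr_mem ({v} : Finset V)
                  rw [card_singleton, ← hn, Nat.cast_one] at this
                  rw [← this]
                  exact pr_mono fun x hx => by simpa using hx.2 h2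
                · rw [if_neg h1, if_neg h2, mul_one]; exact pr_le_one _
          refine h7.trans (le_of_eq ?_)
          rw [Finset.prod_mul_distrib, Finset.prod_ite_eq' univ p.1, Finset.prod_ite_eq' univ p.2]
          simp; ring
      refine (Finset.sum_le_sum fun p _ => h5 p).trans (le_of_eq ?_)
      simp only [sum_const, card_univ, nsmul_eq_mul, Fintype.card_prod]
      rw [hτcard]; push_cast; ring
    calc n / k * _ ≤ n / k * ((k^2/n^2) * B) := mul_le_mul_of_nonneg_left h1 hpos.le
      _ = k * B / n := by field_simp

end PMx


namespace PMx

open Finset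
set_option linter.unusedSectionVars false
set_option linter.unusedVariables false

section nib
variable {V : Type} [Fintype V] [DecidableEq V]

/-- weighted degree inside `U` -/
noncomputable def dg (w : Finset V → ℝ) (U : Finset V) (v : V) : ℝ :=
  ∑ f ∈ U.powerset, w f * ind (v ∈ f)

noncomputable def cg (w : Finset V → ℝ) (U : Finset V) (u v : V) : ℝ :=
  ∑ f ∈ U.powerset, w f * (ind (u ∈ f) * ind (v ∈ f))

noncomputable def dt (w : Finset V → ℝ) (U e : Finset V) (v : V) : ℝ :=
  ∑ u ∈ U, ind (u ∈ e) * ind (u ≠ v) * cg w U u v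

noncomputable def Phi (w : Finset V → ℝ) (U : Finset V) (p : ℝ) : ℝ :=
  ∑ v ∈ U, (dg w U v - p)^2

structure NW (w : Finset V → ℝ) (k : ℕ) (D : ℝ) : Prop where
  nn : ∀ e, 0 ≤ w e
  unif : ∀ e, w e ≠ 0 → e.card = k
  deg : ∀ v, ∑ e with v ∈ e, w e = 1
  cod : ∀ u v, u ≠ v → ∑ e with (u ∈ e ∧ v ∈ e), w e ≤ D / Fintype.card V

variable {w : Finset V → ℝ} {k : ℕ} {D : ℝ}

lemma sum_ind_mem {f U : Finset V} (h : f ⊆ U) : ∑ v ∈ U, ind (v ∈ f) = f.card := by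
  have : ∀ v ∈ U, ind (v ∈ f) = if v ∈ f then (1:ℝ) else 0 := by
    intro v _; by_cases hv : v ∈ f <;> simp [ind, hv]
  rw [Finset.sum_congr rfl this, Finset.sum_ite_mem, inter_eq_right.mpr h]; simp

lemma ind_sq (p : Prop) : ind p * ind p = ind p := by
  by_cases h : p <;> simp [ind, h]

lemma dg_nonneg (h : NW w k D) (U : Finset V) (v : V) : 0 ≤ dg w U v :=
  Finset.sum_nonneg fun f _ => mul_nonneg (h.nn f) (ind_nonneg _)

lemma dg_le_one (h : NW w k D) (U : Finset V) (v : V) : dg w U v ≤ 1 := by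
  rw [← h.deg v, dg, Finset.sum_filter]
  refine (Finset.sum_le_sum_of_subset_of_nonneg (subset_univ _) ?_).trans (le_of_eq ?_)
  · intro f _ _; exact mul_nonneg (h.nn f) (ind_nonneg _)
  · refine Finset.sum_congr rfl fun f _ => ?_
    by_cases hv : v ∈ f <;> simp [ind, hv]

lemma cg_nonneg (h : NW w k D) (U : Finset V) (u v : V) : 0 ≤ cg w U u v :=
  Finset.sum_nonneg fun f _ => mul_nonneg (h.nn f) (mul_nonneg (ind_nonneg _) (ind_nonneg _))

lemma cg_comm (U : Finset V) (u v : V) : cg w U u v = cg w U v u := by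
  unfold cg; refine Finset.sum_congr rfl fun f _ => ?_; ring

lemma cg_le (h : NW w k D) (U : Finset V) {u v : V} (huv : u ≠ v) :
    cg w U u v ≤ D / Fintype.card V := by
  refine le_trans ?_ (h.cod u v huv)
  rw [cg, Finset.sum_filter]
  refine (Finset.sum_le_sum_of_subset_of_nonneg (subset_univ _) ?_).trans (le_of_eq ?_)
  · intro f _ _; exact mul_nonneg (h.nn f) (mul_nonneg (ind_nonneg _) (ind_nonneg _))
  · refine Finset.sum_congr rfl fun f _ => ?_
    by_cases hv : v ∈ f <;> by_cases hu : u ∈ f <;> simp [ind, hv, hu]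

lemma w_card (h : NW w k D) (f : Finset V) : w f * (f.card : ℝ) = w f * k := by
  by_cases h0 : w f = 0
  · simp [h0]
  · rw [h.unif f h0]

lemma sum_dg (h : NW w k D) (U : Finset V) : ∑ v ∈ U, dg w U v = k * ∑ f ∈ U.powerset, w f := by
  unfold dg
  rw [Finset.sum_comm, Finset.mul_sum]
  refine Finset.sum_congr rfl fun f hf => ?_
  rw [← Finset.mul_sum, sum_ind_mem (mem_powerset.mp hf), w_card h, mul_comm]

lemma sum_cg (h : NW w k D) (U : Finset V) {v : V} (hv : v ∈ U) :
    ∑ u ∈ U, ind (u ≠ v) * cg w U u v = (k - 1) * dg w U v := by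
  have h1 : ∀ u ∈ U, ind (u ≠ v) * cg w U u v = cg w U u v - ind (v = u) * cg w U u v := by
    intro u _
    have : ind (u ≠ v) = 1 - ind (v = u) := by
      rw [← ind_not]; exact ind_congr (by simp [eq_comm])
    rw [this]; ring
  rw [Finset.sum_congr rfl h1, Finset.sum_sub_distrib]
  have h2 : ∑ u ∈ U, ind (v = u) * cg w U u v = dg w U v := by
    rw [Finset.sum_eq_single v]
    · rw [ind_true rfl, one_mul]
      unfold cg dg
      refine Finset.sum_congr rfl fun f _ => ?_
      rw [ind_sq]
    · intro u _ hu; rw [ind_false (fun h => hu h.symm), zero_mul]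
    · intro h; exact absurd hv h
  rw [h2]
  have h3 : ∑ u ∈ U, cg w U u v = k * dg w U v := by
    unfold cg dg
    rw [Finset.sum_comm, Finset.mul_sum]
    refine Finset.sum_congr rfl fun f hf => ?_
    rw [← Finset.mul_sum, ← Finset.sum_mul, sum_ind_mem (mem_powerset.mp hf), ← mul_assoc, w_card h]
    ring
  rw [h3]; ring

lemma dt_nonneg (h : NW w k D) (U e : Finset V) (v : V) : 0 ≤ dt w U e v :=
  Finset.sum_nonneg fun u _ => mul_nonneg (mul_nonneg (ind_nonneg _) (ind_nonneg _)) (cg_nonneg h _ _ _)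

lemma dt_le (h : NW w k D) (hD : 0 ≤ D) {U e : Finset V} (he : e ⊆ U) (hek : e.card = k) (v : V) :
    dt w U e v ≤ k * (D / Fintype.card V) := by
  unfold dt
  have : ∀ u ∈ U, ind (u ∈ e) * ind (u ≠ v) * cg w U u v ≤ ind (u ∈ e) * (D / Fintype.card V) := by
    intro u _
    rw [mul_assoc]
    apply mul_le_mul_of_nonneg_left _ (ind_nonneg _)
    by_cases hu : u ≠ v
    · rw [ind_true hu, one_mul]; exact cg_le h U hu
    · rw [ind_false hu, zero_mul]; positivity
  refine (Finset.sum_le_sum this).trans (le_of_eq ?_)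
  rw [← Finset.sum_mul, sum_ind_mem he, hek]

/-- the change of degree -/
lemma dg_sdiff {U e : Finset V} (v : V) :
    dg w U v - dg w (U \ e) v = ∑ f ∈ U.powerset, w f * (ind (v ∈ f) * ind (¬ Disjoint f e)) := by
  have h1 : dg w (U \ e) v = ∑ f ∈ U.powerset, w f * (ind (v ∈ f) * ind (Disjoint f e)) := by
    unfold dg
    symm
    have hsub : (U \ e).powerset ⊆ U.powerset := powerset_mono.mpr sdiff_subset
    rw [← Finset.sum_subset hsub]
    · refine Finset.sum_congr rfl fun f hf => ?_
      rw [ind_true (p := Disjoint f e), mul_one]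
      exact (subset_sdiff.mp (mem_powerset.mp hf)).2
    · intro f hf hf'
      rw [ind_false (p := Disjoint f e)]
      · simp
      · intro hd; exact hf' (mem_powerset.mpr (subset_sdiff.mpr ⟨mem_powerset.mp hf, hd⟩))
  rw [h1, dg, ← Finset.sum_sub_distrib]
  refine Finset.sum_congr rfl fun f _ => ?_
  rw [ind_not]; ring

lemma dt_eq {U e : Finset V} (he : e ⊆ U) {v : V} (hv : v ∉ e) :
    dt w U e v = ∑ f ∈ U.powerset, w f * (ind (v ∈ f) * ((f ∩ e).card : ℝ)) := by
  unfold dt cg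
  have h1 : ∀ u ∈ U, ind (u ∈ e) * ind (u ≠ v) * ∑ f ∈ U.powerset, w f * (ind (u ∈ f) * ind (v ∈ f))
      = ∑ f ∈ U.powerset, w f * ind (v ∈ f) * ind (u ∈ f ∩ e) := by
    intro u _
    rw [Finset.mul_sum]
    refine Finset.sum_congr rfl fun f _ => ?_
    have : ind (u ∈ e) * ind (u ≠ v) = ind (u ∈ e) := by
      by_cases hu : u ∈ e
      · rw [ind_true (p := u ≠ v) (by rintro rfl; exact hv hu), mul_one]
      · rw [ind_false hu, zero_mul]
    rw [this, ind_congr (mem_inter (a := u) (s₁ := f) (s₂ := e)), ind_and]; ring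
  rw [Finset.sum_congr rfl h1, Finset.sum_comm]
  refine Finset.sum_congr rfl fun f _ => ?_
  rw [← Finset.mul_sum, sum_ind_mem (inter_subset_right.trans he)]; ring

lemma err_nonneg (h : NW w k D) {U e : Finset V} (he : e ⊆ U) {v : V} (hv : v ∉ e) :
    0 ≤ dt w U e v - (dg w U v - dg w (U \ e) v) := by
  rw [dg_sdiff, dt_eq he hv, ← Finset.sum_sub_distrib]
  refine Finset.sum_nonneg fun f _ => ?_
  rw [← mul_sub, ← mul_sub]
  refine mul_nonneg (h.nn f) (mul_nonneg (ind_nonneg _) ?_)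
  by_cases hd : Disjoint f e
  · rw [ind_false (not_not.mpr hd)]; simp
  · rw [ind_true hd, sub_nonneg]
    have : 0 < (f ∩ e).card := by
      rw [card_pos]; exact not_disjoint_iff_nonempty_inter.mp hd
    exact_mod_cast this

lemma err_sum (h : NW w k D) (hD : 0 ≤ D) {U e : Finset V} (he : e ⊆ U) (hek : e.card = k) :
    ∑ v ∈ U \ e, (dt w U e v - (dg w U v - dg w (U \ e) v)) ≤ k^3 * (D / Fintype.card V) := by
  have h1 : ∀ v ∈ U \ e, dt w U e v - (dg w U v - dg w (U \ e) v) ≤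
      ∑ f ∈ U.powerset, w f * (ind (v ∈ f) *
        ∑ u ∈ U, ∑ u' ∈ U, ind (u ∈ e) * ind (u' ∈ e) * ind (u ≠ u') * (ind (u ∈ f) * ind (u' ∈ f))) := by
    intro v hv
    rw [dg_sdiff, dt_eq he (mem_sdiff.mp hv).2, ← Finset.sum_sub_distrib]
    refine Finset.sum_le_sum fun f _ => ?_
    rw [← mul_sub, ← mul_sub]
    refine mul_le_mul_of_nonneg_left (mul_le_mul_of_nonneg_left ?_ (ind_nonneg _)) (h.nn f)
    have e1 : ∑ u ∈ U, ∑ u' ∈ U, ind (u ∈ e) * ind (u' ∈ e) * ind (u ≠ u') * (ind (u ∈ f) * ind (u' ∈ f))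
        = ((f ∩ e).card : ℝ) * (f ∩ e).card - (f ∩ e).card := by
      have e2 : ∀ u ∈ U, ∀ u' ∈ U, ind (u ∈ e) * ind (u' ∈ e) * ind (u ≠ u') * (ind (u ∈ f) * ind (u' ∈ f))
          = ind (u ∈ f ∩ e) * ind (u' ∈ f ∩ e) - ind (u = u') * (ind (u ∈ f ∩ e) * ind (u' ∈ f ∩ e)) := by
        intro u _ u' _
        rw [ind_congr (mem_inter (a := u) (s₁ := f) (s₂ := e)), ind_and,
          ind_congr (mem_inter (a := u') (s₁ := f) (s₂ := e)), ind_and, ind_not]; ring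
      rw [Finset.sum_congr rfl fun u hu => Finset.sum_congr rfl (e2 u hu)]
      simp only [Finset.sum_sub_distrib]
      congr 1
      · rw [← Finset.sum_mul_sum, sum_ind_mem (inter_subset_right.trans he)]
      · rw [← sum_ind_mem (inter_subset_right.trans he : f ∩ e ⊆ U)]
        refine Finset.sum_congr rfl fun u hu => ?_
        rw [Finset.sum_eq_single u]
        · rw [ind_true rfl, ind_sq, one_mul]
        · intro b _ hb; rw [ind_false (fun h => hb h.symm), zero_mul]
        · intro h; exact absurd hu h
    rw [e1]
    by_cases hd : Disjoint f e
    · rw [ind_false (not_not.mpr hd), disjoint_iff_inter_eq_empty.mp hd]; simp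
    · rw [ind_true hd]
      have : 0 < (f ∩ e).card := by
        rw [card_pos]; exact not_disjoint_iff_nonempty_inter.mp hd
      have : (1:ℝ) ≤ (f ∩ e).card := by exact_mod_cast this
      nlinarith
  refine (Finset.sum_le_sum h1).trans ?_
  rw [Finset.sum_comm]
  have h2 : ∀ f ∈ U.powerset, ∑ v ∈ U \ e, w f * (ind (v ∈ f) *
        ∑ u ∈ U, ∑ u' ∈ U, ind (u ∈ e) * ind (u' ∈ e) * ind (u ≠ u') * (ind (u ∈ f) * ind (u' ∈ f))) ≤
      k * (w f * ∑ u ∈ U, ∑ u' ∈ U, ind (u ∈ e) * ind (u' ∈ e) * ind (u ≠ u') * (ind (u ∈ f) * ind (u' ∈ f))) := by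
    intro f hf
    rw [← Finset.mul_sum, ← Finset.sum_mul]
    have hS : 0 ≤ ∑ u ∈ U, ∑ u' ∈ U, ind (u ∈ e) * ind (u' ∈ e) * ind (u ≠ u') * (ind (u ∈ f) * ind (u' ∈ f)) :=
      Finset.sum_nonneg fun u _ => Finset.sum_nonneg fun u' _ => mul_nonneg (mul_nonneg (mul_nonneg (ind_nonneg _) (ind_nonneg _)) (ind_nonneg _)) (mul_nonneg (ind_nonneg _) (ind_nonneg _))
    set S := ∑ u ∈ U, ∑ u' ∈ U, ind (u ∈ e) * ind (u' ∈ e) * ind (u ≠ u') * (ind (u ∈ f) * ind (u' ∈ f))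
    have h3 : ∑ v ∈ U \ e, ind (v ∈ f) ≤ f.card := by
      rw [← sum_ind_mem (mem_powerset.mp hf)]
      exact Finset.sum_le_sum_of_subset_of_nonneg sdiff_subset fun _ _ _ => ind_nonneg _
    calc w f * ((∑ v ∈ U \ e, ind (v ∈ f)) * S) ≤ w f * (f.card * S) :=
          mul_le_mul_of_nonneg_left (mul_le_mul_of_nonneg_right h3 hS) (h.nn f)
      _ = (w f * f.card) * S := by ring
      _ = k * (w f * S) := by rw [w_card h]; ring
  refine (Finset.sum_le_sum h2).trans ?_
  rw [← Finset.mul_sum]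
  have h4 : ∑ f ∈ U.powerset, w f * ∑ u ∈ U, ∑ u' ∈ U, ind (u ∈ e) * ind (u' ∈ e) * ind (u ≠ u') * (ind (u ∈ f) * ind (u' ∈ f))
      = ∑ u ∈ U, ∑ u' ∈ U, ind (u ∈ e) * ind (u' ∈ e) * (ind (u ≠ u') * cg w U u u') := by
    simp only [Finset.mul_sum]
    rw [Finset.sum_comm]
    refine Finset.sum_congr rfl fun u _ => ?_
    rw [Finset.sum_comm]
    refine Finset.sum_congr rfl fun u' _ => ?_
    unfold cg
    rw [Finset.mul_sum, Finset.mul_sum]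
    refine Finset.sum_congr rfl fun f _ => ?_
    ring
  rw [h4]
  have h5 : ∑ u ∈ U, ∑ u' ∈ U, ind (u ∈ e) * ind (u' ∈ e) * (ind (u ≠ u') * cg w U u u') ≤
      ∑ u ∈ U, ∑ u' ∈ U, ind (u ∈ e) * ind (u' ∈ e) * (D / Fintype.card V) := by
    refine Finset.sum_le_sum fun u _ => Finset.sum_le_sum fun u' _ => ?_
    apply mul_le_mul_of_nonneg_left _ (mul_nonneg (ind_nonneg _) (ind_nonneg _))
    by_cases hu : u ≠ u'
    · rw [ind_true hu, one_mul]; exact cg_le h U hu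
    · rw [ind_false hu, zero_mul]; positivity
  have h6 : ∑ u ∈ U, ∑ u' ∈ U, ind (u ∈ e) * ind (u' ∈ e) * (D / Fintype.card V) =
      k * k * (D / Fintype.card V) := by
    simp only [← Finset.sum_mul]
    rw [← Finset.sum_mul_sum, sum_ind_mem he, hek]
  rw [h6] at h5
  calc (k:ℝ) * _ ≤ k * (k * k * (D / Fintype.card V)) := mul_le_mul_of_nonneg_left h5 (Nat.cast_nonneg _)
    _ = _ := by ring

end nib
end PMx


namespace PMx

open Finset
set_option linter.unusedSectionVars false
set_option linter.unusedVariables false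

section nib
variable {V : Type} [Fintype V] [DecidableEq V]
variable {w : Finset V → ℝ} {k : ℕ} {D : ℝ}

lemma nibA (h : NW w k D) (hD : 0 ≤ D) {U e : Finset V} (he : e ⊆ U) (hek : e.card = k)
    (p p' a : ℝ) (hp0 : 0 ≤ p) (hp1 : p ≤ 1) (ha : 0 ≤ a) (hn : 0 < Fintype.card V)
    (hq0 : 0 ≤ p - p') (hq1 : p - p' ≤ a / Fintype.card V) :
    Phi w (U \ e) p' ≤ Phi w U p + 2 * (p - p') * ∑ v ∈ U, (dg w U v - p)
      - 2 * ∑ v ∈ U, (dg w U v - p) * dt w U e v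
      + (2 * a * k + 2 * (k^3 + k^2) * D + (k * D + a)^2) / Fintype.card V := by
  set n : ℝ := ((Fintype.card V : ℕ) : ℝ) with hndef
  have hn0 : 0 < n := Nat.cast_pos.mpr hn
  set q := p - p' with hq
  set x : V → ℝ := fun v => dg w U v - p with hx
  have hx1 : ∀ v, |x v| ≤ 1 := by
    intro v
    have h1 := dg_nonneg h U v
    have h2 := dg_le_one h U v
    rw [abs_le, hx]; constructor <;> simp only <;> linarith
  have hpt : ∀ v ∈ U \ e, (dg w (U \ e) v - p')^2 ≤ x v ^ 2 + 2 * q * x v - 2 * (x v * dt w U e v)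
      + 2 * (dt w U e v - (dg w U v - dg w (U \ e) v)) + ((k*D+a)/n)^2 := by
    intro v hv
    have hve := (mem_sdiff.mp hv).2
    have herr := err_nonneg h he hve
    have hdt := dt_le h hD he hek v
    set δ := dg w U v - dg w (U \ e) v with hδ
    have hδ0 : 0 ≤ δ := by
      rw [hδ, dg_sdiff]
      exact Finset.sum_nonneg fun f _ => mul_nonneg (h.nn f) (mul_nonneg (ind_nonneg _) (ind_nonneg _))
    have e1 : dg w (U \ e) v - p' = x v + (q - δ) := by simp only [hx, hq, hδ]; ring
    have h1 : (q - δ)^2 ≤ ((k*D+a)/n)^2 := by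
      apply sq_le_sq'
      · have : δ ≤ k * D / n := by rw [mul_div_assoc]; linarith
        have : (k*D+a)/n = k*D/n + a/n := add_div _ _ _
        have : 0 ≤ a / n := by positivity
        linarith
      · have : (k*D+a)/n = k*D/n + a/n := add_div _ _ _
        have : 0 ≤ k * D / n := by positivity
        linarith
    have h2 : x v * (dt w U e v - δ) ≤ dt w U e v - δ := by
      have := (abs_le.mp (hx1 v)).2
      nlinarith
    rw [e1]
    nlinarith
  have hsum : Phi w (U \ e) p' ≤ ∑ v ∈ U \ e, (x v ^ 2 + 2 * q * x v - 2 * (x v * dt w U e v)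
      + 2 * (dt w U e v - (dg w U v - dg w (U \ e) v)) + ((k*D+a)/n)^2) :=
    Finset.sum_le_sum hpt
  rw [Finset.sum_add_distrib, Finset.sum_add_distrib, Finset.sum_sub_distrib, Finset.sum_add_distrib,
    ← Finset.mul_sum, ← Finset.mul_sum, ← Finset.mul_sum] at hsum
  have hs1 : ∑ v ∈ U \ e, x v ^ 2 ≤ Phi w U p :=
    Finset.sum_le_sum_of_subset_of_nonneg sdiff_subset fun v _ _ => sq_nonneg _
  have hs2 : ∑ v ∈ U \ e, x v = ∑ v ∈ U, x v - ∑ v ∈ e, x v := by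
    rw [← Finset.sum_sdiff he]; ring
  have hs3 : ∑ v ∈ U \ e, x v * dt w U e v = ∑ v ∈ U, x v * dt w U e v - ∑ v ∈ e, x v * dt w U e v := by
    rw [← Finset.sum_sdiff he]; ring
  have hs4 : -(k:ℝ) ≤ ∑ v ∈ e, x v := by
    have : ∑ v ∈ e, (-1:ℝ) ≤ ∑ v ∈ e, x v := Finset.sum_le_sum fun v _ => (abs_le.mp (hx1 v)).1
    simpa [hek] using this
  have hs5 : ∑ v ∈ e, x v * dt w U e v ≤ k * (k * (D / n)) := by
    have : ∑ v ∈ e, x v * dt w U e v ≤ ∑ v ∈ e, k * (D / n) := by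
      refine Finset.sum_le_sum fun v _ => ?_
      have h1 := (abs_le.mp (hx1 v)).2
      have h2 := dt_nonneg h U e v
      have h3 := dt_le h hD he hek v
      nlinarith
    simpa [hek] using this
  have hs6 := err_sum h hD he hek
  have hs7 : ∑ v ∈ U \ e, ((k*D+a)/n)^2 ≤ (k*D+a)^2 / n := by
    rw [sum_const, nsmul_eq_mul]
    have : ((U \ e).card : ℝ) ≤ n := by rw [hndef]; exact_mod_cast card_le_univ _
    calc ((U \ e).card : ℝ) * ((k*D+a)/n)^2 ≤ n * ((k*D+a)/n)^2 := by gcongr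
      _ = _ := by field_simp
  rw [hs2, hs3] at hsum
  have hs8 : 2 * q * (- ∑ v ∈ e, x v) ≤ 2 * (a * k) / n := by
    have h1 : q * (- ∑ v ∈ e, x v) ≤ q * k := mul_le_mul_of_nonneg_left (by linarith) hq0
    have h2 : q * k ≤ a / n * k := mul_le_mul_of_nonneg_right hq1 (Nat.cast_nonneg _)
    calc 2 * q * (- ∑ v ∈ e, x v) = 2 * (q * (- ∑ v ∈ e, x v)) := by ring
      _ ≤ 2 * (a / n * k) := by linarith
      _ = _ := by ring
  have hfin : (2 * a * k + 2 * (k^3 + k^2) * D + (k * D + a)^2) / n =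
      2 * (a * k) / n + 2 * (k * (k * (D / n))) + 2 * (k^3 * (D / n)) + (k*D+a)^2 / n := by
    field_simp; ring
  rw [hfin]
  linarith

lemma nibB (h : NW w k D) (hk : 1 ≤ k) {U : Finset V} (p : ℝ) (hp0 : 0 ≤ p) :
    (k - 1) * p^2 * ∑ v ∈ U, (dg w U v - p) - (k - 1) * Phi w U p ≤
      ∑ e ∈ U.powerset, w e * ∑ v ∈ U, (dg w U v - p) * dt w U e v := by
  set x : V → ℝ := fun v => dg w U v - p with hx
  have hk1 : (0:ℝ) ≤ k - 1 := by
    have : (1:ℝ) ≤ k := by exact_mod_cast hk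
    linarith
  have e1 : ∑ e ∈ U.powerset, w e * ∑ v ∈ U, x v * dt w U e v =
      ∑ v ∈ U, x v * ∑ u ∈ U, ind (u ≠ v) * cg w U u v * dg w U u := by
    simp only [Finset.mul_sum]
    rw [Finset.sum_comm]
    refine Finset.sum_congr rfl fun v _ => ?_
    unfold dt
    simp only [Finset.mul_sum]
    rw [Finset.sum_comm]
    refine Finset.sum_congr rfl fun u _ => ?_
    conv_rhs => rw [dg]
    rw [Finset.mul_sum, Finset.mul_sum]
    refine Finset.sum_congr rfl fun f _ => ?_
    ring
  rw [e1]
  have e2 : ∀ v ∈ U, x v * ∑ u ∈ U, ind (u ≠ v) * cg w U u v * dg w U u =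
      (k-1) * p * (x v * dg w U v) + ∑ u ∈ U, ind (u ≠ v) * cg w U u v * (x u * x v) := by
    intro v hv
    have : ∀ u ∈ U, ind (u ≠ v) * cg w U u v * dg w U u =
        p * (ind (u ≠ v) * cg w U u v) + ind (u ≠ v) * cg w U u v * x u := by
      intro u _; simp only [hx]; ring
    rw [Finset.sum_congr rfl this, Finset.sum_add_distrib, ← Finset.mul_sum, sum_cg h U hv, mul_add,
      Finset.mul_sum]
    congr 1
    · ring
    · refine Finset.sum_congr rfl fun u _ => ?_; ring
  rw [Finset.sum_congr rfl e2, Finset.sum_add_distrib, ← Finset.mul_sum]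
  have e3 : ∑ v ∈ U, x v * dg w U v = Phi w U p + p * ∑ v ∈ U, x v := by
    unfold Phi
    rw [Finset.mul_sum, ← Finset.sum_add_distrib]
    refine Finset.sum_congr rfl fun v _ => ?_
    simp only [hx]; ring
  have e4 : - ((k-1) * Phi w U p) ≤ ∑ v ∈ U, ∑ u ∈ U, ind (u ≠ v) * cg w U u v * (x u * x v) := by
    have h1 : ∑ v ∈ U, ∑ u ∈ U, -(ind (u ≠ v) * cg w U u v * (x u ^2 /2 + x v ^2/2)) ≤
        ∑ v ∈ U, ∑ u ∈ U, ind (u ≠ v) * cg w U u v * (x u * x v) := by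
      refine Finset.sum_le_sum fun v _ => Finset.sum_le_sum fun u _ => ?_
      have h2 : 0 ≤ ind (u ≠ v) * cg w U u v := mul_nonneg (ind_nonneg _) (cg_nonneg h _ _ _)
      nlinarith [sq_nonneg (x u + x v)]
    refine le_trans ?_ h1
    have h3 : ∑ v ∈ U, ∑ u ∈ U, ind (u ≠ v) * cg w U u v * x v ^2 ≤ (k-1) * Phi w U p := by
      unfold Phi
      rw [Finset.mul_sum]
      refine Finset.sum_le_sum fun v hv => ?_
      rw [← Finset.sum_mul, sum_cg h U hv]
      have := dg_le_one h U v
      have h4 : (k-1) * dg w U v ≤ (k-1) * 1 := mul_le_mul_of_nonneg_left this hk1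
      rw [mul_one] at h4
      exact mul_le_mul_of_nonneg_right h4 (sq_nonneg _)
    have h4 : ∑ v ∈ U, ∑ u ∈ U, ind (u ≠ v) * cg w U u v * x u ^2 =
        ∑ v ∈ U, ∑ u ∈ U, ind (u ≠ v) * cg w U u v * x v ^2 := by
      rw [Finset.sum_comm]
      refine Finset.sum_congr rfl fun v _ => Finset.sum_congr rfl fun u _ => ?_
      rw [cg_comm, ind_congr (ne_comm (a := v) (b := u))]
    have h5 : ∑ v ∈ U, ∑ u ∈ U, -(ind (u ≠ v) * cg w U u v * (x u ^2 /2 + x v ^2/2)) =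
        -((∑ v ∈ U, ∑ u ∈ U, ind (u ≠ v) * cg w U u v * x u ^2) / 2 +
          (∑ v ∈ U, ∑ u ∈ U, ind (u ≠ v) * cg w U u v * x v ^2) / 2) := by
      simp only [Finset.sum_div, ← Finset.sum_add_distrib, ← Finset.sum_neg_distrib]
      refine Finset.sum_congr rfl fun v _ => Finset.sum_congr rfl fun u _ => ?_
      ring
    rw [h5, h4]; linarith
  have hPhi : 0 ≤ Phi w U p := Finset.sum_nonneg fun v _ => sq_nonneg _
  rw [e3]
  have : 0 ≤ (k-1) * p * Phi w U p := by positivity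
  nlinarith

lemma nib_step (h : NW w k D) (hD : 0 ≤ D) (hk : 1 ≤ k) {U : Finset V}
    (p p' a : ℝ) (hp0 : 0 ≤ p) (hp1 : p ≤ 1) (ha : 0 ≤ a) (hN : 0 < U.card)
    (hp' : p - p' = p * (k * (k-1)) / U.card) (hq1 : p - p' ≤ a / Fintype.card V)
    (W c : ℝ) (hW : W = ∑ e ∈ U.powerset, w e) (hc : 0 < c) (hcW : c * Fintype.card V ≤ W) :
    ∃ e, e ⊆ U ∧ w e ≠ 0 ∧ Phi w (U \ e) p' ≤ Phi w U p +
      (4 * (k-1) / c * Phi w U p + (2 * a * k + 2 * (k^3 + k^2) * D + (k * D + a)^2)) / Fintype.card V := by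
  have hn : 0 < Fintype.card V := lt_of_lt_of_le hN (card_le_univ _)
  set n : ℝ := ((Fintype.card V : ℕ) : ℝ) with hndef
  have hn0 : 0 < n := Nat.cast_pos.mpr hn
  have hN0 : (0:ℝ) < U.card := Nat.cast_pos.mpr hN
  have hk1 : (0:ℝ) ≤ k - 1 := by
    have : (1:ℝ) ≤ k := by exact_mod_cast hk
    linarith
  have hk0 : (0:ℝ) < k := by linarith
  set C := (2 * a * k + 2 * (k^3 + k^2) * D + (k * D + a)^2) with hC
  have hW0 : 0 < W := lt_of_lt_of_le (by positivity) hcW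
  have hq0 : 0 ≤ p - p' := by rw [hp']; positivity
  set X := ∑ v ∈ U, (dg w U v - p) with hX
  set Φ := Phi w U p with hΦ
  have hΦ0 : 0 ≤ Φ := Finset.sum_nonneg fun v _ => sq_nonneg _
  have hXW : k * W = U.card * p + X := by
    rw [hX, Finset.sum_sub_distrib, sum_dg h U, hW]; simp
  have hXsq : X^2 ≤ U.card * Φ := by
    have := sq_sum_le_card_mul_sum_sq (s := U) (f := fun v => dg w U v - p)
    exact this
  by_contra hcon
  push Not at hcon
  have hlt : ∑ e ∈ U.powerset, w e * (Φ + (4 * (k-1) / c * Φ + C) / n) <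
      ∑ e ∈ U.powerset, w e * (Φ + 2 * (p - p') * X - 2 * ∑ v ∈ U, (dg w U v - p) * dt w U e v + C / n) := by
    apply Finset.sum_lt_sum
    · intro e he
      by_cases h0 : w e = 0
      · simp [h0]
      · have heU := mem_powerset.mp he
        have h1 := hcon e heU h0
        have h2 := nibA h hD heU (h.unif e h0) p p' a hp0 hp1 ha hn hq0 hq1
        exact mul_le_mul_of_nonneg_left (h1.trans_le h2).le (h.nn e)
    · have : ∃ e ∈ U.powerset, w e ≠ 0 := by
        by_contra h0
        push Not at h0
        rw [hW, Finset.sum_eq_zero h0] at hW0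
        exact lt_irrefl _ hW0
      obtain ⟨e, he, h0⟩ := this
      have heU := mem_powerset.mp he
      have h1 := hcon e heU h0
      have h2 := nibA h hD heU (h.unif e h0) p p' a hp0 hp1 ha hn hq0 hq1
      exact ⟨e, he, mul_lt_mul_of_pos_left (h1.trans_le h2) (lt_of_le_of_ne (h.nn e) (Ne.symm h0))⟩
  have hB := nibB h hk (U := U) p hp0
  rw [← hX, ← hΦ] at hB
  have e1 : ∑ e ∈ U.powerset, w e * (Φ + 2 * (p - p') * X - 2 * ∑ v ∈ U, (dg w U v - p) * dt w U e v + C / n)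
      = W * (Φ + 2 * (p - p') * X + C / n) - 2 * ∑ e ∈ U.powerset, w e * ∑ v ∈ U, (dg w U v - p) * dt w U e v := by
    rw [hW, Finset.sum_mul, Finset.mul_sum U.powerset, ← Finset.sum_sub_distrib]
    refine Finset.sum_congr rfl fun e _ => ?_
    ring
  rw [e1, ← Finset.sum_mul, ← hW] at hlt
  have e2 : W * (p - p') * X = (k-1) * p^2 * X + (k-1) * p * (X^2 / U.card) := by
    have : W = (U.card * p + X) / k := by rw [← hXW]; field_simp
    rw [hp', this]; field_simp
  have e3 : (k-1) * p * (X^2 / U.card) ≤ (k-1) * Φ := by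
    have h1 : X^2 / U.card ≤ Φ := by rw [div_le_iff₀ hN0]; linarith
    have h2 : (k-1) * p ≤ (k-1) * 1 := mul_le_mul_of_nonneg_left hp1 hk1
    calc (k-1) * p * (X^2 / U.card) ≤ (k-1) * 1 * Φ := by
          apply mul_le_mul h2 h1 (by positivity) (by positivity)
      _ = _ := by ring
  have e4 : 4 * ((k-1) * Φ) ≤ W * (4 * (k-1) / c * Φ / n) := by
    have : 4 * ((k-1) * Φ) = (c * n) * (4 * (k-1) / c * Φ / n) := by field_simp
    rw [this]
    exact mul_le_mul_of_nonneg_right hcW (by positivity)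
  have e5 : (4 * (k-1) / c * Φ + C) / n = 4 * (k-1) / c * Φ / n + C / n := add_div _ _ _
  rw [e5] at hlt
  nlinarith

end nib
end PMx


namespace PMx

open Finset
set_option linter.unusedSectionVars false
set_option linter.unusedVariables false

lemma one_sub_pow_ge (a : ℝ) (ha : 0 ≤ a) (n t : ℕ) (hn : 0 < n) (hna : 2 * a ≤ n) (ht : t ≤ n) :
    Real.exp (-(2*a)) ≤ (1 - a / n)^t := by
  have hn0 : (0:ℝ) < n := Nat.cast_pos.mpr hn
  set x := a / n with hx
  have hx0 : 0 ≤ x := by positivity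
  have hx2 : x ≤ 1/2 := by rw [hx, div_le_iff₀ hn0]; linarith
  have h1 : Real.exp (-(2*x)) ≤ 1 - x := by
    have h2 := Real.add_one_le_exp (2*x)
    rw [Real.exp_neg, inv_le_iff_one_le_mul₀ (Real.exp_pos _)]
    have h3 : 0 ≤ 1 - x := by linarith
    calc (1:ℝ) ≤ (1-x) * (2*x+1) := by nlinarith
      _ ≤ (1-x) * Real.exp (2*x) := mul_le_mul_of_nonneg_left h2 h3
  calc Real.exp (-(2*a)) = Real.exp (-(2*x))^n := by
        rw [← Real.exp_nat_mul, hx]; congr 1; field_simp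
    _ ≤ Real.exp (-(2*x))^t := pow_le_pow_of_le_one (Real.exp_pos _).le
        (by rw [Real.exp_le_one_iff]; linarith) ht
    _ ≤ _ := pow_le_pow_left₀ (Real.exp_pos _).le h1 t

lemma one_add_pow_le (a : ℝ) (ha : 0 ≤ a) (n t : ℕ) (hn : 0 < n) (ht : t ≤ n) :
    (1 + a / n)^t ≤ Real.exp a := by
  have hn0 : (0:ℝ) < n := Nat.cast_pos.mpr hn
  have h1 : 1 ≤ 1 + a/n := by have : 0 ≤ a / n := by positivity
                              linarith
  calc (1 + a / n)^t ≤ (1 + a/n)^n := pow_le_pow_right₀ h1 ht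
    _ ≤ Real.exp (a/n)^n := by
        apply pow_le_pow_left₀ (by linarith)
        have := Real.add_one_le_exp (a/n); linarith
    _ = _ := by rw [← Real.exp_nat_mul]; congr 1; field_simp

set_option maxHeartbeats 1000000 in
theorem nibble (k : ℕ) (hk : 1 ≤ k) (D : ℝ) (hD : 0 ≤ D) (σ : ℝ) (hσ : 0 < σ) :
    ∃ n₀ : ℕ, ∀ (V : Type) [Fintype V] [DecidableEq V] (w : Finset V → ℝ), n₀ ≤ Fintype.card V →
      NW w k D → ∃ M : Finset (Finset V), (∀ e ∈ M, w e ≠ 0) ∧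
        (M : Set (Finset V)).PairwiseDisjoint id ∧
        ((univ \ M.biUnion id).card : ℝ) ≤ σ * Fintype.card V := by
  have hkR : (1:ℝ) ≤ k := by exact_mod_cast hk
  have hk1 : (0:ℝ) ≤ k - 1 := by linarith
  have hk0 : (0:ℝ) < k := by linarith
  set a : ℝ := k * (k-1) / σ with ha
  have ha0 : 0 ≤ a := by positivity
  set p0 := Real.exp (-(2*a)) with hp0
  have hp0p : 0 < p0 := Real.exp_pos _
  set c := σ * p0 / (2*k) with hc
  have hc0 : 0 < c := by positivity
  set C := (2 * a * k + 2 * (k^3 + k^2) * D + (k * D + a)^2) with hC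
  have hC0 : 0 ≤ C := by positivity
  set C1 := 4 * (k-1) / c + C with hC1
  have hC10 : 0 ≤ C1 := by positivity
  set C2 := Real.exp C1 with hC2
  have hC2p : 0 < C2 := Real.exp_pos _
  refine ⟨⌈2*a⌉₊ + ⌈4 * C2 / (σ * p0^2)⌉₊ + 1, ?_⟩
  intro V _ _ w hnn h
  set n := Fintype.card V with hn
  have hn0 : 0 < n := by omega
  have hnR : (0:ℝ) < n := Nat.cast_pos.mpr hn0
  have hna : 2 * a ≤ n := (Nat.le_ceil _).trans (by exact_mod_cast (by omega : ⌈2*a⌉₊ ≤ n))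
  have hnC : 4 * C2 / (σ * p0^2) ≤ n :=
    (Nat.le_ceil _).trans (by exact_mod_cast (by omega : ⌈4 * C2 / (σ * p0^2)⌉₊ ≤ n))
  have han : a / n ≤ 1/2 := by rw [div_le_iff₀ hnR]; linarith
  by_contra hcon
  push Not at hcon
  have key : ∀ t : ℕ, ∃ M : Finset (Finset V), (∀ e ∈ M, w e ≠ 0) ∧
      (M : Set (Finset V)).PairwiseDisjoint id ∧ (univ \ M.biUnion id).card + k * t = n ∧
      ∃ p : ℝ, (1 - a/n)^t ≤ p ∧ p ≤ 1 ∧ Phi w (univ \ M.biUnion id) p + 1 ≤ (1 + C1 / n)^t := by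
    intro t
    induction t with
    | zero =>
      refine ⟨∅, by simp, by simp, by simp [hn], 1, by simp, le_rfl, ?_⟩
      have : Phi w (univ \ (∅ : Finset (Finset V)).biUnion id) 1 = 0 := by
        unfold Phi
        apply Finset.sum_eq_zero
        intro v _
        have : dg w (univ \ (∅ : Finset (Finset V)).biUnion id) v = 1 := by
          rw [← h.deg v, dg, Finset.sum_filter]
          simp only [biUnion_empty, sdiff_empty, powerset_univ]
          refine Finset.sum_congr rfl fun f _ => ?_
          by_cases hv : v ∈ f <;> simp [ind, hv]
        rw [this]; ring
      rw [this]; simp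
    | succ t ih =>
      obtain ⟨M, hM1, hM2, hM3, p, hp1, hp2, hΦ⟩ := ih
      set U := univ \ M.biUnion id with hU
      have hNσ : σ * n < U.card := hcon M hM1 hM2
      have hN0 : (0:ℝ) < U.card := lt_trans (by positivity) hNσ
      have ht : t ≤ n := by nlinarith
      have hpp : p0 ≤ p := (one_sub_pow_ge a ha0 n t hn0 hna ht).trans hp1
      have hppos : 0 < p := hp0p.trans_le hpp
      have hΦ0 : 0 ≤ Phi w U p := Finset.sum_nonneg fun v _ => sq_nonneg _
      have hΦC : Phi w U p ≤ C2 := by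
        have := one_add_pow_le C1 hC10 n t hn0 ht
        linarith
      set W := ∑ e ∈ U.powerset, w e with hW
      have hcW : c * n ≤ W := by
        set X := ∑ v ∈ U, (dg w U v - p) with hX
        have hXW : k * W = U.card * p + X := by
          rw [hX, Finset.sum_sub_distrib, sum_dg h U, hW]; simp
        have hXsq : X^2 ≤ U.card * Phi w U p :=
          sq_sum_le_card_mul_sum_sq (s := U) (f := fun v => dg w U v - p)
        have h1 : X^2 ≤ (U.card * p0 / 2)^2 := by
          refine hXsq.trans ?_
          have h2 : C2 ≤ U.card * p0^2 / 4 := by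
            rw [div_le_iff₀ (by positivity)] at hnC
            nlinarith [sq_pos_of_pos hp0p]
          calc (U.card:ℝ) * Phi w U p ≤ U.card * (U.card * p0^2 / 4) := by gcongr; linarith
            _ = _ := by ring
        have h2 : -(U.card * p0 / 2) ≤ X := (abs_le_of_sq_le_sq' h1 (by positivity)).1
        have h3 : (U.card : ℝ) * p0 ≤ U.card * p := by gcongr
        have h4 : σ * n * p0 ≤ U.card * p0 := by gcongr
        have h5 : k * (c * n) ≤ k * W := by
          have : k * (c * n) = σ * n * p0 / 2 := by rw [hc]; field_simp
          rw [this, hXW]; linarith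
        exact le_of_mul_le_mul_left h5 hk0
      set p' := p - p * (k * (k-1)) / U.card with hp'
      have hpd : p - p' = p * (k * (k-1)) / U.card := by rw [hp']; ring
      have hfrac : k * (k-1) / (U.card : ℝ) ≤ a / n := by
        rw [ha, div_div]
        gcongr
      have hq1 : p - p' ≤ p * (a / n) := by
        rw [hpd, mul_div_assoc]
        gcongr
      obtain ⟨e, heU, he0, heΦ⟩ := nib_step h hD hk (U := U) p p' a hppos.le hp2 ha0
        (by exact_mod_cast hN0) hpd
        (hq1.trans (mul_le_of_le_one_left (by positivity) hp2)) W c hW hc0 hcW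
      have hdisj : ∀ f ∈ M, Disjoint f e := by
        intro f hf
        have h1 : f ⊆ M.biUnion id := subset_biUnion_of_mem id hf
        rw [hU] at heU
        exact (disjoint_of_subset_right heU disjoint_sdiff).mono_left h1
      have hUe : univ \ (insert e M).biUnion id = U \ e := by
        rw [hU, biUnion_insert]
        ext v; simp only [mem_sdiff, mem_union, mem_univ, true_and, id]; tauto
      refine ⟨insert e M, ?_, ?_, ?_, p', ?_, ?_, ?_⟩
      · intro f hf
        rcases mem_insert.mp hf with rfl | hf
        · exact he0
        · exact hM1 f hf
      · rw [coe_insert]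
        apply hM2.insert
        intro f hf _
        exact (hdisj f hf).symm
      · rw [hUe, card_sdiff_of_subset heU, h.unif e he0]
        have := card_le_card heU
        rw [h.unif e he0] at this
        rw [mul_add]; omega
      · rw [pow_succ]
        calc (1 - a/n)^t * (1 - a/n) ≤ p * (1 - a/n) := mul_le_mul_of_nonneg_right hp1 (by linarith)
          _ ≤ p' := by linarith
      · have : 0 ≤ p - p' := by rw [hpd]; positivity
        linarith
      · rw [hUe, pow_succ]
        have h1 : (4 * (k-1) / c * Phi w U p + C) / n ≤ (Phi w U p + 1) * (C1 / n) := by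
          rw [← mul_div_assoc]
          apply div_le_div_of_nonneg_right _ hnR.le
          have h2 : 0 ≤ 4 * (k-1) / c := by positivity
          have h3 : 0 ≤ C * Phi w U p := by positivity
          rw [hC1]; nlinarith
        have h4 : 0 ≤ 1 + C1 / n := by positivity
        calc Phi w (U \ e) p' + 1 ≤ (Phi w U p + 1) * (1 + C1 / n) := by linarith
          _ ≤ _ := mul_le_mul_of_nonneg_right hΦ h4
  obtain ⟨M, _, _, h3, _⟩ := key (n+1)
  nlinarith

end PMx


namespace PMx

open Finset
set_option linter.unusedSectionVars false
set_option linter.unusedVariables false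

theorem apm (k d M : ℕ) (hk : k = d + (M+1)) (hM : 1 ≤ M) (hdM : d ≤ M) (hd : 1 ≤ d)
    (hG : (1 - (1 - 1/(k:ℝ))^(M+1)) + (M+1)*((M:ℝ)-d)*(1-1/(k:ℝ))^(M-1)/k^2 < 1/2) :
    ∃ γ : ℝ, 0 < γ ∧ ∀ σ : ℝ, 0 < σ → ∃ n₀ : ℕ, ∀ (V : Type) [Fintype V] [DecidableEq V],
      n₀ ≤ Fintype.card V → k ∣ Fintype.card V → ∀ H : Finset (Finset V),
      (∀ e ∈ H, e.card = k) → DegC H d (M+1) γ →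
      ∃ N ⊆ H, (N : Set (Finset V)).PairwiseDisjoint id ∧
        ((univ \ N.biUnion id).card : ℝ) ≤ σ * Fintype.card V := by
  obtain ⟨γ, hγ, D, hD, s₀, hfm⟩ := frac_matching k d M hk hM hdM hd hG
  refine ⟨γ, hγ, fun σ hσ => ?_⟩
  obtain ⟨n₁, hn⟩ := nibble k (by omega) D hD.le σ hσ
  refine ⟨max n₁ (k*s₀), ?_⟩
  intro V _ _ hV hkV H hH hdeg
  obtain ⟨s, hs⟩ := hkV
  have hss : s₀ ≤ s := by
    have h1 : k * s₀ ≤ k * s := by rw [← hs]; exact (le_max_right _ _).trans hV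
    exact Nat.le_of_mul_le_mul_left h1 (by omega)
  obtain ⟨w, hw0, hw1, hw2, hw3⟩ := hfm V s hss hs H hH hdeg
  have hsup : ∀ e, w e ≠ 0 → e ∈ H := fun e he => by_contra fun h => he (hw1 e h)
  obtain ⟨N, hN1, hN2, hN3⟩ := hn V w ((le_max_left _ _).trans hV)
    ⟨hw0, fun e he => hH e (hsup e he), hw2, hw3⟩
  exact ⟨N, fun e he => hsup e (hN1 e he), hN2, hN3⟩

end PMx


namespace PMx

open Finset
set_option linter.unusedSectionVars false
set_option linter.unusedVariables false

lemma exists_of_pr_pos {Ω : Type*} [Fintype Ω] {P : Ω → Prop} (h : 0 < pr P) : ∃ ω, P ω := by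
  by_contra hc
  push Not at hc
  have : pr P = 0 := by
    unfold pr ex
    rw [Finset.sum_eq_zero fun ω _ => ind_false (hc ω)]; simp
  linarith

lemma pr_markov {Ω : Type*} [Fintype Ω] (f : Ω → ℝ) (hf : ∀ ω, 0 ≤ f ω) (η : ℝ) (hη : 0 < η) :
    pr (fun ω => η < f ω) ≤ ex f / η := by
  rw [le_div_iff₀ hη]
  unfold pr
  rw [← ex_mul_right]
  refine ex_mono fun ω => ?_
  by_cases h : η < f ω
  · rw [ind_true h]; linarith
  · rw [ind_false h]; simpa using hf ω

section
variable {V : Type} [Fintype V] [DecidableEq V]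

def Nb (H : Finset (Finset V)) {ι : Type} [Fintype ι] (v : V) (x : ι → V) : Prop :=
  insert v (univ.image x) ∈ H

def pat (A : Finset V) {ι : Type} [Fintype ι] (f : ι → V) : Finset ι := univ.filter fun i => f i ∈ A

lemma pr_not_inj_cons_le [Nonempty V] (d' : ℕ) (v : V) :
    pr (fun y : Fin d' → V => ¬ Function.Injective (Fin.cons v y : Fin (d'+1) → V)) ≤
      ((d':ℝ)+1)^2 / Fintype.card V := by
  have h1 : pr (fun y : Fin d' → V => ¬ Function.Injective (Fin.cons v y : Fin (d'+1) → V)) ≤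
      pr (fun y : Fin d' → V => ¬ Function.Injective y ∨ ∃ i, y i ∈ ({v} : Finset V)) := by
    refine pr_mono fun y hy => ?_
    by_contra hc
    push Not at hc
    apply hy
    rw [Fin.cons_injective_iff]
    refine ⟨?_, hc.1⟩
    rintro ⟨i, hi⟩
    exact hc.2 i (by simp [hi])
  refine h1.trans ((pr_or_le _ _).trans ?_)
  have h2 := pr_not_inj_le (ι := Fin d') (Ω := V)
  have h3 := pr_hit_le (ι := Fin d') ({v} : Finset V)
  simp only [Fintype.card_fin, card_singleton, Nat.cast_one, mul_one] at h2 h3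
  have hn : (0:ℝ) < Fintype.card V := Nat.cast_pos.mpr Fintype.card_pos
  refine (add_le_add h2 h3).trans ?_
  rw [← add_div]
  apply div_le_div_of_nonneg_right _ hn.le
  nlinarith [Nat.cast_nonneg (α := ℝ) d']

lemma deg1 [Nonempty V] {H : Finset (Finset V)} {d' m : ℕ} {γ : ℝ} (hγ : 0 ≤ γ) (hγ2 : γ ≤ 1/2)
    (h : DegC H (d'+1) m γ) (v : V) :
    1/2 - γ - ((d':ℝ)+1)^2 / Fintype.card V ≤ pr (fun x : (Fin d' ⊕ Fin m) → V => Nb H v x) := by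
  have e := Equiv.sumArrowEquivProdArrow (Fin d') (Fin m) V
  rw [← pr_equiv (Equiv.sumArrowEquivProdArrow (Fin d') (Fin m) V).symm, pr_prod]
  have h1 : ∀ y : Fin d' → V, (1/2-γ) - ind (¬ Function.Injective (Fin.cons v y : Fin (d'+1) → V)) ≤
      pr (fun x : Fin m → V => Nb H v
        ((Equiv.sumArrowEquivProdArrow (Fin d') (Fin m) V).symm (y, x))) := by
    intro y
    by_cases hy : Function.Injective (Fin.cons v y : Fin (d'+1) → V)
    · rw [ind_false (by simpa using hy), sub_zero]
      refine (h _ hy).trans (pr_mono fun x hx => ?_)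
      unfold Ed at hx
      unfold Nb
      convert hx using 1
      ext z
      simp [Fin.exists_fin_succ, eq_comm, or_assoc]
    · rw [ind_true hy]
      have := pr_nonneg (fun x : Fin m → V => Nb H v
        ((Equiv.sumArrowEquivProdArrow (Fin d') (Fin m) V).symm (y, x)))
      linarith
  refine le_trans ?_ (ex_mono h1)
  rw [ex_sub, ex_const]
  have := pr_not_inj_cons_le d' v
  unfold pr at this
  linarith

end
end PMx


namespace PMx

open Finset
set_option linter.unusedSectionVars false
set_option linter.unusedVariables false

section
variable {V : Type} [Fintype V] [DecidableEq V]

lemma DegC.mono {H : Finset (Finset V)} {d m : ℕ} {γ γ' : ℝ} (h : DegC H d m γ) (hg : γ ≤ γ') :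
    DegC H d m γ' := fun s hs => by linarith [h s hs]

/-- type `i` edges are dense -/
def Typ (H : Finset (Finset V)) (A : Finset V) (d' m : ℕ) (μ : ℝ) (i : ℕ) : Prop :=
  ∃ τ : Finset (Fin (d'+1) ⊕ Fin m), τ.card = i ∧
    μ ≤ pr (fun f : (Fin (d'+1) ⊕ Fin m) → V => Ed H f ∧ pat A f = τ)

lemma pr_pat_ge [Nonempty V] {ι : Type} [Fintype ι] [DecidableEq ι] (A : Finset V) {ε : ℝ} (hε : 0 < ε)
    (h1 : ε * Fintype.card V ≤ A.card) (h2 : ε * Fintype.card V ≤ Aᶜ.card) (τ : Finset ι) :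
    ε ^ (Fintype.card ι) ≤ pr (fun f : ι → V => pat A f = τ) := by
  have hn : (0:ℝ) < Fintype.card V := Nat.cast_pos.mpr Fintype.card_pos
  have h3 : pr (fun f : ι → V => pat A f = τ) = pr (fun f : ι → V => ∀ i, (f i ∈ A ↔ i ∈ τ)) := by
    refine pr_congr fun f => ?_
    rw [Finset.ext_iff]; simp [pat]
  rw [h3, pr_pi (fun i x => (x ∈ A ↔ i ∈ τ)), ← Finset.card_univ, ← Finset.prod_const]
  refine Finset.prod_le_prod (fun _ _ => hε.le) fun i _ => ?_
  by_cases hi : i ∈ τ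
  · simp only [hi, iff_true]
    rw [pr_mem, le_div_iff₀ hn]; exact h1
  · simp only [hi, iff_false]
    have : pr (fun x => x ∉ A) = pr (fun x => x ∈ Aᶜ) := pr_congr fun x => by simp
    rw [this, pr_mem, le_div_iff₀ hn]; exact h2

/-- the pair of (first vertex, rest of first block) and second block -/
noncomputable def rowE (V : Type) (d' m : ℕ) :
    ((V × (Fin d' → V)) × (Fin m → V)) ≃ ((Fin (d'+1) ⊕ Fin m) → V) :=
  ((Equiv.prodCongr (Fin.consEquiv (fun _ => V)) (Equiv.refl _)).trans
    (Equiv.sumArrowEquivProdArrow (Fin (d'+1)) (Fin m) V).symm)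

lemma rowE_apply (d' m : ℕ) (u : V) (y : Fin d' → V) (x : Fin m → V) :
    rowE V d' m ((u, y), x) = Sum.elim (Fin.cons u y : Fin (d'+1) → V) x := by
  ext i; rcases i with i | i <;> simp [rowE, Fin.consEquiv]

lemma pat_card_row (A : Finset V) (d' m : ℕ) (u : V) (y : Fin d' → V) (x : Fin m → V) :
    (pat A (Sum.elim (Fin.cons u y : Fin (d'+1) → V) x)).card =
      (if u ∈ A then 1 else 0) + (pat A y).card + (pat A x).card := by
  unfold pat
  simp only [Finset.card_filter]
  rw [Fintype.sum_sum_type]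
  simp only [Sum.elim_inl, Sum.elim_inr, Fin.sum_univ_succ, Fin.cons_zero, Fin.cons_succ]
  congr!

lemma pr_marg1 {Y : Type*} [Fintype Y] [Nonempty V] (P : V × Y → Prop) :
    pr (fun z : V × (V × Y) => P (z.1, z.2.2)) = pr P := by
  rw [pr_prod, pr_prod]
  refine ex_congr fun u => ?_
  rw [pr_prod]
  exact ex_const (Ω := V) (pr fun b => P (u, b))

lemma pr_marg2 {Y : Type*} [Fintype Y] [Nonempty V] (P : Y → Prop) :
    pr (fun z : V × Y => P z.2) = pr P := by
  rw [pr_prod]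
  exact ex_const (Ω := V) (pr P)

/-- if type structure fails, contradiction -/
lemma types_aux [Nonempty V] (d' m : ℕ) {ε γ μ : ℝ} (hε : 0 < ε) (hμ : 0 < μ) (A : Finset V)
    (h1 : ε * Fintype.card V ≤ A.card) (h2 : ε * Fintype.card V ≤ Aᶜ.card)
    (H : Finset (Finset V)) (hdeg : DegC H (d'+1) m γ)
    (hγ : γ ≤ ε^m / 8)
    (hμs : 2 * (2^(d'+1+m) * μ / (ε^m/8)) + 2 * ((d':ℝ)+1)^2 / Fintype.card V < ε^(d'+2))
    (i : ℕ) (hi : i < d'+1+m) (hi1 : ¬ Typ H A d' m μ i) (hi2 : ¬ Typ H A d' m μ (i+1))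
    (hj : ∀ j, ¬ (Typ H A d' m μ j ∧ Typ H A d' m μ (j+1))) : False := by
  set K := Fin (d'+1) ⊕ Fin m with hK
  set η := ε^m / 8 with hη
  have hεm : 0 < ε^m := by positivity
  have hη0 : 0 < η := by positivity
  -- bad tuples
  let bad : (K → V) → Prop := fun f => Ed H f ∧ ¬ Typ H A d' m μ (pat A f).card
  have hbad : pr bad ≤ 2^(d'+1+m) * μ := by
    have h3 : pr bad ≤ pr (fun f : K → V => ∃ τ : Finset K,
        (Ed H f ∧ pat A f = τ) ∧ ¬ Typ H A d' m μ τ.card) := by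
      refine pr_mono fun f hf => ⟨pat A f, ⟨hf.1, rfl⟩, hf.2⟩
    refine h3.trans ((pr_exists_le _).trans ?_)
    have h4 : ∀ τ : Finset K, pr (fun f : K → V => (Ed H f ∧ pat A f = τ) ∧ ¬ Typ H A d' m μ τ.card)
        ≤ μ := by
      intro τ
      by_cases ht : Typ H A d' m μ τ.card
      · have : pr (fun f : K → V => (Ed H f ∧ pat A f = τ) ∧ ¬ Typ H A d' m μ τ.card) = 0 := by
          unfold pr ex
          rw [Finset.sum_eq_zero fun f _ => ind_false (fun h => h.2 ht)]; simp
        rw [this]; exact hμ.le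
      · refine (pr_mono fun f hf => hf.1).trans ?_
        by_contra hc
        push Not at hc
        exact ht ⟨τ, rfl, hc.le⟩
    refine (Finset.sum_le_sum fun τ _ => h4 τ).trans ?_
    simp [hK]
  let bd : V × (Fin d' → V) → ℝ := fun p => pr fun x : Fin m → V => bad (rowE V d' m (p, x))
  have hbd : ex bd ≤ 2^(d'+1+m) * μ := by
    have h3 : pr (fun z => bad (rowE V d' m z)) = pr bad := pr_equiv _ _
    rw [pr_prod] at h3
    exact h3.le.trans hbad
  have hbd0 : ∀ p, 0 ≤ bd p := fun p => pr_nonneg _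
  obtain ⟨a, b, hab, ha, hb⟩ : ∃ a b, a + b = i ∧ a ≤ d' ∧ b ≤ m :=
    ⟨i - m, i - (i - m), by omega, by omega, by omega⟩
  obtain ⟨τa, -, hτa⟩ := Finset.exists_subset_card_eq (s := (univ : Finset (Fin d'))) (n := a) (by simpa using ha)
  obtain ⟨τb, -, hτb⟩ := Finset.exists_subset_card_eq (s := (univ : Finset (Fin m))) (n := b) (by simpa using hb)
  have hn : (0:ℝ) < Fintype.card V := Nat.cast_pos.mpr Fintype.card_pos
  -- the good event
  let W : V × (V × (Fin d' → V)) → Prop := fun z => z.1 ∉ A ∧ (z.2.1 ∈ A ∧ pat A z.2.2 = τa)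
  have hW : ε^(d'+2) ≤ pr W := by
    have e1 : ε ≤ pr (fun u => u ∉ A) := by
      have : pr (fun x => x ∉ A) = pr (fun x => x ∈ Aᶜ) := pr_congr fun x => by simp
      rw [this, pr_mem, le_div_iff₀ hn]; exact h2
    have e2 : ε ≤ pr (fun u => u ∈ A) := by
      rw [pr_mem, le_div_iff₀ hn]; exact h1
    have e3 := pr_pat_ge (ι := Fin d') A hε h1 h2 τa
    rw [Fintype.card_fin] at e3
    have e4 := pr_prod_ge (P := fun u : V => u ∈ A) (Q := fun _ (y : Fin d' → V) => pat A y = τa)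
      (by positivity) e2 (fun _ _ => e3)
    have e5 := pr_prod_ge (P := fun u : V => u ∉ A)
      (Q := fun _ (p : V × (Fin d' → V)) => p.1 ∈ A ∧ pat A p.2 = τa)
      (by positivity) e1 (fun _ _ => e4)
    refine le_trans (le_of_eq ?_) e5
    ring
  let B1 : V × (Fin d' → V) → Prop := fun p => η < bd p
  let B2 : V × (Fin d' → V) → Prop := fun p => ¬ Function.Injective (Fin.cons p.1 p.2 : Fin (d'+1) → V)
  have hB1 : pr B1 ≤ 2^(d'+1+m) * μ / η :=
    (pr_markov bd hbd0 η hη0).trans (div_le_div_of_nonneg_right hbd hη0.le)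
  have hB2 : pr B2 ≤ ((d':ℝ)+1)^2 / Fintype.card V := by
    rw [pr_prod]
    refine le_trans (ex_mono fun u => pr_not_inj_cons_le d' u) (le_of_eq (ex_const _))
  have hB : ∀ P : V × (V × (Fin d' → V)) → Prop, (∀ z, P z → (B1 (z.1, z.2.2) ∨ B2 (z.1, z.2.2)) ∨
      (B1 z.2 ∨ B2 z.2)) → pr P < ε^(d'+2) := by
    intro P hP
    refine lt_of_le_of_lt (pr_mono hP) ?_
    refine lt_of_le_of_lt (pr_or_le _ _) ?_
    have q1 := pr_or_le (fun z : V × (V × (Fin d' → V)) => B1 (z.1, z.2.2)) (fun z => B2 (z.1, z.2.2))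
    have q2 := pr_or_le (fun z : V × (V × (Fin d' → V)) => B1 z.2) (fun z => B2 z.2)
    rw [pr_marg1 B1, pr_marg1 B2] at q1
    rw [pr_marg2 B1, pr_marg2 B2] at q2
    have q3 : 2 * ((d':ℝ)+1)^2 / Fintype.card V = 2 * (((d':ℝ)+1)^2 / Fintype.card V) := by ring
    rw [q3] at hμs
    linarith
  have hpos : 0 < pr (fun z => W z ∧ ¬ ((B1 (z.1, z.2.2) ∨ B2 (z.1, z.2.2)) ∨ (B1 z.2 ∨ B2 z.2))) := by
    refine lt_of_lt_of_le ?_ (pr_and_not_ge _ _)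
    have := hB _ (fun z hz => hz)
    linarith
  obtain ⟨⟨u, v, y⟩, ⟨hu, hv, hy⟩, hnb⟩ := exists_of_pr_pos hpos
  push Not at hnb
  obtain ⟨⟨c1, c2⟩, c3, c4⟩ := hnb
  simp only [B1, B2, not_lt, not_not] at c1 c2 c3 c4
  have D1 := hdeg _ c2
  have D2 := hdeg _ c4
  simp only [bd] at c1 c3
  have hb3 := pr_pat_ge (ι := Fin m) A hε h1 h2 τb
  rw [Fintype.card_fin] at hb3
  have : Nonempty (Fin m → V) := inferInstance
  have key : pr (fun x : Fin m → V => Ed H (Sum.elim (Fin.cons u y : Fin (d'+1) → V) x)) +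
      pr (fun x : Fin m → V => Ed H (Sum.elim (Fin.cons v y : Fin (d'+1) → V) x)) +
      pr (fun x : Fin m → V => pat A x = τb) ≤ 1 +
      (pr (fun x : Fin m → V => bad (rowE V d' m ((u, y), x))) +
        pr (fun x : Fin m → V => bad (rowE V d' m ((v, y), x)))) := by
    have e0 : (1:ℝ) = ex (fun _ : Fin m → V => (1:ℝ)) := (ex_const 1).symm
    rw [e0]
    unfold pr
    rw [← ex_add, ← ex_add, ← ex_add, ← ex_add]
    refine ex_mono fun x => ?_
    simp only [rowE_apply]
    have t1 := pat_card_row A d' m u y x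
    have t2 := pat_card_row A d' m v y x
    simp only [hu, hv, if_true, if_false, hy, hτa] at t1 t2
    simp only [bad]
    rw [t1, t2]
    have g1 := ind_le_one (Ed H (Sum.elim (Fin.cons u y : Fin (d'+1) → V) x))
    have g2 := ind_le_one (Ed H (Sum.elim (Fin.cons v y : Fin (d'+1) → V) x))
    have g3 := ind_le_one (pat A x = τb)
    rw [ind_and, ind_and]
    have k1 := ind_nonneg (Ed H (Sum.elim (Fin.cons u y : Fin (d'+1) → V) x))
    have k2 := ind_nonneg (Ed H (Sum.elim (Fin.cons v y : Fin (d'+1) → V) x))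
    by_cases hx : pat A x = τb
    · have s1 : 0 + a + (pat A x).card = i := by rw [hx, hτb]; omega
      have s2 : 1 + a + (pat A x).card = i + 1 := by omega
      rw [s1, s2, ind_true hi1, ind_true hi2]
      linarith
    · rw [ind_false hx]
      have s2 : 1 + a + (pat A x).card = (0 + a + (pat A x).card) + 1 := by omega
      rw [s2]
      by_cases q1 : Typ H A d' m μ (0 + a + (pat A x).card)
      · have q2 : ¬ Typ H A d' m μ (0 + a + (pat A x).card + 1) := fun h => hj _ ⟨q1, h⟩
        rw [ind_true q2]
        have := mul_nonneg k1 (ind_nonneg (¬Typ H A d' m μ (0 + a + (pat A x).card)))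
        linarith
      · rw [ind_true q1]
        have := mul_nonneg k2 (ind_nonneg (¬Typ H A d' m μ (0 + a + (pat A x).card + 1)))
        linarith
  have : η = ε^m/8 := rfl
  linarith

theorem types (d' m : ℕ) (hk : 3 ≤ d' + 1 + m) (ε : ℝ) (hε : 0 < ε) :
    ∃ γ : ℝ, 0 < γ ∧ ∃ μ : ℝ, 0 < μ ∧ ∃ n₀ : ℕ, ∀ (V : Type) [Fintype V] [DecidableEq V],
      n₀ ≤ Fintype.card V → ∀ A : Finset V, ε * Fintype.card V ≤ A.card →
      ε * Fintype.card V ≤ Aᶜ.card → ∀ H : Finset (Finset V), DegC H (d'+1) m γ →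
      ∃ i s : ℕ, (s = 1 ∨ s = 2) ∧ Typ H A d' m μ i ∧ Typ H A d' m μ (i+s) := by
  have hd0 : (0:ℝ) < (d':ℝ)+1 := by positivity
  refine ⟨ε^m/8, by positivity, ε^(d'+2) * (ε^m/8) / (8 * 2^(d'+1+m)), by positivity,
    ⌈8 * ((d':ℝ)+1)^2 / ε^(d'+2)⌉₊ + 1, ?_⟩
  intro V _ _ hn A h1 h2 H hdeg
  have hn1 : 8 * ((d':ℝ)+1)^2 / ε^(d'+2) ≤ Fintype.card V := by
    refine (Nat.le_ceil _).trans ?_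
    exact Nat.cast_le.mpr (by omega)
  have hn0 : 0 < Fintype.card V := by omega
  have hn0R : (0:ℝ) < Fintype.card V := by exact_mod_cast hn0
  have : Nonempty V := Fintype.card_pos_iff.mp hn0
  have hcond : 2 * (2^(d'+1+m) * (ε^(d'+2) * (ε^m/8) / (8 * 2^(d'+1+m))) / (ε^m/8)) +
      2 * ((d':ℝ)+1)^2 / Fintype.card V < ε^(d'+2) := by
    have e1 : 2 * (2^(d'+1+m) * (ε^(d'+2) * (ε^m/8) / (8 * 2^(d'+1+m))) / (ε^m/8)) = ε^(d'+2)/4 := by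
      field_simp; ring
    rw [e1]
    have hε2 : 0 < ε^(d'+2) := by positivity
    have e2 : 2 * ((d':ℝ)+1)^2 / Fintype.card V ≤ ε^(d'+2) / 4 := by
      rw [div_le_iff₀ hn0R]
      rw [div_le_iff₀ hε2] at hn1
      nlinarith
    linarith
  by_contra hc
  push Not at hc
  set μ := ε^(d'+2) * (ε^m/8) / (8 * 2^(d'+1+m)) with hμ
  have hj : ∀ j, ¬ (Typ H A d' m μ j ∧ Typ H A d' m μ (j+1)) := fun j hj => hc j 1 (Or.inl rfl) hj.1 hj.2
  have hj2 : ∀ j, Typ H A d' m μ j → ¬ Typ H A d' m μ (j+2) := fun j hj => hc j 2 (Or.inr rfl) hj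
  have main : ∀ i, i < d'+1+m → Typ H A d' m μ i ∨ Typ H A d' m μ (i+1) := by
    intro i hi
    by_contra hcc
    push Not at hcc
    exact types_aux d' m hε (by positivity) A h1 h2 H hdeg le_rfl hcond i hi hcc.1 hcc.2 hj
  have m0 := main 0 (by omega)
  have m1 := main 1 (by omega)
  have m2 := main 2 (by omega)
  have j0 := hj 0
  have j1 := hj 1
  have j2 := hj 2
  have p0 := hj2 0
  have p1 := hj2 1
  simp only [zero_add, Nat.reduceAdd] at *
  tauto

end
end PMx


namespace PMx

open Finset
set_option linter.unusedSectionVars false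
set_option linter.unusedVariables false

section hyb
variable {V : Type} [Fintype V] [DecidableEq V] {ι : Type} [Fintype ι] [DecidableEq ι]

/-- swap the coordinates in `T` between two tuples -/
def pwE (V : Type) (ι : Type) [DecidableEq ι] (T : Finset ι) :
    ((ι → V) × (ι → V)) ≃ ((ι → V) × (ι → V)) where
  toFun p := (T.piecewise p.2 p.1, T.piecewise p.1 p.2)
  invFun p := (T.piecewise p.2 p.1, T.piecewise p.1 p.2)
  left_inv p := by
    ext i <;> by_cases hi : i ∈ T <;> simp [hi]
  right_inv p := by
    ext i <;> by_cases hi : i ∈ T <;> simp [hi]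

lemma hybrid [Nonempty V] (L : (ι → V) → Prop) (T : Finset ι) :
    pr (fun p : (ι → V) × (ι → V) => ¬ (L p.1 ↔ L (T.piecewise p.2 p.1))) ≤
      ∑ i ∈ T, pr (fun p : V × (ι → V) => ¬ (L p.2 ↔ L (Function.update p.2 i p.1))) := by
  induction T using Finset.induction_on with
  | empty => simp [pr, ex, ind]
  | insert i T hi ih =>
    rw [Finset.sum_insert hi]
    have h1 : pr (fun p : (ι → V) × (ι → V) => ¬ (L p.1 ↔ L ((insert i T).piecewise p.2 p.1))) ≤
        pr (fun p : (ι → V) × (ι → V) => ¬ (L (T.piecewise p.2 p.1) ↔ L ((insert i T).piecewise p.2 p.1))) +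
        pr (fun p : (ι → V) × (ι → V) => ¬ (L p.1 ↔ L (T.piecewise p.2 p.1))) := by
      refine le_trans (pr_mono fun p hp => ?_) (pr_or_le _ _)
      tauto
    refine h1.trans (add_le_add ?_ ih)
    have h2 : pr (fun p : (ι → V) × (ι → V) => ¬ (L p.1 ↔ L (Function.update p.1 i (p.2 i)))) =
        pr (fun p : (ι → V) × (ι → V) => ¬ (L (T.piecewise p.2 p.1) ↔ L ((insert i T).piecewise p.2 p.1))) := by
      rw [← pr_equiv (pwE V ι T)]
      refine pr_congr fun p => ?_
      have : Function.update (T.piecewise p.2 p.1) i (T.piecewise p.1 p.2 i) = (insert i T).piecewise p.2 p.1 := by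
        rw [Finset.piecewise_insert, Finset.piecewise_eq_of_notMem _ _ _ hi]
      simp only [pwE, Equiv.coe_fn_mk, this]
    rw [← h2, pr_prod, pr_prod]
    unfold pr
    rw [ex_comm (Ω := V)]
    refine ex_mono fun S => ?_
    exact le_of_eq (ex_coord i (fun x => ind (¬ (L S ↔ L (Function.update S i x)))))

/-- swap the external vertex with coordinate `i` -/
def swE (V : Type) (ι : Type) [DecidableEq ι] (i : ι) : (V × (ι → V)) ≃ (V × (ι → V)) where
  toFun p := (p.2 i, Function.update p.2 i p.1)
  invFun p := (p.2 i, Function.update p.2 i p.1)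
  left_inv p := by simp
  right_inv p := by simp

lemma Nb_swap (H : Finset (Finset V)) (x : V) (S : ι → V) (i : ι) :
    Nb H (S i) (Function.update S i x) ↔ Nb H x S := by
  have : insert (S i) (univ.image (Function.update S i x)) = insert x (univ.image S) := by
    ext z
    simp only [mem_insert, mem_image, mem_univ, true_and]
    constructor
    · rintro (rfl | ⟨j, rfl⟩)
      · exact Or.inr ⟨i, rfl⟩
      · by_cases hj : j = i
        · subst hj; simp
        · rw [Function.update_of_ne hj]; exact Or.inr ⟨j, rfl⟩
    · rintro (rfl | ⟨j, rfl⟩)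
      · exact Or.inr ⟨i, by simp⟩
      · by_cases hj : j = i
        · subst hj; simp
        · exact Or.inr ⟨j, by rw [Function.update_of_ne hj]⟩
  unfold Nb; rw [this]

def Adj (H : Finset (Finset V)) (ι : Type) [Fintype ι] [DecidableEq ι] (β : ℝ) (u v : V) : Prop :=
  β ≤ pr (fun x : ι → V => Nb H u x ∧ Nb H v x)

lemma Adj.symm {H : Finset (Finset V)} {β : ℝ} {u v : V} (h : Adj H ι β u v) : Adj H ι β v u := by
  unfold Adj at *
  rwa [pr_congr fun x => and_comm]

lemma adj_self {H : Finset (Finset V)} {β γ : ℝ} (hβ : β ≤ 1/2 - γ) {u : V}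
    (hN : 1/2 - γ ≤ pr (fun x : ι → V => Nb H u x)) : Adj H ι β u u := by
  unfold Adj
  rw [pr_congr fun x => and_self_iff]; linarith

lemma adj_triple [Nonempty V] {H : Finset (Finset V)} {β γ : ℝ} (hβ : β + γ < 1/6)
    (hN : ∀ v, 1/2 - γ ≤ pr (fun x : ι → V => Nb H v x)) (u v w : V) :
    Adj H ι β u v ∨ Adj H ι β u w ∨ Adj H ι β v w := by
  by_contra hc
  push Not at hc
  obtain ⟨h1, h2, h3⟩ := hc
  unfold Adj at h1 h2 h3
  push Not at h1 h2 h3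
  have key : pr (fun x : ι → V => Nb H u x) + pr (fun x : ι → V => Nb H v x) +
      pr (fun x : ι → V => Nb H w x) ≤ 1 + (pr (fun x : ι → V => Nb H u x ∧ Nb H v x) +
      pr (fun x : ι → V => Nb H u x ∧ Nb H w x) + pr (fun x : ι → V => Nb H v x ∧ Nb H w x)) := by
    have e0 : (1:ℝ) = ex (fun _ : ι → V => (1:ℝ)) := (ex_const 1).symm
    rw [e0]
    unfold pr
    rw [← ex_add, ← ex_add, ← ex_add, ← ex_add, ← ex_add]
    refine ex_mono fun x => ?_
    simp only [ind_and]
    by_cases a : Nb H u x <;> by_cases b : Nb H v x <;> by_cases c : Nb H w x <;>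
      simp [ind, a, b, c] <;> norm_num
  have := hN u
  have := hN v
  have := hN w
  linarith

lemma min_adj [Nonempty V] {H : Finset (Finset V)} {β : ℝ} (hβ0 : 0 < β)
    (hβ : β * (100 * (Fintype.card ι + 1)) = 1)
    (hN : ∀ v, 1/2 - β ≤ pr (fun x : ι → V => Nb H v x)) (w : V) :
    β ≤ pr (fun x => Adj H ι β w x) := by
  by_contra hc
  push Not at hc
  have hq : (0:ℝ) ≤ Fintype.card ι := Nat.cast_nonneg _
  have hβs : β ≤ 1/100 := by nlinarith
  set L : (ι → V) → Prop := fun S => Nb H w S with hL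
  have hexn : ∃ x, ¬ Adj H ι β w x := by
    refine exists_of_pr_pos ?_
    rw [pr_not]; linarith
  have hpl : 1/2 - β ≤ pr L := hN w
  have hpu : pr L ≤ 1/2 + 2 * β := by
    obtain ⟨x, hx⟩ := hexn
    unfold Adj at hx
    push Not at hx
    have e1 : pr L + pr (fun S : ι → V => Nb H x S) ≤ 1 + pr (fun S : ι → V => Nb H w S ∧ Nb H x S) := by
      have e0 : (1:ℝ) = ex (fun _ : ι → V => (1:ℝ)) := (ex_const 1).symm
      rw [e0]
      unfold pr
      rw [← ex_add, ← ex_add]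
      refine ex_mono fun S => ?_
      simp only [ind_and, hL]
      by_cases a : Nb H w S <;> by_cases b : Nb H x S <;> simp [ind, a, b]
    linarith [hN x]
  -- disagreement
  let D : V × (ι → V) → Prop := fun p => (Nb H p.1 p.2 ↔ L p.2)
  have hD : pr D ≤ 5 * β := by
    rw [pr_prod]
    have e1 : ∀ x : V, pr (fun S => D (x, S)) ≤ 4 * β + ind (Adj H ι β w x) := by
      intro x
      by_cases hx : Adj H ι β w x
      · rw [ind_true hx]; linarith [pr_le_one (fun S => D (x, S))]
      · rw [ind_false hx]
        unfold Adj at hx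
        push Not at hx
        have e2 : pr (fun S => D (x, S)) = 1 + 2 * pr (fun S : ι → V => Nb H w S ∧ Nb H x S)
            - pr L - pr (fun S : ι → V => Nb H x S) := by
          have e0 : (1:ℝ) = ex (fun _ : ι → V => (1:ℝ)) := (ex_const 1).symm
          rw [e0]
          unfold pr
          rw [← ex_mul_left, ← ex_add, ← ex_sub, ← ex_sub]
          refine ex_congr fun S => ?_
          simp only [ind_and, hL, D]
          by_cases a : Nb H w S <;> by_cases b : Nb H x S <;> simp [ind, a, b] <;> norm_num
        rw [e2]
        linarith [hN x]
    refine (ex_mono e1).trans ?_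
    rw [ex_add, ex_const]
    unfold pr at hc
    linarith
  have hI : ∀ i, pr (fun p : V × (ι → V) => ¬ (L p.2 ↔ L (Function.update p.2 i p.1))) ≤ 10 * β := by
    intro i
    have e1 : pr (fun p => D (swE V ι i p)) = pr D := pr_equiv _ _
    have e2 := pr_or_le D (fun p => D (swE V ι i p))
    refine le_trans (pr_mono fun p hp => ?_) (e2.trans (by linarith))
    have e3 := Nb_swap H p.1 p.2 i
    simp only [D, swE, Equiv.coe_fn_mk]
    rw [e3]
    tauto
  have hh := hybrid L univ
  have hh2 : ∑ i, pr (fun p : V × (ι → V) => ¬ (L p.2 ↔ L (Function.update p.2 i p.1))) ≤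
      Fintype.card ι * (10 * β) := by
    refine (Finset.sum_le_sum fun i _ => hI i).trans ?_
    simp
  have hprod : pr (fun p : (ι → V) × (ι → V) => L p.1 ∧ ¬ L p.2) = pr L * (1 - pr L) := by
    rw [← pr_not, pr_prod]
    have : ∀ a : ι → V, pr (fun b : ι → V => L a ∧ ¬ L b) = ind (L a) * pr (fun b => ¬ L b) := by
      intro a
      unfold pr
      rw [← ex_mul_left]
      exact ex_congr fun b => ind_and _ _
    simp only [this]
    rw [ex_mul_right]; rfl
  have hle : pr (fun p : (ι → V) × (ι → V) => L p.1 ∧ ¬ L p.2) ≤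
      pr (fun p : (ι → V) × (ι → V) => ¬ (L p.1 ↔ L ((univ : Finset ι).piecewise p.2 p.1))) := by
    refine pr_mono fun p hp => ?_
    rw [Finset.piecewise_univ]
    tauto
  have hb : Fintype.card ι * (10 * β) ≤ 1/10 := by nlinarith
  have hlow : (48/100:ℝ) * (48/100) ≤ pr L * (1 - pr L) := by
    apply mul_le_mul <;> linarith
  linarith

end hyb
end PMx


namespace PMx

open Finset
set_option linter.unusedSectionVars false
set_option linter.unusedVariables false

section
variable {V : Type} [Fintype V] [DecidableEq V]

open Classical in
lemma two_parts (hn : 2 ≤ Fintype.card V) (R : V → V → Prop) (hs : ∀ u v, R u v → R v u)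
    (ht : ∀ u v w, R u v ∨ R u w ∨ R v w) {ε : ℝ} (hε : 0 < ε) (hε1 : ε ≤ 1)
    (hm : ∀ w, ε ≤ pr (fun x => R w x)) :
    ∃ A : Finset V, ε/4 * Fintype.card V ≤ A.card ∧ ε/4 * Fintype.card V ≤ Aᶜ.card ∧
      ∀ u v, (u ∈ A ↔ v ∈ A) →
        (ε/4) * (ε/4) ≤ pr (fun p : V × V => R u p.1 ∧ (R p.1 p.2 ∧ R p.2 v)) := by
  have hn0 : 0 < Fintype.card V := by omega
  have hnR : (0:ℝ) < Fintype.card V := by exact_mod_cast hn0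
  have hne : Nonempty V := Fintype.card_pos_iff.mp hn0
  set c := ε/4 with hc
  have hc0 : 0 < c := by positivity
  by_cases h1 : ∀ u v, c ≤ pr (fun z => R u z ∧ R v z)
  · obtain ⟨A, -, hA⟩ := Finset.exists_subset_card_eq (s := (univ : Finset V))
      (n := Fintype.card V / 2) (by simp; omega)
    have e1 : Fintype.card V ≤ 4 * (Fintype.card V / 2) := by omega
    have e2 : (Fintype.card V : ℝ) ≤ 4 * ((Fintype.card V / 2 : ℕ) : ℝ) := by exact_mod_cast e1
    have e3 : A.card ≤ Aᶜ.card := by rw [card_compl, hA]; omega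
    have e4 : (A.card : ℝ) ≤ Aᶜ.card := by exact_mod_cast e3
    rw [← hA] at e2
    have e5 : c * Fintype.card V ≤ A.card := by nlinarith
    refine ⟨A, e5, e5.trans e4, fun u v _ => ?_⟩
    refine (pr_prod_ge hc0.le (P := fun z => R u z) (Q := fun z z' => R z z' ∧ R z' v) (a := c) (b := c)
      ?_ ?_)
    · refine (h1 u u).trans (pr_mono fun z hz => hz.1)
    · intro z _
      exact (h1 z v).trans (pr_mono fun z' hz => ⟨hz.1, hs _ _ hz.2⟩)
  · push Not at h1
    obtain ⟨u, v, huv⟩ := h1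
    set A0 : Finset V := univ.filter fun x => ¬ R v x with hA0
    set B0 : Finset V := univ.filter fun x => R v x ∧ ¬ R u x with hB0
    have mA : ∀ x, x ∈ A0 ↔ ¬ R v x := by simp [hA0]
    have mB : ∀ x, x ∈ B0 ↔ R v x ∧ ¬ R u x := by simp [hB0]
    have cA : ∀ x ∈ A0, ∀ y ∈ A0, R x y := by
      intro x hx y hy
      rw [mA] at hx hy
      have := ht v x y; tauto
    have cB : ∀ x ∈ B0, ∀ y ∈ B0, R x y := by
      intro x hx y hy
      rw [mB] at hx hy
      have := ht u x y; tauto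
    have pA : ε - c ≤ pr (fun x => x ∈ A0) := by
      have := pr_and_not_ge (fun x => R u x) (fun x => R u x ∧ R v x)
      refine le_trans ?_ (this.trans (pr_mono fun x hx => ?_))
      · linarith [hm u]
      · rw [mA]; tauto
    have pB : ε - c ≤ pr (fun x => x ∈ B0) := by
      have := pr_and_not_ge (fun x => R v x) (fun x => R u x ∧ R v x)
      refine le_trans ?_ (this.trans (pr_mono fun x hx => ?_))
      · linarith [hm v]
      · rw [mB]; tauto
    set A : Finset V := univ.filter fun x => x ∈ A0 ∨ (x ∉ B0 ∧ c ≤ pr (fun z => z ∈ A0 ∧ R x z)) with hA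
    have hinA : ∀ x ∈ A, c ≤ pr (fun z => z ∈ A0 ∧ R x z) := by
      intro x hx
      rw [hA, mem_filter] at hx
      rcases hx.2 with h | h
      · refine le_trans ?_ (pr_mono (P := fun z => z ∈ A0) fun z hz => ⟨hz, cA x h z hz⟩)
        linarith
      · exact h.2
    have hinB : ∀ x, x ∉ A → c ≤ pr (fun z => z ∈ B0 ∧ R x z) := by
      intro x hx
      rw [hA, mem_filter] at hx
      push Not at hx
      have hx := hx (mem_univ _)
      by_cases hb : x ∈ B0
      · refine le_trans ?_ (pr_mono (P := fun z => z ∈ B0) fun z hz => ⟨hz, cB x hb z hz⟩)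
        linarith
      · have h3 := hx.2 hb
        have h4 : pr (fun z => R x z) ≤ pr (fun z => z ∈ B0 ∧ R x z) +
            (pr (fun z => z ∈ A0 ∧ R x z) + pr (fun z => R u z ∧ R v z)) := by
          refine le_trans (pr_mono fun z hz => ?_) ((pr_or_le _ _).trans
            (add_le_add le_rfl (pr_or_le _ _)))
          rw [mA, mB]; tauto
        linarith [hm x]
    have subA : A0 ⊆ A := fun x hx => by rw [hA, mem_filter]; exact ⟨mem_univ _, Or.inl hx⟩
    have subB : B0 ⊆ Aᶜ := by
      intro x hx
      rw [mem_compl, hA, mem_filter]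
      have h1 := (mB x).mp hx
      have h2 := mA x
      tauto
    rw [pr_mem, le_div_iff₀ hnR] at pA pB
    have qA : (A0.card : ℝ) ≤ A.card := by exact_mod_cast card_le_card subA
    have qB : (B0.card : ℝ) ≤ Aᶜ.card := by exact_mod_cast card_le_card subB
    have hcc : c * Fintype.card V ≤ (ε - c) * Fintype.card V := by
      apply mul_le_mul_of_nonneg_right _ hnR.le; linarith
    refine ⟨A, by linarith, by linarith, fun x y hxy => ?_⟩
    by_cases hx : x ∈ A
    · have hy := hxy.mp hx
      refine le_trans (pr_prod_ge hc0.le (P := fun z => z ∈ A0 ∧ R x z)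
        (Q := fun z z' => z' ∈ A0 ∧ R y z') (hinA x hx) (fun _ _ => hinA y hy)) (pr_mono fun p hp => ?_)
      exact ⟨hp.1.2, cA _ hp.1.1 _ hp.2.1, hs _ _ hp.2.2⟩
    · have hy := fun h => hx (hxy.mpr h)
      refine le_trans (pr_prod_ge hc0.le (P := fun z => z ∈ B0 ∧ R x z)
        (Q := fun z z' => z' ∈ B0 ∧ R y z') (hinB x hx) (fun _ _ => hinB y hy)) (pr_mono fun p hp => ?_)
      exact ⟨hp.1.2, cB _ hp.1.1 _ hp.2.1, hs _ _ hp.2.2⟩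

end
end PMx


namespace PMx

open Finset
set_option linter.unusedSectionVars false
set_option linter.unusedVariables false

section
variable {V : Type} [Fintype V] [DecidableEq V] {ι : Type} [Fintype ι] [DecidableEq ι]

/-- `U` is perfectly matched by edges of `H`. -/
def Mat (H : Finset (Finset V)) (U : Finset V) : Prop :=
  ∃ M ⊆ H, (M : Set (Finset V)).PairwiseDisjoint id ∧ M.biUnion id = U

lemma Mat.empty (H : Finset (Finset V)) : Mat H ∅ := ⟨∅, by simp, by simp, by simp⟩

lemma Mat.single {H : Finset (Finset V)} {e : Finset V} (he : e ∈ H) : Mat H e :=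
  ⟨{e}, by simpa using he, by simp, by simp⟩

lemma Mat.union {H : Finset (Finset V)} {U U' : Finset V} (h : Mat H U) (h' : Mat H U')
    (hd : Disjoint U U') : Mat H (U ∪ U') := by
  obtain ⟨M, hM, hp, hU⟩ := h
  obtain ⟨M', hM', hp', hU'⟩ := h'
  refine ⟨M ∪ M', union_subset hM hM', ?_, ?_⟩
  · rw [coe_union, Set.pairwiseDisjoint_union]
    refine ⟨hp, hp', fun e he e' he' _ => ?_⟩
    refine hd.mono ?_ ?_
    · rw [← hU]; exact subset_biUnion_of_mem id he
    · rw [← hU']; exact subset_biUnion_of_mem id he'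
  · rw [union_biUnion, hU, hU']

lemma Mat.biUnion {H : Finset (Finset V)} {α : Type*} [DecidableEq α] (s : Finset α) (f : α → Finset V)
    (h : ∀ a ∈ s, Mat H (f a)) (hd : (s : Set α).PairwiseDisjoint f) : Mat H (s.biUnion f) := by
  induction s using Finset.induction_on with
  | empty => simpa using Mat.empty H
  | insert a s ha ih =>
    rw [biUnion_insert]
    refine (h a (mem_insert_self _ _)).union (ih (fun b hb => h b (mem_insert_of_mem hb))
      (hd.subset (by simp))) ?_
    rw [disjoint_biUnion_right]
    intro b hb
    exact hd (by simp) (by simp [hb]) (fun h => ha (h ▸ hb))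

lemma Mat.card_dvd {H : Finset (Finset V)} {k : ℕ} (hH : ∀ e ∈ H, e.card = k) {U : Finset V}
    (h : Mat H U) : k ∣ U.card := by
  obtain ⟨M, hM, hp, rfl⟩ := h
  rw [card_biUnion (fun e he e' he' hne => hp he he' hne)]
  exact Finset.dvd_sum fun e he => by simp [hH e (hM he)]

def Lk (H : Finset (Finset V)) {Λ : Type} [Fintype Λ] (u v : V) (l : Λ → V) : Prop :=
  Function.Injective l ∧ (∀ p, l p ≠ u) ∧ (∀ p, l p ≠ v) ∧ Mat H (insert u (univ.image l)) ∧
    Mat H (insert v (univ.image l))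

abbrev LIdx (ι : Type) := Bool ⊕ (ι ⊕ (ι ⊕ ι))

/-- tuple of a link -/
def lkE (V ι : Type) : ((V × V) × ((ι → V) × ((ι → V) × (ι → V)))) ≃ (LIdx ι → V) :=
  (Equiv.prodCongr (Equiv.boolArrowEquivProd V).symm ((Equiv.prodCongr (Equiv.refl _)
    (Equiv.sumArrowEquivProdArrow ι ι V).symm).trans (Equiv.sumArrowEquivProdArrow ι (ι ⊕ ι) V).symm)).trans
    (Equiv.sumArrowEquivProdArrow Bool (ι ⊕ (ι ⊕ ι)) V).symm

lemma lkE_apply (z z' : V) (S1 S2 S3 : ι → V) :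
    lkE V ι ((z, z'), (S1, (S2, S3))) =
      Sum.elim (fun b => if b then z' else z) (Sum.elim S1 (Sum.elim S2 S3)) := by
  ext i
  rcases i with (_ | _) | (i | (i | i)) <;> simp [lkE, Equiv.boolArrowEquivProd]

lemma Mat3 {H : Finset (Finset V)} {z z' u : V} {S1 S2 S3 : ι → V}
    (h : Function.Injective (Sum.elim (fun b : Bool => if b then z' else z) (Sum.elim S1 (Sum.elim S2 S3))))
    (hu : ∀ p, (Sum.elim (fun b : Bool => if b then z' else z) (Sum.elim S1 (Sum.elim S2 S3))) p ≠ u)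
    (h1 : Nb H u S1) (h2 : Nb H z S2) (h3 : Nb H z' S3) :
    Mat H (insert u (univ.image
      (Sum.elim (fun b : Bool => if b then z' else z) (Sum.elim S1 (Sum.elim S2 S3))))) := by
  have u1 : z ≠ u := by simpa using hu (Sum.inl false)
  have u2 : z' ≠ u := by simpa using hu (Sum.inl true)
  have u3 : ∀ i, S1 i ≠ u := fun i => by simpa using hu (Sum.inr (Sum.inl i))
  have u4 : ∀ i, S2 i ≠ u := fun i => by simpa using hu (Sum.inr (Sum.inr (Sum.inl i)))
  have u5 : ∀ i, S3 i ≠ u := fun i => by simpa using hu (Sum.inr (Sum.inr (Sum.inr i)))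
  have zz : z ≠ z' := by simpa using h.ne (a₁ := Sum.inl false) (a₂ := Sum.inl true) (by simp)
  have z1 : ∀ i, S1 i ≠ z := fun i => by
    simpa using h.ne (a₁ := Sum.inr (Sum.inl i)) (a₂ := Sum.inl false) (by simp)
  have z2 : ∀ i, S2 i ≠ z := fun i => by
    simpa using h.ne (a₁ := Sum.inr (Sum.inr (Sum.inl i))) (a₂ := Sum.inl false) (by simp)
  have z3 : ∀ i, S3 i ≠ z := fun i => by
    simpa using h.ne (a₁ := Sum.inr (Sum.inr (Sum.inr i))) (a₂ := Sum.inl false) (by simp)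
  have y1 : ∀ i, S1 i ≠ z' := fun i => by
    simpa using h.ne (a₁ := Sum.inr (Sum.inl i)) (a₂ := Sum.inl true) (by simp)
  have y2 : ∀ i, S2 i ≠ z' := fun i => by
    simpa using h.ne (a₁ := Sum.inr (Sum.inr (Sum.inl i))) (a₂ := Sum.inl true) (by simp)
  have y3 : ∀ i, S3 i ≠ z' := fun i => by
    simpa using h.ne (a₁ := Sum.inr (Sum.inr (Sum.inr i))) (a₂ := Sum.inl true) (by simp)
  have s12 : ∀ i j, S1 i ≠ S2 j := fun i j => by
    simpa using h.ne (a₁ := Sum.inr (Sum.inl i)) (a₂ := Sum.inr (Sum.inr (Sum.inl j))) (by simp)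
  have s13 : ∀ i j, S1 i ≠ S3 j := fun i j => by
    simpa using h.ne (a₁ := Sum.inr (Sum.inl i)) (a₂ := Sum.inr (Sum.inr (Sum.inr j))) (by simp)
  have s23 : ∀ i j, S2 i ≠ S3 j := fun i j => by
    simpa using h.ne (a₁ := Sum.inr (Sum.inr (Sum.inl i))) (a₂ := Sum.inr (Sum.inr (Sum.inr j))) (by simp)
  have d23 : Disjoint (insert z (univ.image S2)) (insert z' (univ.image S3)) := by
    rw [disjoint_left]
    simp only [mem_insert, mem_image, mem_univ, true_and]
    rintro a (rfl | ⟨i, rfl⟩) (rfl | ⟨j, hj⟩)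
    · exact zz rfl
    · exact z3 j hj
    · exact y2 i rfl
    · exact s23 i j hj.symm
  have d1 : Disjoint (insert u (univ.image S1)) (insert z (univ.image S2) ∪ insert z' (univ.image S3)) := by
    rw [disjoint_left]
    simp only [mem_insert, mem_image, mem_univ, true_and, mem_union]
    rintro a (rfl | ⟨i, rfl⟩) ((h | ⟨j, hj⟩) | (h | ⟨j, hj⟩))
    · exact u1 h.symm
    · exact u4 j hj
    · exact u2 h.symm
    · exact u5 j hj
    · exact z1 i h
    · exact s12 i j hj.symm
    · exact y1 i h
    · exact s13 i j hj.symm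
  have := (Mat.single h1).union ((Mat.single h2).union (Mat.single h3) d23) d1
  convert this using 1
  ext a
  simp only [mem_insert, mem_image, mem_univ, true_and, mem_union, Sum.exists, Sum.elim_inl, Sum.elim_inr,
    Bool.exists_bool, if_true]
  simp only [Bool.false_eq_true, if_false, eq_comm (a := a)]
  tauto

lemma Mat3' {H : Finset (Finset V)} {z z' u : V} {S1 S2 S3 : ι → V}
    (h : Function.Injective (Sum.elim (fun b : Bool => if b then z' else z) (Sum.elim S1 (Sum.elim S2 S3))))
    (hu : ∀ p, (Sum.elim (fun b : Bool => if b then z' else z) (Sum.elim S1 (Sum.elim S2 S3))) p ≠ u)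
    (h1 : Nb H z S1) (h2 : Nb H z' S2) (h3 : Nb H u S3) :
    Mat H (insert u (univ.image
      (Sum.elim (fun b : Bool => if b then z' else z) (Sum.elim S1 (Sum.elim S2 S3))))) := by
  -- reversed order of the previous lemma
  let e : LIdx ι ≃ LIdx ι :=
    { toFun := Sum.elim (fun b => Sum.inl (!b))
        (Sum.elim (fun i => Sum.inr (Sum.inr (Sum.inr i))) (Sum.elim (fun i => Sum.inr (Sum.inr (Sum.inl i)))
          (fun i => Sum.inr (Sum.inl i))))
      invFun := Sum.elim (fun b => Sum.inl (!b))
        (Sum.elim (fun i => Sum.inr (Sum.inr (Sum.inr i))) (Sum.elim (fun i => Sum.inr (Sum.inr (Sum.inl i)))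
          (fun i => Sum.inr (Sum.inl i))))
      left_inv := by rintro (b | (i | (i | i))) <;> simp
      right_inv := by rintro (b | (i | (i | i))) <;> simp }
  have he : (Sum.elim (fun b : Bool => if b then z else z') (Sum.elim S3 (Sum.elim S2 S1))) =
      (Sum.elim (fun b : Bool => if b then z' else z) (Sum.elim S1 (Sum.elim S2 S3))) ∘ e := by
    ext i
    rcases i with (_ | _) | (i | (i | i)) <;> simp [e]
  have key := Mat3 (H := H) (z := z') (z' := z) (u := u) (S1 := S3) (S2 := S2) (S3 := S1)
    (by rw [he]; exact h.comp e.injective) (by rw [he]; exact fun p => hu (e p)) h3 h2 h1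
  rw [he] at key
  convert key using 2
  ext a
  simp only [mem_image, mem_univ, true_and, Function.comp]
  exact ⟨fun ⟨p, hp⟩ => ⟨e.symm p, by simpa using hp⟩, fun ⟨p, hp⟩ => ⟨e p, hp⟩⟩

lemma link_density [Nonempty V] {H : Finset (Finset V)} {β c : ℝ} (hβ : 0 ≤ β) (u v : V)
    (h : c ≤ pr (fun p : V × V => Adj H ι β u p.1 ∧ (Adj H ι β p.1 p.2 ∧ Adj H ι β p.2 v))) :
    c * β^3 - ((Fintype.card (LIdx ι):ℝ)^2 + 2 * Fintype.card (LIdx ι)) / Fintype.card V ≤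
      pr (fun l : LIdx ι → V => Lk H u v l) := by
  have h1 : c * β^3 ≤ pr (fun p : (V × V) × ((ι → V) × ((ι → V) × (ι → V))) =>
      (Adj H ι β u p.1.1 ∧ (Adj H ι β p.1.1 p.1.2 ∧ Adj H ι β p.1.2 v)) ∧
      ((Nb H u p.2.1 ∧ Nb H p.1.1 p.2.1) ∧ ((Nb H p.1.1 p.2.2.1 ∧ Nb H p.1.2 p.2.2.1) ∧
        (Nb H p.1.2 p.2.2.2 ∧ Nb H v p.2.2.2)))) := by
    refine pr_prod_ge (b := β^3) (by positivity) h
      (Q := fun (z : V × V) (s : (ι → V) × ((ι → V) × (ι → V))) => 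
      ((Nb H u s.1 ∧ Nb H z.1 s.1) ∧ ((Nb H z.1 s.2.1 ∧ Nb H z.2 s.2.1) ∧
        (Nb H z.2 s.2.2 ∧ Nb H v s.2.2)))) ?_
    rintro ⟨z, z'⟩ ⟨a1, a2, a3⟩
    have e1 := pr_prod_ge hβ a2 (Q := fun _ (S : ι → V) => Nb H z' S ∧ Nb H v S) (fun _ _ => a3)
    have e2 := pr_prod_ge (mul_nonneg hβ hβ) a1 (Q := fun _ (s : (ι → V) × (ι → V)) =>
      ((Nb H z s.1 ∧ Nb H z' s.1) ∧ (Nb H z' s.2 ∧ Nb H v s.2))) (fun _ _ => e1)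
    refine le_trans (le_of_eq (by ring)) e2
  rw [← pr_equiv (lkE V ι)]
  have h2 : pr (fun p => ¬ Function.Injective (lkE V ι p) ∨ ∃ i, lkE V ι p i ∈ ({u, v} : Finset V)) ≤
      ((Fintype.card (LIdx ι):ℝ)^2 + 2 * Fintype.card (LIdx ι)) / Fintype.card V := by
    refine (pr_or_le _ _).trans ?_
    rw [pr_equiv (lkE V ι) (fun l => ¬ Function.Injective l),
      pr_equiv (lkE V ι) (fun l => ∃ i, l i ∈ ({u, v} : Finset V)), add_div]
    refine add_le_add pr_not_inj_le ((pr_hit_le _).trans ?_)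
    apply div_le_div_of_nonneg_right _ (Nat.cast_nonneg _)
    have : ((({u, v} : Finset V).card : ℕ) : ℝ) ≤ 2 := by exact_mod_cast card_le_two
    have h0 : (0:ℝ) ≤ Fintype.card (LIdx ι) := Nat.cast_nonneg _
    nlinarith
  refine le_trans (sub_le_sub h1 h2) ((pr_and_not_ge _ _).trans (pr_mono ?_))
  rintro ⟨⟨z, z'⟩, S1, S2, S3⟩ ⟨⟨-, ⟨a1, a2⟩, ⟨a3, a4⟩, a5, a6⟩, hb⟩
  push Not at hb
  simp only [lkE_apply] at hb ⊢
  obtain ⟨hb1, hb2⟩ := hb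
  have hu : ∀ p, (Sum.elim (fun b : Bool => if b then z' else z) (Sum.elim S1 (Sum.elim S2 S3))) p ≠ u :=
    fun p hp => hb2 p (by simp [hp])
  have hv : ∀ p, (Sum.elim (fun b : Bool => if b then z' else z) (Sum.elim S1 (Sum.elim S2 S3))) p ≠ v :=
    fun p hp => hb2 p (by simp [hp])
  exact ⟨hb1, hu, hv, Mat3 hb1 hu a1 a3 a5, Mat3' hb1 hv a2 a4 a6⟩

end
end PMx


namespace PMx

open Finset
set_option linter.unusedSectionVars false
set_option linter.unusedVariables false

section
variable {V : Type} [Fintype V] [DecidableEq V] {K Λ : Type} [Fintype K] [DecidableEq K]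
  [Fintype Λ] [DecidableEq Λ]

/-- `T` absorbs `Q` -/
def Ab (H : Finset (Finset V)) (Q T : Finset V) : Prop :=
  Disjoint T Q ∧ Mat H T ∧ Mat H (T ∪ Q)

def abE (V K Λ : Type) : ((K → V) × (K → Λ → V)) ≃ ((K ⊕ (K × Λ)) → V) :=
  (Equiv.prodCongr (Equiv.refl _) (Equiv.curry K Λ V).symm).trans
    (Equiv.sumArrowEquivProdArrow K (K × Λ) V).symm

lemma abE_apply (F : K → V) (l : K → Λ → V) :
    abE V K Λ (F, l) = Sum.elim F (fun p => l p.1 p.2) := by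
  ext i
  rcases i with i | ⟨i, j⟩ <;> simp [abE, Function.uncurry]

lemma ab_of {H : Finset (Finset V)} {g F : K → V} {l : K → Λ → V} (hg : Function.Injective g)
    (hF : Ed H F) (hl : ∀ p, Lk H (g p) (F p) (l p))
    (hinj : Function.Injective (Sum.elim F (fun p : K × Λ => l p.1 p.2)))
    (hav : ∀ i, Sum.elim F (fun p : K × Λ => l p.1 p.2) i ∉ univ.image g) :
    Ab H (univ.image g) (univ.image (Sum.elim F (fun p : K × Λ => l p.1 p.2))) := by
  have a1 : ∀ p q, F p ≠ g q := fun p q h => hav (Sum.inl p) (by simp [h])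
  have a2 : ∀ p j q, l p j ≠ g q := fun p j q h => hav (Sum.inr (p, j)) (by simp [h])
  have a3 : ∀ p q, F p = F q → p = q := fun p q h => by
    have := hinj (a₁ := Sum.inl p) (a₂ := Sum.inl q) (by simpa using h); simpa using this
  have a4 : ∀ p q j, F p ≠ l q j := fun p q j => by
    simpa using hinj.ne (a₁ := Sum.inl p) (a₂ := Sum.inr (q, j)) (by simp)
  have a5 : ∀ p q i j, l p i = l q j → p = q := fun p q i j h => by
    have := hinj (a₁ := Sum.inr (p, i)) (a₂ := Sum.inr (q, j)) (by simpa using h)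
    simp at this; exact this.1
  refine ⟨?_, ?_, ?_⟩
  · rw [disjoint_left]
    intro a ha
    simp only [mem_image, mem_univ, true_and] at ha
    obtain ⟨i, rfl⟩ := ha
    exact hav i
  · have := Mat.biUnion (H := H) (univ : Finset K) (fun p => insert (F p) (univ.image (l p)))
      (fun p _ => (hl p).2.2.2.2) (by
        intro p _ q _ hpq
        simp only [Function.onFun]
        rw [disjoint_left]
        simp only [mem_insert, mem_image, mem_univ, true_and]
        rintro a (rfl | ⟨i, rfl⟩) (h | ⟨j, hj⟩)
        · exact hpq (a3 _ _ h)
        · exact a4 _ _ _ hj.symm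
        · exact a4 _ _ _ h.symm
        · exact hpq (a5 _ _ _ _ hj).symm)
    convert this using 1
    ext a
    simp only [mem_insert, mem_image, mem_univ, true_and, mem_biUnion, Sum.exists, Sum.elim_inl,
      Sum.elim_inr, Prod.exists, exists_or, eq_comm (a := a)]
  · have h1 := Mat.biUnion (H := H) (univ : Finset K) (fun p => insert (g p) (univ.image (l p)))
      (fun p _ => (hl p).2.2.2.1) (by
        intro p _ q _ hpq
        simp only [Function.onFun]
        rw [disjoint_left]
        simp only [mem_insert, mem_image, mem_univ, true_and]
        rintro a (rfl | ⟨i, rfl⟩) (h | ⟨j, hj⟩)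
        · exact hpq (hg h)
        · exact a2 _ _ _ hj
        · exact a2 _ _ _ h
        · exact hpq (a5 _ _ _ _ hj).symm)
    have h2 := (Mat.single hF).union h1 (by
        rw [disjoint_left]
        simp only [mem_insert, mem_image, mem_univ, true_and, mem_biUnion]
        rintro a ⟨p, rfl⟩ ⟨q, (h | ⟨j, hj⟩)⟩
        · exact a1 _ _ h
        · exact a4 _ _ _ hj.symm)
    convert h2 using 1
    ext a
    simp only [mem_insert, mem_image, mem_univ, true_and, mem_biUnion, Sum.exists, Sum.elim_inl,
      Sum.elim_inr, Prod.exists, exists_or, mem_union, eq_comm (a := a)]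
    exact or_right_comm.trans or_assoc

lemma ab_density [Nonempty V] {H : Finset (Finset V)} {A : Finset V} {τ : Finset K} {μ α : ℝ}
    (hα : 0 ≤ α) (hμ : μ ≤ pr (fun f : K → V => Ed H f ∧ pat A f = τ))
    (hl : ∀ u v, (u ∈ A ↔ v ∈ A) → α ≤ pr (fun l : Λ → V => Lk H u v l))
    (g : K → V) (hg : Function.Injective g) (hgp : pat A g = τ) :
    μ * α^(Fintype.card K) - ((Fintype.card (K ⊕ (K × Λ)):ℝ)^2 +
        Fintype.card (K ⊕ (K × Λ)) * Fintype.card K) / Fintype.card V ≤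
      pr (fun t : (K ⊕ (K × Λ)) → V => Function.Injective t ∧ Ab H (univ.image g) (univ.image t)) := by
  have h1 : μ * α^(Fintype.card K) ≤ pr (fun z : (K → V) × (K → Λ → V) =>
      (Ed H z.1 ∧ pat A z.1 = τ) ∧ ∀ p, Lk H (g p) (z.1 p) (z.2 p)) := by
    refine pr_prod_ge (b := α^(Fintype.card K)) (by positivity) hμ (Q := fun F (l : K → Λ → V) => ∀ p, Lk H (g p) (F p) (l p)) ?_
    rintro F ⟨-, hF⟩
    rw [pr_pi (fun p (l : Λ → V) => Lk H (g p) (F p) l), ← Finset.card_univ, ← Finset.prod_const]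
    refine Finset.prod_le_prod (fun _ _ => hα) fun p _ => hl _ _ ?_
    have : p ∈ pat A g ↔ p ∈ pat A F := by rw [hgp, hF]
    simpa [pat] using this
  rw [← pr_equiv (abE V K Λ)]
  have h2 : pr (fun p => ¬ Function.Injective (abE V K Λ p) ∨ ∃ i, abE V K Λ p i ∈ univ.image g) ≤
      ((Fintype.card (K ⊕ (K × Λ)):ℝ)^2 +
        Fintype.card (K ⊕ (K × Λ)) * Fintype.card K) / Fintype.card V := by
    refine (pr_or_le _ _).trans ?_
    rw [pr_equiv (abE V K Λ) (fun l => ¬ Function.Injective l),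
      pr_equiv (abE V K Λ) (fun l => ∃ i, l i ∈ univ.image g), add_div]
    refine add_le_add pr_not_inj_le ((pr_hit_le _).trans (le_of_eq ?_))
    rw [card_image_of_injective _ hg, card_univ]
  refine le_trans (sub_le_sub h1 h2) ((pr_and_not_ge _ _).trans (pr_mono ?_))
  rintro ⟨F, l⟩ ⟨⟨⟨a1, a2⟩, a3⟩, hb⟩
  push Not at hb
  simp only [abE_apply] at hb ⊢
  exact ⟨hb.1, ab_of hg a1 a3 hb.1 hb.2⟩

end

abbrev KI (d' m : ℕ) := Fin (d'+1) ⊕ Fin m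
abbrev ThI (d' m : ℕ) := KI d' m ⊕ (KI d' m × LIdx (Fin d' ⊕ Fin m))

instance ldec (ι : Type) [DecidableEq ι] : DecidableEq (LIdx ι) :=
  @instDecidableEqSum _ _ inferInstance (@instDecidableEqSum _ _ inferInstance inferInstance)

instance (d' m : ℕ) : DecidableEq (ThI d' m) :=
  @instDecidableEqSum _ _ inferInstance (@instDecidableEqProd _ _ inferInstance inferInstance)

theorem absorb_struct (d' m : ℕ) (hk : 3 ≤ d' + 1 + m) :
    ∃ γ : ℝ, 0 < γ ∧ ∃ ε : ℝ, 0 < ε ∧ ∃ α : ℝ, 0 < α ∧ ∃ n₀ : ℕ,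
      ∀ (V : Type) [Fintype V] [DecidableEq V], n₀ ≤ Fintype.card V →
      ∀ H : Finset (Finset V), DegC H (d'+1) m γ →
      ∃ A : Finset V, ε * Fintype.card V ≤ A.card ∧ ε * Fintype.card V ≤ Aᶜ.card ∧
      ∃ i s : ℕ, (s = 1 ∨ s = 2) ∧ ∃ τ₁ τ₂ : Finset (KI d' m), τ₁.card = i ∧ τ₂.card = i + s ∧
        ∀ g : KI d' m → V, Function.Injective g → (pat A g = τ₁ ∨ pat A g = τ₂) →
          α ≤ pr (fun t : ThI d' m → V => Function.Injective t ∧ Ab H (univ.image g) (univ.image t)) := by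
  set q : ℕ := Fintype.card (Fin d' ⊕ Fin m) with hq
  set β : ℝ := 1 / (100 * (q + 1)) with hβ
  have hβ0 : 0 < β := by positivity
  have hβ1 : β * (100 * (q + 1)) = 1 := by rw [hβ]; field_simp
  have hβs : β ≤ 1/100 := by
    have : (0:ℝ) ≤ q := Nat.cast_nonneg _
    nlinarith
  set ε := β/4 with hε
  have hε0 : 0 < ε := by positivity
  obtain ⟨γ₁, hγ₁, μ, hμ, n₁, htyp⟩ := types d' m hk ε hε0
  set c₁ : ℝ := ε * ε * β^3 with hc₁
  have hc₁0 : 0 < c₁ := by positivity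
  set N₁ : ℝ := ((Fintype.card (LIdx (Fin d' ⊕ Fin m)):ℝ)^2 + 2 * Fintype.card (LIdx (Fin d' ⊕ Fin m))) with hN₁
  set α₀ : ℝ := μ * (c₁/2)^(Fintype.card (KI d' m)) with hα₀
  have hα₀0 : 0 < α₀ := by positivity
  set N₂ : ℝ := ((Fintype.card (ThI d' m):ℝ)^2 +
        Fintype.card (ThI d' m) * Fintype.card (KI d' m)) with hN₂
  refine ⟨min γ₁ (β/2), by positivity, ε, hε0, α₀/2, by positivity,
    n₁ + 2 + ⌈N₁ / (c₁/2)⌉₊ + ⌈N₂ / (α₀/2)⌉₊ + ⌈((d':ℝ)+1)^2/(β/2)⌉₊, ?_⟩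
  intro V _ _ hn H hdeg
  have hn0 : 0 < Fintype.card V := by omega
  have hnR : (0:ℝ) < Fintype.card V := by exact_mod_cast hn0
  have hne : Nonempty V := Fintype.card_pos_iff.mp hn0
  have b1 : N₁ / (c₁/2) ≤ Fintype.card V := (Nat.le_ceil _).trans (Nat.cast_le.mpr (by omega))
  have b2 : N₂ / (α₀/2) ≤ Fintype.card V := (Nat.le_ceil _).trans (Nat.cast_le.mpr (by omega))
  have b3 : ((d':ℝ)+1)^2/(β/2) ≤ Fintype.card V := (Nat.le_ceil _).trans (Nat.cast_le.mpr (by omega))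
  have inv : ∀ N x : ℝ, 0 < x → N / x ≤ Fintype.card V → N / Fintype.card V ≤ x := by
    intro N x hx h
    rw [div_le_iff₀ hx] at h
    rw [div_le_iff₀ hnR]; linarith
  have b1 := inv _ _ (by positivity) b1
  have b2 := inv _ _ (by positivity) b2
  have b3 := inv _ _ (by positivity) b3
  have hN : ∀ v, 1/2 - β ≤ pr (fun x : (Fin d' ⊕ Fin m) → V => Nb H v x) := by
    intro v
    have := deg1 (H := H) (γ := β/2) (by positivity) (by linarith) (hdeg.mono (min_le_right _ _)) v
    linarith
  obtain ⟨A, hA1, hA2, hA3⟩ := two_parts (V := V) (by omega) (fun u v => Adj H (Fin d' ⊕ Fin m) β u v)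
    (fun u v h => h.symm) (adj_triple (γ := β) (by linarith) hN) hβ0 (by linarith)
    (fun w => min_adj hβ0 hβ1 hN w)
  obtain ⟨i, s, hs, ⟨τ₁, h1, h1'⟩, ⟨τ₂, h2, h2'⟩⟩ :=
    htyp V (by omega) A hA1 hA2 H (hdeg.mono (min_le_left _ _))
  refine ⟨A, hA1, hA2, i, s, hs, τ₁, τ₂, h1, h2, ?_⟩
  have hl : ∀ u v, (u ∈ A ↔ v ∈ A) → c₁/2 ≤ pr (fun l : LIdx (Fin d' ⊕ Fin m) → V => Lk H u v l) := by
    intro u v huv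
    have := link_density (ι := Fin d' ⊕ Fin m) (H := H) hβ0.le u v (hA3 u v huv)
    rw [← hε, ← hc₁, ← hN₁] at this
    linarith
  have fin : ∀ τ : Finset (KI d' m), μ ≤ pr (fun f : KI d' m → V => Ed H f ∧ pat A f = τ) →
      ∀ g : KI d' m → V, Function.Injective g → pat A g = τ →
      α₀/2 ≤ pr (fun t : ThI d' m → V => Function.Injective t ∧ Ab H (univ.image g) (univ.image t)) := by
    intro τ hτ g hg hgp
    have := ab_density (K := KI d' m) (Λ := LIdx (Fin d' ⊕ Fin m)) (by positivity) hτ hl g hg hgp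
    rw [← hα₀] at this
    change α₀ - N₂ / _ ≤ _ at this
    linarith
  rintro g hg (hgp | hgp)
  · exact fin τ₁ h1' g hg hgp
  · exact fin τ₂ h2' g hg hgp

end PMx


namespace PMx

open Finset
set_option linter.unusedSectionVars false
set_option linter.unusedVariables false

section
variable {V : Type} [Fintype V] [DecidableEq V] {Θ : Type} [Fintype Θ] [DecidableEq Θ]
  {Γ : Type}

open scoped Classical in
lemma select [Nonempty V] [Nonempty Θ] {H : Finset (Finset V)} (G : Finset Γ) (Q : Γ → Finset V)
    {α : ℝ} (hα : 0 < α)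
    (h : ∀ g ∈ G, α ≤ pr (fun t : Θ → V => Function.Injective t ∧ Ab H (Q g) (univ.image t)))
    (X : Finset V) (r : ℕ)
    (hr : (Fintype.card Θ : ℝ) * (Fintype.card Θ * r + X.card) / Fintype.card V ≤ α/2) :
    ∃ 𝓣 : Finset (Finset V), 𝓣.card ≤ r ∧ (𝓣 : Set (Finset V)).PairwiseDisjoint id ∧
      (∀ T ∈ 𝓣, T.card = Fintype.card Θ ∧ Disjoint T X ∧ Mat H T) ∧
      ∑ g ∈ G, (1/2:ℝ)^(𝓣.filter (fun T => Ab H (Q g) T)).card ≤ (1 - α/4)^r * G.card := by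
  induction r with
  | zero => exact ⟨∅, by simp, by simp, by simp, by simp⟩
  | succ r ih =>
    have hV : (0:ℝ) < Fintype.card V := by exact_mod_cast Fintype.card_pos
    obtain ⟨𝓣, h1, h2, h3, h4⟩ := ih (le_trans (by
      push_cast
      gcongr
      linarith) hr)
    set U := 𝓣.biUnion id ∪ X with hU
    have hUc : (U.card : ℝ) ≤ Fintype.card Θ * r + X.card := by
      have a1 : U.card ≤ (𝓣.biUnion id).card + X.card := card_union_le _ _
      have a2 : (𝓣.biUnion id).card ≤ 𝓣.card * Fintype.card Θ :=
        card_biUnion_le_card_mul _ _ _ fun T hT => (h3 T hT).1.le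
      have a3 : 𝓣.card * Fintype.card Θ ≤ Fintype.card Θ * r := by
        rw [mul_comm]; exact Nat.mul_le_mul_left _ h1
      exact_mod_cast (by omega : U.card ≤ Fintype.card Θ * r + X.card)
    have hp : ∀ g ∈ G, α/2 ≤ pr (fun t : Θ → V =>
        (Function.Injective t ∧ Ab H (Q g) (univ.image t)) ∧ ¬ ∃ i, t i ∈ U) := by
      intro g hg
      refine le_trans ?_ (pr_and_not_ge _ _)
      have := pr_hit_le (ι := Θ) U
      have b : (Fintype.card Θ : ℝ) * U.card / Fintype.card V ≤ α/2 := by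
        refine le_trans ?_ hr
        push_cast
        gcongr
        linarith
      linarith [h g hg]
    set w : Γ → ℝ := fun g => (1/2:ℝ)^(𝓣.filter (fun T => Ab H (Q g) T)).card with hw
    have hw0 : ∀ g, 0 ≤ w g := fun g => by simp only [hw]; positivity
    let gd : Γ → (Θ → V) → Prop := fun g t =>
        (Function.Injective t ∧ Ab H (Q g) (univ.image t)) ∧ ¬ ∃ i, t i ∈ U
    obtain ⟨t, ht⟩ := exists_le_ex (fun t : Θ → V => ∑ g ∈ G, w g * (1 - ind (gd g t) / 2))
    have hex : ex (fun t : Θ → V => ∑ g ∈ G, w g * (1 - ind (gd g t) / 2)) ≤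
        (1 - α/4) * ∑ g ∈ G, w g := by
      rw [ex_sum, mul_sum]
      refine sum_le_sum fun g hg => ?_
      rw [ex_mul_left, mul_comm]
      refine mul_le_mul_of_nonneg_right ?_ (hw0 g)
      rw [ex_sub, ex_const]
      have : ex (fun t : Θ → V => ind (gd g t) / 2) = pr (gd g) / 2 := by
        simp only [div_eq_mul_inv]; rw [ex_mul_right]; rfl
      rw [this]
      have := hp g hg
      change α/2 ≤ pr (gd g) at this
      linarith
    have hfin : (1 - α/4) * ∑ g ∈ G, w g ≤ (1 - α/4)^(r+1) * G.card ∨ G = ∅ := by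
      by_cases hG : G = ∅
      · right; exact hG
      left
      obtain ⟨g, hg⟩ := Finset.nonempty_iff_ne_empty.mpr hG
      have : α ≤ 1 := (h g hg).trans (pr_le_one _)
      rw [pow_succ', mul_assoc]
      exact mul_le_mul_of_nonneg_left h4 (by linarith)
    rcases hfin with hfin | hG
    swap
    · subst hG
      exact ⟨∅, by simp, by simp, by simp, by simp⟩
    have htot := (ht.trans hex).trans hfin
    by_cases hg : ∃ g ∈ G, gd g t
    · obtain ⟨g₀, hg₀, ⟨hinj, hab⟩, hav⟩ := hg
      set T := univ.image t with hT
      have hTc : T.card = Fintype.card Θ := by rw [hT, card_image_of_injective _ hinj, card_univ]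
      have hTU : Disjoint T U := by
        rw [disjoint_left]
        intro a ha haU
        rw [hT, mem_image] at ha
        obtain ⟨i, -, rfl⟩ := ha
        exact hav ⟨i, haU⟩
      have hTn : T ∉ 𝓣 := by
        intro hmem
        have : T ⊆ U := (subset_biUnion_of_mem id hmem).trans subset_union_left
        have := disjoint_self.mp (hTU.mono_right this)
        have h0 : T.card = 0 := by rw [this]; rfl
        have : 0 < Fintype.card Θ := Fintype.card_pos
        omega
      refine ⟨insert T 𝓣, ?_, ?_, ?_, ?_⟩
      · rw [card_insert_of_notMem hTn]; omega
      · rw [coe_insert]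
        refine h2.insert fun S hS _ => ?_
        exact hTU.mono_right ((subset_biUnion_of_mem id hS).trans subset_union_left)
      · intro S hS
        rcases mem_insert.mp hS with rfl | hS
        · exact ⟨hTc, hTU.mono_right subset_union_right, hab.2.1⟩
        · exact h3 S hS
      · refine le_trans (sum_le_sum fun g hg => ?_) htot
        rw [filter_insert]
        split_ifs with hc
        · rw [card_insert_of_notMem (fun hh => hTn (mem_filter.mp hh).1),
            ind_true (show gd g t from ⟨⟨hinj, hc⟩, hav⟩), pow_succ]
          simp only [hw]; linarith
        · rw [ind_false (fun hh : gd g t => hc hh.1.2)]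
          simp only [hw]; linarith
    · push Not at hg
      refine ⟨𝓣, by omega, h2, h3, ?_⟩
      refine le_trans (sum_le_sum fun g hg' => ?_) htot
      rw [ind_false (hg g hg')]
      simp only [hw]; linarith

end

end PMx


namespace PMx

open Finset
set_option linter.unusedSectionVars false
set_option linter.unusedVariables false

open scoped Classical in
theorem select_final (Θ κ : Type) [Fintype Θ] [DecidableEq Θ] [Nonempty Θ] [Fintype κ] [DecidableEq κ]
    (α : ℝ) (hα : 0 < α) (C₀ : ℕ) (l₀ : ℝ) (hl₀ : 0 < l₀) :
    ∃ l : ℝ, 0 < l ∧ ∃ n₀ : ℕ, ∀ (V : Type) [Fintype V] [DecidableEq V], n₀ ≤ Fintype.card V →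
      ∀ (H : Finset (Finset V)) (P : (κ → V) → Prop),
      (∀ g, P g → α ≤ pr (fun t : Θ → V => Function.Injective t ∧ Ab H (univ.image g) (univ.image t))) →
      ∀ X : Finset V, X.card ≤ C₀ →
      ∃ 𝓣 : Finset (Finset V), ((𝓣.biUnion id).card : ℝ) ≤ l₀ * Fintype.card V ∧
        (𝓣 : Set (Finset V)).PairwiseDisjoint id ∧ (∀ T ∈ 𝓣, Disjoint T X ∧ Mat H T) ∧
        ∀ g, P g → l * Fintype.card V ≤ (𝓣.filter (fun T => Ab H (univ.image g) T)).card := by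
  set c : ℝ := ((Fintype.card Θ : ℕ) : ℝ) with hc
  have hc0 : 0 < c := by rw [hc]; exact_mod_cast Fintype.card_pos
  set b : ℝ := min (l₀/c) (α/(4*c^2)) with hb
  have hb0 : 0 < b := by positivity
  have hb1 : b * c ≤ l₀ := by
    have : b ≤ l₀/c := min_le_left _ _
    rwa [le_div_iff₀ hc0] at this
  have hb2 : b * (4*c^2) ≤ α := by
    have : b ≤ α/(4*c^2) := min_le_right _ _
    rwa [le_div_iff₀ (by positivity)] at this
  set l : ℝ := α * b / 8 with hl
  have hl0 : 0 < l := by positivity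
  have hlim := tendsto_pow_const_mul_const_pow_of_abs_lt_one (Fintype.card κ) (r := Real.exp (-l)) (by
    rw [abs_of_pos (Real.exp_pos _), Real.exp_lt_one_iff]; linarith)
  have hev := hlim.eventually (gt_mem_nhds (Real.exp_pos (-(α/4))))
  obtain ⟨n₁, hn₁⟩ := Filter.eventually_atTop.mp hev
  refine ⟨l, hl0, n₁ + 1 + ⌈4 * c * C₀ / α⌉₊, ?_⟩
  intro V _ _ hn H P hP X hX
  have hn0 : 0 < Fintype.card V := by omega
  have hnR : (0:ℝ) < Fintype.card V := by exact_mod_cast hn0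
  have hne : Nonempty V := Fintype.card_pos_iff.mp hn0
  have e1 : 4 * c * C₀ / α ≤ Fintype.card V := (Nat.le_ceil _).trans (Nat.cast_le.mpr (by omega))
  have e2 := hn₁ (Fintype.card V) (by omega)
  set n : ℝ := ((Fintype.card V : ℕ) : ℝ) with hnn
  rw [div_le_iff₀ hα] at e1
  set r := ⌊b * n⌋₊ with hr
  have hr1 : (r:ℝ) ≤ b * n := Nat.floor_le (by positivity)
  have hr2 : b * n < r + 1 := Nat.lt_floor_add_one _
  obtain ⟨𝓣, h1, h2, h3, h4⟩ := select (Θ := Θ) (H := H) (univ.filter P) (fun g => univ.image g) hα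
    (fun g hg => hP g (mem_filter.mp hg).2) X r (by
      rw [← hc, ← hnn, div_le_iff₀ hnR]
      have : (X.card:ℝ) ≤ C₀ := by exact_mod_cast hX
      have q1 : c * (c * r + X.card) ≤ c * (c * (b * n) + C₀) := by gcongr
      have q2 : b * (4*c^2) * n ≤ α * n := by gcongr
      nlinarith)
  refine ⟨𝓣, ?_, h2, fun T hT => (h3 T hT).2, ?_⟩
  · have a2 : (𝓣.biUnion id).card ≤ 𝓣.card * Fintype.card Θ :=
        card_biUnion_le_card_mul _ _ _ fun T hT => (h3 T hT).1.le
    have a3 : 𝓣.card * Fintype.card Θ ≤ r * Fintype.card Θ := Nat.mul_le_mul_right _ h1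
    have a4 : ((𝓣.biUnion id).card:ℝ) ≤ r * c := by rw [hc]; exact_mod_cast a2.trans a3
    calc _ ≤ r * c := a4
      _ ≤ b * n * c := by gcongr
      _ = b * c * n := by ring
      _ ≤ l₀ * n := by gcongr
  · intro g hg
    by_contra hlt
    push Not at hlt
    set m := (𝓣.filter (fun T => Ab H (univ.image g) T)).card with hm
    have f1 : (1/2:ℝ)^m ≤ (1 - α/4)^r * (univ.filter P).card := by
      refine le_trans ?_ h4
      exact Finset.single_le_sum (f := fun g => (1/2:ℝ)^(𝓣.filter (fun T => Ab H (univ.image g) T)).card)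
        (fun _ _ => by positivity) (mem_filter.mpr ⟨mem_univ g, hg⟩)
    have f2 : ((univ.filter P).card : ℝ) ≤ n^(Fintype.card κ) := by
      have := card_filter_le (univ : Finset (κ → V)) P
      rw [card_univ, Fintype.card_fun] at this
      rw [hnn]; exact_mod_cast this
    have hα1 : α ≤ 1 := (hP g hg).trans (pr_le_one _)
    have f3 : (1 - α/4)^r ≤ Real.exp (-(α/4)*r) := by
      rw [mul_comm, Real.exp_nat_mul]
      refine pow_le_pow_left₀ (by linarith) ?_ _
      have := Real.add_one_le_exp (-(α/4))
      linarith
    have f4 : Real.exp (-(l*n)) ≤ (1/2:ℝ)^m := by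
      have : Real.exp (-1:ℝ) ≤ 1/2 := by
        rw [Real.exp_neg, inv_le_comm₀ (Real.exp_pos _) (by norm_num)]
        have := Real.add_one_le_exp (1:ℝ)
        linarith
      calc Real.exp (-(l*n)) ≤ Real.exp (m * (-1:ℝ)) := Real.exp_le_exp.mpr (by linarith)
        _ = (Real.exp (-1))^m := Real.exp_nat_mul _ _
        _ ≤ _ := pow_le_pow_left₀ (Real.exp_pos _).le this _
    have f5 : Real.exp (-(l*n)) ≤ Real.exp (-(α/4)*r) * n^(Fintype.card κ) :=
      f4.trans (f1.trans (mul_le_mul f3 f2 (by positivity) (Real.exp_pos _).le))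
    have f6 : Real.exp (-l)^(Fintype.card V) = Real.exp (-(l*n)) := by
      rw [← Real.exp_nat_mul]; congr 1; rw [← hnn]; ring
    rw [f6] at e2
    have f7 : Real.exp (-(α/4)*r) ≤ Real.exp (α/4) * Real.exp (-(l*n)) * Real.exp (-(l*n)) := by
      rw [← Real.exp_add, ← Real.exp_add]
      refine Real.exp_le_exp.mpr ?_
      have : α * (b*n) ≤ α * (r+1) := by gcongr
      rw [hl]; linarith
    have f8 : Real.exp (-(l*n)) ≤ Real.exp (α/4) * Real.exp (-(l*n)) * (n^(Fintype.card κ) * Real.exp (-(l*n))) :=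
      f5.trans (le_trans (mul_le_mul_of_nonneg_right f7 (by positivity)) (by ring_nf; rfl))
    have f9 : Real.exp (α/4) * Real.exp (-(l*n)) * (n^(Fintype.card κ) * Real.exp (-(l*n))) <
        Real.exp (α/4) * Real.exp (-(l*n)) * Real.exp (-(α/4)) := by
      refine mul_lt_mul_of_pos_left e2 (by positivity)
    have f10 : Real.exp (α/4) * Real.exp (-(l*n)) * Real.exp (-(α/4)) = Real.exp (-(l*n)) := by
      rw [← Real.exp_add, ← Real.exp_add]; congr 1; ring
    linarith

end PMx


namespace PMx

open Finset
set_option linter.unusedSectionVars false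
set_option linter.unusedVariables false

section
variable {V : Type} [Fintype V] [DecidableEq V] {κ : Type} [Fintype κ] [DecidableEq κ]

lemma exists_enum (A : Finset V) (τ : Finset κ) (P N : Finset V) (hP : P.card = τ.card)
    (hN : N.card = τᶜ.card) (hPA : P ⊆ A) (hNA : Disjoint N A) :
    ∃ g : κ → V, Function.Injective g ∧ pat A g = τ ∧ univ.image g = P ∪ N := by
  let e₁ : τ ≃ P := (Finset.equivOfCardEq hP).symm
  let e₂ : (τᶜ : Finset κ) ≃ N := (Finset.equivOfCardEq hN).symm
  let g : κ → V := fun x => if h : x ∈ τ then (e₁ ⟨x, h⟩ : V) else e₂ ⟨x, by simpa using h⟩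
  have hg1 : ∀ x (h : x ∈ τ), g x = e₁ ⟨x, h⟩ := fun x h => by simp [g, h]
  have hg2 : ∀ x (h : x ∉ τ), g x = e₂ ⟨x, by simpa using h⟩ := fun x h => by simp [g, h]
  have m1 : ∀ x, x ∈ τ → g x ∈ P := fun x h => by rw [hg1 x h]; exact (e₁ ⟨x, h⟩).2
  have m2 : ∀ x, x ∉ τ → g x ∈ N := fun x h => by rw [hg2 x h]; exact (e₂ _).2
  have dj : ∀ a, a ∈ P → a ∈ N → False := fun a h1 h2 => disjoint_left.mp hNA h2 (hPA h1)
  have hinj : Function.Injective g := by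
    intro x y hxy
    by_cases hx : x ∈ τ <;> by_cases hy : y ∈ τ
    · rw [hg1 x hx, hg1 y hy] at hxy
      have := e₁.injective (Subtype.ext hxy)
      simpa using this
    · exact (dj _ (m1 x hx) (hxy ▸ m2 y hy)).elim
    · exact (dj _ (m1 y hy) (hxy ▸ m2 x hx)).elim
    · rw [hg2 x hx, hg2 y hy] at hxy
      have := e₂.injective (Subtype.ext hxy)
      simpa using this
  refine ⟨g, hinj, ?_, ?_⟩
  · ext x
    simp only [pat, mem_filter, mem_univ, true_and]
    constructor
    · intro h
      by_contra hx
      exact disjoint_left.mp hNA (m2 x hx) h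
    · intro h; exact hPA (m1 x h)
  · refine eq_of_subset_of_card_le ?_ ?_
    · intro a ha
      rw [mem_image] at ha
      obtain ⟨x, -, rfl⟩ := ha
      by_cases hx : x ∈ τ
      · exact mem_union_left _ (m1 x hx)
      · exact mem_union_right _ (m2 x hx)
    · rw [card_image_of_injective _ hinj]
      refine (card_union_le _ _).trans ?_
      rw [hP, hN, card_univ, card_add_card_compl]

open scoped Classical in
lemma absorb_all {H : Finset (Finset V)} (A : Finset V) (τ₁ τ₂ : Finset κ) (i s : ℕ)
    (h1 : τ₁.card = i) (h2 : τ₂.card = i + s) (r : ℕ) :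
    ∀ (b : ℕ) (R : Finset V) (𝓣 : Finset (Finset V)), b ≤ r → R.card = Fintype.card κ * r →
      (R ∩ A).card = i * r + s * b →
      (𝓣 : Set (Finset V)).PairwiseDisjoint id → (∀ T ∈ 𝓣, Disjoint T R ∧ Mat H T) →
      (∀ g : κ → V, Function.Injective g → (pat A g = τ₁ ∨ pat A g = τ₂) →
        r ≤ (𝓣.filter (fun T => Ab H (univ.image g) T)).card) →
      Mat H (R ∪ 𝓣.biUnion id) := by
  have hk1 : i + s ≤ Fintype.card κ := h2 ▸ card_le_univ _
  induction r with
  | zero =>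
    intro b R 𝓣 hb hR hA hd hT hg
    have : R = ∅ := by simpa using hR
    subst this
    rw [empty_union]
    exact Mat.biUnion 𝓣 id (fun T hT' => (hT T hT').2) hd
  | succ r ih =>
    intro b R 𝓣 hb hR hA hd hT hg
    have hsum : (R ∩ A).card + (R \ A).card = R.card := card_inter_add_card_sdiff _ _
    -- choose type
    have hch : ∃ (τ : Finset κ) (b' : ℕ), (τ = τ₁ ∨ τ = τ₂) ∧ b' ≤ r ∧
        τ.card ≤ (R ∩ A).card ∧ τᶜ.card ≤ (R \ A).card ∧
        (R ∩ A).card = τ.card + (i * r + s * b') := by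
      have hc : ∀ τ : Finset κ, τ.card + τᶜ.card = Fintype.card κ := fun τ => card_add_card_compl τ
      obtain ⟨q, hq⟩ := Nat.exists_eq_add_of_le hk1
      rcases Nat.lt_or_ge r b with hbr | hbr
      · have hbe : b = r + 1 := by omega
        refine ⟨τ₂, r, Or.inr rfl, le_rfl, ?_, ?_, ?_⟩
        · rw [hA, h2, hbe]; nlinarith
        · have := hc τ₂
          rw [hR, hA, hbe, hq] at hsum
          have h3 : τ₂ᶜ.card = q := by omega
          rw [h3]
          nlinarith
        · rw [hA, h2, hbe]; ring
      · refine ⟨τ₁, b, Or.inl rfl, hbr, ?_, ?_, ?_⟩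
        · rw [hA, h1]; nlinarith
        · have := hc τ₁
          rw [hR, hA, hq] at hsum
          have h3 : τ₁ᶜ.card = s + q := by omega
          rw [h3]
          nlinarith [Nat.mul_le_mul_left s hbr]
        · rw [hA, h1]; ring
    obtain ⟨τ, b', hτ, hb', hc1, hc2, hc3⟩ := hch
    obtain ⟨P, hP, hPc⟩ := exists_subset_card_eq hc1
    obtain ⟨N, hN, hNc⟩ := exists_subset_card_eq hc2
    have hPA : P ⊆ A := hP.trans inter_subset_right
    have hNA : Disjoint N A := (disjoint_sdiff_self_left : Disjoint (R \ A) A).mono_left hN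
    obtain ⟨g, hginj, hgp, hgi⟩ := exists_enum A τ P N hPc hNc hPA hNA
    have hgP : pat A g = τ₁ ∨ pat A g = τ₂ := by rw [hgp]; exact hτ
    have hne := hg g hginj hgP
    obtain ⟨T, hTm⟩ := card_pos.mp (by omega : 0 < (𝓣.filter (fun T => Ab H (univ.image g) T)).card)
    rw [mem_filter] at hTm
    obtain ⟨hT𝓣, -, -, hab⟩ := hTm
    set Q := univ.image g with hQ
    have hQR : Q ⊆ R := by
      rw [hgi]; exact union_subset (hP.trans inter_subset_left) (hN.trans sdiff_subset)
    have hQc : Q.card = Fintype.card κ := by rw [hQ, card_image_of_injective _ hginj, card_univ]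
    have hQA : Q ∩ A = P := by
      rw [hgi, union_inter_distrib_right, inter_eq_left.mpr hPA, disjoint_iff_inter_eq_empty.mp hNA,
        union_empty]
    have key := ih b' (R \ Q) (𝓣.erase T) hb' (by
        rw [card_sdiff_of_subset hQR, hR, hQc, mul_add]; omega) (by
        have : (R \ Q) ∩ A = (R ∩ A) \ P := by
          rw [← hQA]; ext a; simp only [mem_inter, mem_sdiff]; tauto
        rw [this, card_sdiff_of_subset hP, hPc, hc3]; omega)
      (hd.subset (by rw [coe_erase]; exact Set.sdiff_subset))
      (fun S hS => ⟨(hT S (mem_of_mem_erase hS)).1.mono_right sdiff_subset, (hT S (mem_of_mem_erase hS)).2⟩)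
      (fun g' hg' hg'' => by
        have := hg g' hg' hg''
        rw [filter_erase]
        have h3 := pred_card_le_card_erase (s := 𝓣.filter (fun T => Ab H (univ.image g') T)) (a := T)
        omega)
    have hdis : Disjoint (R \ Q ∪ (𝓣.erase T).biUnion id) (T ∪ Q) := by
      rw [disjoint_left]
      intro a ha hb
      simp only [mem_union, mem_sdiff, mem_biUnion, mem_erase, id] at ha hb
      rcases ha with ⟨ha1, ha2⟩ | ⟨S, ⟨hS1, hS2⟩, ha⟩
      · rcases hb with hb | hb
        · exact disjoint_left.mp (hT T hT𝓣).1 hb ha1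
        · exact ha2 hb
      · rcases hb with hb | hb
        · exact disjoint_left.mp (hd hS2 hT𝓣 hS1) ha hb
        · exact disjoint_left.mp (hT S hS2).1 ha (hQR hb)
    have := key.union hab hdis
    convert this using 1
    ext a
    simp only [mem_union, mem_sdiff, mem_biUnion, mem_erase, id]
    constructor
    · rintro (h | ⟨S, hS, h⟩)
      · by_cases a ∈ Q <;> tauto
      · by_cases hST : S = T
        · subst hST; tauto
        · exact Or.inl (Or.inr ⟨S, ⟨hST, hS⟩, h⟩)
    · rintro ((⟨h, -⟩ | ⟨S, ⟨-, hS⟩, h⟩) | (h | h))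
      · exact Or.inl h
      · exact Or.inr ⟨S, hS, h⟩
      · exact Or.inr ⟨T, hT𝓣, h⟩
      · exact Or.inl (hQR h)

end

end PMx


namespace PMx

open Finset
set_option linter.unusedSectionVars false
set_option linter.unusedVariables false

section
variable {V : Type} [Fintype V] [DecidableEq V]

/-- the induced hypergraph on `W` -/
def sub (H : Finset (Finset V)) (W : Finset V) : Finset (Finset W) :=
  univ.filter (fun e : Finset W => e.image Subtype.val ∈ H)

lemma mem_sub {H : Finset (Finset V)} {W : Finset V} {e : Finset W} :
    e ∈ sub H W ↔ e.image Subtype.val ∈ H := by simp [sub]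

lemma ed_sub {H : Finset (Finset V)} {W : Finset V} {ι : Type} [Fintype ι] (f : ι → W) :
    Ed (sub H W) f ↔ Ed H (fun i => (f i : V)) := by
  unfold Ed
  rw [mem_sub, image_image]
  rfl

open scoped Classical in
lemma DegC.sub {H : Finset (Finset V)} {d m : ℕ} {γ δ : ℝ} (W : Finset V) (hW : W.Nonempty)
    (hdeg : DegC H d m γ) (h : m * (Wᶜ.card : ℝ) / Fintype.card V ≤ δ) :
    DegC (sub H W) d m (γ + δ) := by
  intro s hs
  have hV : Nonempty V := ⟨hW.choose⟩
  have hWt : Nonempty W := ⟨⟨hW.choose, hW.choose_spec⟩⟩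
  have h1 := hdeg (fun i => (s i : V)) (Subtype.val_injective.comp hs)
  have h2 := pr_hit_le (ι := Fin m) (Wᶜ)
  rw [Fintype.card_fin] at h2
  have h3 := pr_and_not_ge (fun x : Fin m → V => Ed H (Sum.elim (fun i => (s i : V)) x))
    (fun x => ∃ i, x i ∈ Wᶜ)
  have h4 : pr (fun x : Fin m → V => Ed H (Sum.elim (fun i => (s i : V)) x) ∧ ¬ ∃ i, x i ∈ Wᶜ) ≤
      pr (fun x : Fin m → W => Ed (PMx.sub H W) (Sum.elim s x)) := by
    rw [pr_eq_card, pr_eq_card]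
    have hcard : ((univ.filter (fun x : Fin m → V => Ed H (Sum.elim (fun i => (s i : V)) x) ∧
        ¬ ∃ i, x i ∈ Wᶜ)).card) ≤
        ((univ.filter (fun x : Fin m → W => Ed (PMx.sub H W) (Sum.elim s x))).card) := by
      refine card_le_card_of_surjOn (fun x i => (x i : V)) ?_
      intro x hx
      simp only [coe_filter, mem_univ, true_and, Set.mem_ofPred_eq] at hx
      obtain ⟨hx1, hx2⟩ := hx
      push Not at hx2
      have hx2 : ∀ i, x i ∈ W := fun i => by simpa using hx2 i
      refine ⟨fun i => ⟨x i, hx2 i⟩, ?_, rfl⟩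
      simp only [coe_filter, mem_univ, true_and, Set.mem_ofPred_eq]
      rw [ed_sub]
      convert hx1 using 1
      ext i
      rcases i with i | i <;> rfl
    refine div_le_div₀ (Nat.cast_nonneg _) (Nat.cast_le.mpr (by convert hcard)) ?_ ?_
    · exact_mod_cast Fintype.card_pos
    · rw [Fintype.card_fun, Fintype.card_fun, Fintype.card_coe]
      push_cast
      gcongr
      exact card_le_univ W
  linarith

lemma mat_of_sub {H : Finset (Finset V)} {W : Finset V} {U : Finset W} (h : Mat (sub H W) U) :
    Mat H (U.image Subtype.val) := by
  obtain ⟨M, hM, hp, rfl⟩ := h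
  have : (M.biUnion id).image Subtype.val = M.biUnion (fun e => e.image (Subtype.val : W → V)) := by
    rw [biUnion_image]; rfl
  rw [this]
  refine Mat.biUnion _ _ (fun e he => Mat.single (mem_sub.mp (hM he))) ?_
  intro e he e' he' hne
  exact (disjoint_image Subtype.val_injective).mpr (hp he he' hne)

end

theorem apm_sub (k d M : ℕ) (hk : k = d + (M+1)) (hM : 1 ≤ M) (hdM : d ≤ M) (hd : 1 ≤ d)
    (hG : (1 - (1 - 1/(k:ℝ))^(M+1)) + (M+1)*((M:ℝ)-d)*(1-1/(k:ℝ))^(M-1)/k^2 < 1/2) :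
    ∃ γ : ℝ, 0 < γ ∧ ∀ σ : ℝ, 0 < σ → ∃ n₀ : ℕ, ∀ (V : Type) [Fintype V] [DecidableEq V]
      (W : Finset V), n₀ ≤ W.card → k ∣ W.card → ((M+1:ℕ):ℝ) * (Wᶜ.card : ℝ) ≤ γ * Fintype.card V →
      ∀ H : Finset (Finset V), (∀ e ∈ H, e.card = k) → DegC H d (M+1) γ →
      ∃ U ⊆ W, Mat H U ∧ ((W \ U).card : ℝ) ≤ σ * Fintype.card V := by
  obtain ⟨γ, hγ, h⟩ := apm k d M hk hM hdM hd hG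
  refine ⟨γ/2, by positivity, fun σ hσ => ?_⟩
  obtain ⟨n₀, hn₀⟩ := h σ hσ
  refine ⟨n₀ + 1, ?_⟩
  intro V _ _ W hWn hkW hWc H hH hdeg
  have hW : W.Nonempty := card_pos.mp (by omega)
  have hV0 : (0:ℝ) < Fintype.card V := by
    have : W.card ≤ Fintype.card V := card_le_univ W
    exact_mod_cast (by omega : 0 < Fintype.card V)
  have hd' : DegC (sub H W) d (M+1) γ := by
    have := hdeg.sub (δ := γ/2) W hW (by rw [div_le_iff₀ hV0]; exact hWc)
    rwa [add_halves] at this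
  obtain ⟨N, hN, hp, hc⟩ := hn₀ W (by rw [Fintype.card_coe]; omega) (by rwa [Fintype.card_coe]) (sub H W)
    (fun e he => by
      have := hH _ (mem_sub.mp he)
      rwa [card_image_of_injective _ Subtype.val_injective] at this) hd'
  refine ⟨(N.biUnion id).image Subtype.val, ?_, mat_of_sub ⟨N, hN, hp, rfl⟩, ?_⟩
  · intro a ha
    rw [mem_image] at ha
    obtain ⟨x, -, rfl⟩ := ha
    exact x.2
  · have : W \ (N.biUnion id).image Subtype.val = (univ \ N.biUnion id).image Subtype.val := by
      ext a
      simp only [mem_sdiff, mem_image, mem_univ, true_and]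
      constructor
      · rintro ⟨h1, h2⟩
        exact ⟨⟨a, h1⟩, fun h => h2 ⟨_, h, rfl⟩, rfl⟩
      · rintro ⟨x, hx, rfl⟩
        refine ⟨x.2, ?_⟩
        rintro ⟨y, hy, hyx⟩
        exact hx (Subtype.ext hyx ▸ hy)
    rw [this, card_image_of_injective _ Subtype.val_injective]
    refine hc.trans ?_
    rw [Fintype.card_coe]
    gcongr
    exact card_le_univ W

end PMx


namespace PMx

open Finset
set_option linter.unusedSectionVars false
set_option linter.unusedVariables false

lemma tx1 {a s x u : Prop} : (a ∧ ¬ (s ∨ x)) → a ∧ ¬ s ∧ ¬ x := by tauto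
lemma tx2 {s x a b : Prop} : ¬ ((s ∨ x) ∨ (a ∨ b)) → ¬ s ∧ ¬ x ∧ ¬ a ∧ ¬ b := by tauto
lemma tx3 {s x a b u : Prop} : (¬ ((s ∨ x) ∨ (a ∨ b)) ∧ ¬ u) ↔ (¬ s ∧ ¬ x ∧ ¬ a ∧ ¬ b ∧ ¬ u) := by tauto
lemma tx4 {s x a b u c : Prop} (e1 : a → c ∧ ¬ s ∧ ¬ x) (e2 : b → ¬ c ∧ ¬ s ∧ ¬ x)
    (e3 : u → ¬ s ∧ ¬ x ∧ ¬ a ∧ ¬ b) :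
    ¬ ((s ∨ x) ∨ u) ↔ ((a ∨ b) ∨ (¬ s ∧ ¬ x ∧ ¬ a ∧ ¬ b ∧ ¬ u)) := by tauto
lemma tx5 {s x a b u : Prop} (h : a ∨ b) (h' : ¬ s ∧ ¬ x ∧ ¬ a ∧ ¬ b ∧ ¬ u) : False := by tauto
lemma tx6 {a b c z s x : Prop} (e1 : a → c ∧ ¬ s ∧ ¬ x) (e2 : b → ¬ c ∧ ¬ s ∧ ¬ x) :
    (((a ∨ b) ∨ z) ∧ c) ↔ (a ∨ (z ∧ c)) := by tauto
lemma tx7 {a c s x : Prop} (h : s ∨ x) (e1 : c ∧ ¬ s ∧ ¬ x) : False := by tauto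

set_option maxHeartbeats 1000000 in
open scoped Classical in
theorem core_setup (k d' M : ℕ) (hk : k = (d'+1) + (M+1)) (hM : 1 ≤ M) (hdM : d'+1 ≤ M)
    (hG : (1 - (1 - 1/(k:ℝ))^(M+1)) + (M+1)*((M:ℝ)-(d'+1:ℕ))*(1-1/(k:ℝ))^(M-1)/k^2 < 1/2) :
    ∃ γ : ℝ, 0 < γ ∧ ∃ n₀ : ℕ, ∀ (V : Type) [Fintype V] [DecidableEq V], n₀ ≤ Fintype.card V →
      k ∣ Fintype.card V → ∀ H : Finset (Finset V), (∀ e ∈ H, e.card = k) → DegC H (d'+1) (M+1) γ →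
      ∃ A : Finset V, A.Nonempty ∧ Aᶜ.Nonempty ∧ ∃ i s : ℕ, (s = 1 ∨ s = 2) ∧
      ∃ τ₁ τ₂ : Finset (KI d' (M+1)), τ₁.card = i ∧ τ₂.card = i + s ∧
      ∀ X : Finset V, k ∣ X.card → X.card ≤ k →
      ∃ (𝓣 : Finset (Finset V)) (U : Finset V), (𝓣 : Set (Finset V)).PairwiseDisjoint id ∧
        (∀ T ∈ 𝓣, Disjoint T X ∧ Mat H T) ∧ Mat H U ∧ Disjoint U (𝓣.biUnion id) ∧ Disjoint U X ∧
        ∃ ρ w y : ℕ, k * w + k ≤ ρ ∧ y ≤ k * w ∧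
          ((𝓣.biUnion id ∪ X ∪ U)ᶜ).card = 2 * k * ρ + k * w ∧
          ((𝓣.biUnion id ∪ X ∪ U)ᶜ ∩ A).card = (2 * i + s) * ρ + y ∧
          ∀ g : KI d' (M+1) → V, Function.Injective g → (pat A g = τ₁ ∨ pat A g = τ₂) →
            3 * ρ ≤ (𝓣.filter (fun T => Ab H (univ.image g) T)).card := by
  obtain ⟨γ₁, hγ₁, ε, hε, α, hα, n₁, h₁⟩ := absorb_struct d' (M+1) (by omega)
  obtain ⟨γ₂, hγ₂, h₂⟩ := apm_sub k (d'+1) M hk hM hdM (by omega) hG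
  have hkR : (0:ℝ) < k := by exact_mod_cast (by omega : 0 < k)
  set m : ℝ := ((M+1:ℕ):ℝ) with hm
  have hmR : 0 < m := by rw [hm]; exact_mod_cast (by omega : 0 < M+1)
  set l₀ : ℝ := min (ε/4) (γ₂/(4*m)) with hl₀
  have hl₀0 : 0 < l₀ := by positivity
  have hl₀1 : l₀ ≤ ε/4 := min_le_left _ _
  have hl₀2 : l₀ * (4*m) ≤ γ₂ := by
    have : l₀ ≤ γ₂/(4*m) := min_le_right _ _
    rwa [le_div_iff₀ (by positivity)] at this
  obtain ⟨l, hl, n₂, hsel⟩ := select_final (ThI d' (M+1)) (KI d' (M+1)) α hα k l₀ hl₀0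
  set ρ₀ : ℝ := min (l/3) (min (ε/(8*k)) (γ₂/(8*k*m))) with hρ₀
  have hρ0 : 0 < ρ₀ := by positivity
  have hρ1 : ρ₀ ≤ l/3 := min_le_left _ _
  have hρ2 : ρ₀ * (8*k) ≤ ε := by
    have : ρ₀ ≤ ε/(8*k) := (min_le_right _ _).trans (min_le_left _ _)
    rwa [le_div_iff₀ (by positivity)] at this
  have hρ3 : ρ₀ * (8*k*m) ≤ γ₂ := by
    have : ρ₀ ≤ γ₂/(8*k*m) := (min_le_right _ _).trans (min_le_right _ _)
    rwa [le_div_iff₀ (by positivity)] at this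
  obtain ⟨n₃, h₃⟩ := h₂ (ρ₀/2) (by positivity)
  refine ⟨min γ₁ γ₂, by positivity, n₁ + n₂ + 2 * n₃ + 1 + ⌈2*((k:ℝ)+1)/ρ₀⌉₊ + ⌈k/(ε/2)⌉₊ + ⌈m*k/(γ₂/2)⌉₊, ?_⟩
  intro V _ _ hn hkn H hH hdeg
  obtain ⟨A, hA1, hA2, i, s, hs, τ₁, τ₂, hτ₁, hτ₂, habs⟩ := h₁ V (by omega) H (hdeg.mono (min_le_left _ _))
  have hn0 : 0 < Fintype.card V := by omega
  have hnR : (0:ℝ) < Fintype.card V := by exact_mod_cast hn0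
  have b1 : 2*((k:ℝ)+1)/ρ₀ ≤ Fintype.card V := (Nat.le_ceil _).trans (Nat.cast_le.mpr (by omega))
  have b2 : (k:ℝ)/(ε/2) ≤ Fintype.card V := (Nat.le_ceil _).trans (Nat.cast_le.mpr (by omega))
  have b3 : m*k/(γ₂/2) ≤ Fintype.card V := (Nat.le_ceil _).trans (Nat.cast_le.mpr (by omega))
  have b4 : ((2 * n₃ : ℕ):ℝ) ≤ Fintype.card V := Nat.cast_le.mpr (by omega)
  have hAc : A.card + Aᶜ.card = Fintype.card V := card_add_card_compl A
  have hAc' : (A.card : ℝ) + Aᶜ.card = Fintype.card V := by exact_mod_cast hAc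
  set n : ℝ := ((Fintype.card V : ℕ) : ℝ) with hnn
  rw [div_le_iff₀ (by positivity)] at b1 b2 b3
  have hAn : A.Nonempty := by
    rw [← card_pos]
    have : (0:ℝ) < A.card := lt_of_lt_of_le (by positivity) hA1
    exact_mod_cast this
  have hAn' : Aᶜ.Nonempty := by
    rw [← card_pos]
    have : (0:ℝ) < Aᶜ.card := lt_of_lt_of_le (by positivity) hA2
    exact_mod_cast this
  refine ⟨A, hAn, hAn', i, s, hs, τ₁, τ₂, hτ₁, hτ₂, ?_⟩
  intro X hXk hXc
  have hXR : (X.card : ℝ) ≤ k := by exact_mod_cast hXc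
  obtain ⟨𝓣, ht1, ht2, ht3, ht4⟩ := hsel V (by omega) H
    (fun g => Function.Injective g ∧ (pat A g = τ₁ ∨ pat A g = τ₂)) (fun g hg => habs g hg.1 hg.2) X hXc
  set S := 𝓣.biUnion id with hS
  have hSX : Disjoint S X := by
    rw [hS, disjoint_biUnion_left]; exact fun T hT => (ht3 T hT).1
  have hSM : Mat H S := Mat.biUnion 𝓣 id (fun T hT => (ht3 T hT).2) ht2
  set ρ := ⌊ρ₀ * n⌋₊ with hρ
  have r1 : (ρ:ℝ) ≤ ρ₀ * n := Nat.floor_le (by positivity)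
  have r2 : ρ₀ * n < ρ + 1 := Nat.lt_floor_add_one _
  have hik : i + s ≤ k := by
    have := card_le_univ τ₂
    rw [hτ₂] at this
    simp only [Fintype.card_sum, Fintype.card_fin] at this
    omega
  obtain ⟨q, hq⟩ := Nat.exists_eq_add_of_le hik
  have hSXc : ((S ∪ X).card : ℝ) ≤ l₀ * n + k := by
    have := card_union_le S X
    have : ((S ∪ X).card : ℝ) ≤ S.card + X.card := by exact_mod_cast this
    linarith
  have hkρ : 2 * k * (ρ:ℝ) ≤ ε/4 * n := by
    calc 2 * k * (ρ:ℝ) ≤ 2 * k * (ρ₀ * n) := by gcongr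
      _ = (ρ₀ * (8*k)) * n / 4 := by ring
      _ ≤ ε * n / 4 := by gcongr
      _ = _ := by ring
  have hl₀n : l₀ * n ≤ ε/4*n := by gcongr
  have room : ∀ C : Finset V, ε * n ≤ C.card → ∀ c : ℕ, c ≤ 2 * k → c * ρ ≤ (C \ (S ∪ X)).card := by
    intro C hC c hc
    have a1 := le_card_sdiff (S ∪ X) C
    have a2 : (C.card : ℝ) - (S ∪ X).card ≤ (C \ (S ∪ X)).card := by
      have : C.card ≤ (C \ (S ∪ X)).card + (S ∪ X).card := by omega
      have : (C.card : ℝ) ≤ (C \ (S ∪ X)).card + (S ∪ X).card := by exact_mod_cast this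
      linarith
    have a3 : ((c * ρ : ℕ) : ℝ) ≤ 2 * k * ρ := by
      push_cast
      have : (c:ℝ) ≤ 2 * k := by exact_mod_cast hc
      gcongr
    have : ((c * ρ : ℕ) : ℝ) ≤ (C \ (S ∪ X)).card := by linarith
    exact_mod_cast this
  obtain ⟨A₀, hA₀, hA₀c⟩ := exists_subset_card_eq (room A hA1 (2*i+s) (by omega))
  obtain ⟨B₀, hB₀, hB₀c⟩ := exists_subset_card_eq (room Aᶜ hA2 (2*q+s) (by omega))
  have mA : ∀ a ∈ A₀, a ∈ A ∧ a ∉ S ∧ a ∉ X := fun a ha => by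
    have := hA₀ ha; simp only [mem_sdiff, mem_union] at this; exact tx1 (u := True) this
  have mB : ∀ a ∈ B₀, a ∉ A ∧ a ∉ S ∧ a ∉ X := fun a ha => by
    have := hB₀ ha; simp only [mem_sdiff, mem_union, mem_compl] at this; exact tx1 (u := True) this
  have dAB : Disjoint A₀ B₀ := disjoint_left.mpr fun a h1 h2 => (mB a h2).1 (mA a h1).1
  set Y := S ∪ X ∪ (A₀ ∪ B₀) with hY
  have hABc : (A₀ ∪ B₀).card = 2 * k * ρ := by
    rw [card_union_of_disjoint dAB, hA₀c, hB₀c, hq]; ring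
  have dY : Disjoint (S ∪ X) (A₀ ∪ B₀) := by
    rw [disjoint_left]
    intro a h1 h2
    simp only [mem_union] at h1 h2
    rcases h2 with h2 | h2
    · exact tx7 (a := True) h1 (mA a h2)
    · exact tx7 (a := True) h1 (mB a h2)
  have hYc : Y.card = S.card + X.card + 2 * k * ρ := by
    rw [hY, card_union_of_disjoint dY, card_union_of_disjoint hSX, hABc]
  have hYR : (Y.card : ℝ) ≤ l₀ * n + k + 2 * k * ρ := by
    rw [hYc]; push_cast; linarith
  have hWY : Yᶜ.card + Y.card = Fintype.card V := by rw [add_comm]; exact card_add_card_compl Y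
  have hWYR : (Yᶜ.card : ℝ) + Y.card = n := by rw [hnn]; exact_mod_cast hWY
  obtain ⟨U, hU1, hU2, hU3⟩ := h₃ V Yᶜ (by
      have : (n₃:ℝ) ≤ Yᶜ.card := by
        push_cast at b4
        nlinarith
      exact_mod_cast this) (by
      have : k ∣ Y.card := by
        rw [hYc]
        exact Dvd.dvd.add (Dvd.dvd.add (hSM.card_dvd hH) hXk) ⟨2*ρ, by ring⟩
      rw [← Nat.dvd_add_left this, hWY]; exact hkn) (by
      rw [compl_compl]
      calc m * (Y.card:ℝ) ≤ m * (l₀ * n + k + 2 * k * (ρ₀ * n)) := by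
            refine mul_le_mul_of_nonneg_left (hYR.trans ?_) hmR.le
            gcongr
        _ = (l₀ * (4*m)) * n / 4 + m * k + (ρ₀ * (8*k*m)) * n / 4 := by ring
        _ ≤ γ₂ * n / 4 + m * k + γ₂ * n / 4 := by gcongr
        _ ≤ γ₂ * n := by linarith) H hH (hdeg.mono (min_le_right _ _))
  set Z := Yᶜ \ U with hZ
  have mU : ∀ a ∈ U, a ∉ S ∧ a ∉ X ∧ a ∉ A₀ ∧ a ∉ B₀ := fun a ha => by
    have := hU1 ha; rw [hY] at this; simp only [mem_compl, mem_union] at this; exact tx2 this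
  have hUZ : U.card + Z.card = Yᶜ.card := by
    rw [hZ, add_comm]; exact card_sdiff_add_card_eq_card hU1
  have hkZ : k ∣ Z.card := by
    rw [← Nat.dvd_add_right (hU2.card_dvd hH), hUZ]
    have : k ∣ Y.card := by
      rw [hYc]
      exact Dvd.dvd.add (Dvd.dvd.add (hSM.card_dvd hH) hXk) ⟨2*ρ, by ring⟩
    rw [← Nat.dvd_add_left this, hWY]; exact hkn
  obtain ⟨w, hw⟩ := hkZ
  have mZ : ∀ a, a ∈ Z ↔ a ∉ S ∧ a ∉ X ∧ a ∉ A₀ ∧ a ∉ B₀ ∧ a ∉ U := fun a => by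
    rw [hZ, hY]; simp only [mem_sdiff, mem_compl, mem_union]; exact tx3
  have hR : (S ∪ X ∪ U)ᶜ = (A₀ ∪ B₀) ∪ Z := by
    ext a
    simp only [mem_compl, mem_union, mZ]
    exact tx4 (mA a) (mB a) (mU a)
  have dZ : Disjoint (A₀ ∪ B₀) Z := by
    rw [disjoint_left]; intro a h1 h2
    rw [mZ] at h2; rw [mem_union] at h1; exact tx5 h1 h2
  refine ⟨𝓣, U, ht2, ht3, hU2, ?_, ?_, ρ, w, (Z ∩ A).card, ?_, ?_, ?_, ?_, ?_⟩
  · exact disjoint_left.mpr fun a ha => (mU a ha).1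
  · exact disjoint_left.mpr fun a ha => (mU a ha).2.1
  · have : ((k * w + k : ℕ):ℝ) ≤ ρ := by
      rw [← hw]; push_cast; linarith
    exact_mod_cast this
  · rw [← hw]; exact card_le_card inter_subset_left
  · rw [hR, card_union_of_disjoint dZ, hABc, hw]
  · have : (S ∪ X ∪ U)ᶜ ∩ A = A₀ ∪ (Z ∩ A) := by
      rw [hR]
      ext a
      simp only [mem_inter, mem_union]
      exact tx6 (mA a) (mB a)
    rw [this, card_union_of_disjoint, hA₀c]
    exact disjoint_left.mpr fun a h1 h2 => disjoint_left.mp dZ (mem_union_left _ h1) (mem_inter.mp h2).1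
  · intro g hg hg'
    have := ht4 g ⟨hg, hg'⟩
    have h3 : ((3 * ρ : ℕ) : ℝ) ≤ l * n := by
      push_cast
      have : ρ₀ * n ≤ l/3 * n := by gcongr
      linarith
    have := h3.trans this
    exact_mod_cast this

end PMx


namespace PMx

open Finset
set_option linter.unusedSectionVars false
set_option linter.unusedVariables false

lemma ty1 {s e u : Prop} : ¬ ((s ∨ e) ∨ u) ↔ ¬ s ∧ ¬ e ∧ ¬ u := by tauto
lemma ty2 {s u : Prop} : ¬ ((s ∨ False) ∨ u) ↔ ¬ s ∧ ¬ u := by tauto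
lemma ty3 {s e u : Prop} : (((¬ s ∧ ¬ e ∧ ¬ u) ∨ s) ∨ e) ∨ u := by tauto
lemma ty4 {s e u : Prop} : (((¬ s ∧ ¬ e ∧ ¬ u) ∨ e) ∨ s) ∨ u := by tauto
lemma ty5 {s u : Prop} : ((¬ s ∧ ¬ u) ∨ s) ∨ u := by tauto

lemma arith_b {i s r y : ℕ} (h : s = 1 ∨ (s = 2 ∧ y % 2 = (i * r) % 2)) (h1 : i * r ≤ y)
    (h2 : y ≤ (i + s) * r) : ∃ b ≤ r, y = i * r + s * b := by
  rw [add_mul] at h2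
  rcases h with rfl | ⟨rfl, h⟩
  · exact ⟨y - i * r, by omega, by omega⟩
  · exact ⟨(y - i * r)/2, by omega, by omega⟩

lemma Mat.parity {V : Type} [Fintype V] [DecidableEq V] {H : Finset (Finset V)} {k i : ℕ} (hk : 0 < k)
    (hH : ∀ e ∈ H, e.card = k) {A : Finset V} (hp : ∀ e ∈ H, (e ∩ A).card % 2 = i % 2)
    {U : Finset V} (h : Mat H U) : ∃ c, U.card = k * c ∧ (U ∩ A).card % 2 = (i * c) % 2 := by
  obtain ⟨M, hM, hd, rfl⟩ := h
  refine ⟨M.card, ?_, ?_⟩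
  · rw [card_biUnion (fun e he e' he' hne => hd he he' hne),
      sum_congr rfl (fun e he => (hH e (hM he) : (id e).card = k)), sum_const, smul_eq_mul, mul_comm]
  · rw [biUnion_inter, card_biUnion (fun e he e' he' hne =>
      (hd he he' hne).mono inter_subset_left inter_subset_left), sum_nat_mod,
      sum_congr rfl (f := fun e => (id e ∩ A).card % 2) (g := fun _ => i % 2) (fun e he => hp e (hM he)), ← sum_nat_mod,
      sum_const, smul_eq_mul, mul_comm]

set_option maxHeartbeats 1000000 in
theorem core (k d' M : ℕ) (hk : k = (d'+1) + (M+1)) (hM : 1 ≤ M) (hdM : d'+1 ≤ M)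
    (hG : (1 - (1 - 1/(k:ℝ))^(M+1)) + (M+1)*((M:ℝ)-(d'+1:ℕ))*(1-1/(k:ℝ))^(M-1)/k^2 < 1/2) :
    ∃ γ : ℝ, 0 < γ ∧ ∃ n₀ : ℕ, ∀ (V : Type) [Fintype V] [DecidableEq V], n₀ ≤ Fintype.card V →
      k ∣ Fintype.card V → ∀ H : Finset (Finset V), (∀ e ∈ H, e.card = k) → DegC H (d'+1) (M+1) γ →
      (∀ A : Finset V, A.Nonempty → Aᶜ.Nonempty → ∀ i, (∀ e ∈ H, (e ∩ A).card % 2 = i % 2) →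
        A.card % 2 = (i * (Fintype.card V / k)) % 2) →
      Mat H univ := by
  obtain ⟨γ, hγ, n₀, h⟩ := core_setup k d' M hk hM hdM hG
  refine ⟨γ, hγ, n₀, ?_⟩
  intro V _ _ hn hkn H hH hdeg hpar
  obtain ⟨A, hA, hA', i, s, hs, τ₁, τ₂, hτ₁, hτ₂, hX⟩ := h V hn hkn H hH hdeg
  have hk0 : 0 < k := by omega
  have hcK : Fintype.card (KI d' (M+1)) = k := by
    simp only [Fintype.card_sum, Fintype.card_fin]; omega
  have hik : i + s ≤ k := by
    have := card_le_univ τ₂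
    rw [hτ₂, hcK] at this; exact this
  -- common finish
  have fin : ∀ (𝓣 : Finset (Finset V)) (R : Finset V) (ρ w y : ℕ),
      (𝓣 : Set (Finset V)).PairwiseDisjoint id → (∀ T ∈ 𝓣, Disjoint T R ∧ Mat H T) →
      k * w ≤ ρ → y ≤ k * w → R.card = 2 * k * ρ + k * w → (R ∩ A).card = (2 * i + s) * ρ + y →
      (s = 1 ∨ (s = 2 ∧ (R ∩ A).card % 2 = (i * (2 * ρ + w)) % 2)) →
      (∀ g : KI d' (M+1) → V, Function.Injective g → (pat A g = τ₁ ∨ pat A g = τ₂) →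
            3 * ρ ≤ (letI := Classical.decPred (fun T => Ab H (univ.image g) T); 𝓣.filter (fun T => Ab H (univ.image g) T)).card) →
      Mat H (R ∪ 𝓣.biUnion id) := by
    intro 𝓣 R ρ w y h1 h2 h3 h4 h5 h6 h7 h8
    have hwρ : w ≤ ρ := by nlinarith
    have hs1 : 1 ≤ s := by omega
    obtain ⟨b, hb, hy⟩ := arith_b h7 (by
      rw [h6]
      have : i * w ≤ k * w := Nat.mul_le_mul_right _ (by omega)
      nlinarith) (by
      rw [h6]
      nlinarith)
    refine absorb_all A τ₁ τ₂ i s hτ₁ hτ₂ (2 * ρ + w) b R 𝓣 hb (by rw [h5, hcK]; ring) hy h1 h2 ?_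
    intro g hg hg'
    have := h8 g hg hg'
    refine le_trans (by omega : 2 * ρ + w ≤ 3 * ρ) (this.trans (le_of_eq ?_))
    congr!
  by_cases hs2 : s = 2 ∧ ∃ e ∈ H, (e ∩ A).card % 2 ≠ i % 2
  · obtain ⟨hs2, e, he, hne⟩ := hs2
    obtain ⟨𝓣, U, t1, t2, t3, t4, t5, ρ, w, y, q1, q2, q3, q4, q5⟩ := hX e (by rw [hH e he]) (hH e he).le
    set S := 𝓣.biUnion id with hS
    have hSe : Disjoint S e := by rw [hS, disjoint_biUnion_left]; exact fun T hT => (t2 T hT).1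
    set R := (S ∪ e ∪ U)ᶜ with hR
    have mR : ∀ a, a ∈ R ↔ a ∉ S ∧ a ∉ e ∧ a ∉ U := fun a => by
      rw [hR]; simp only [mem_compl, mem_union]; exact ty1
    have mS : ∀ T ∈ 𝓣, ∀ a ∈ T, a ∈ S := fun T hT a ha => by
      rw [hS, mem_biUnion]; exact ⟨T, hT, ha⟩
    by_cases hp : (R ∩ A).card % 2 = (i * (2 * ρ + w)) % 2
    · have := fin 𝓣 R ρ w y t1 (fun T hT => ⟨disjoint_left.mpr fun a ha hb =>
        ((mR a).mp hb).1 (mS T hT a ha), (t2 T hT).2⟩) (by omega) q2 q3 q4 (Or.inr ⟨hs2, hp⟩)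
        (fun g hg hg' => by convert q5 g hg hg')
      have h2 := (this.union (Mat.single he) (by
        rw [disjoint_left]; intro a ha hb
        rw [mem_union, mR] at ha
        rcases ha with ha | ha
        · exact ha.2.1 hb
        · exact disjoint_left.mp hSe ha hb)).union t3 (by
        rw [disjoint_left]; intro a ha hb
        rw [mem_union, mem_union, mR] at ha
        rcases ha with (ha | ha) | ha
        · exact ha.2.2 hb
        · exact disjoint_left.mp t4 hb ha
        · exact disjoint_left.mp t5 hb ha)
      convert h2
      symm
      rw [eq_univ_iff_forall]
      intro a
      simp only [mem_union, mR, ← hS]; exact ty3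
    · have dRe : Disjoint R e := disjoint_left.mpr fun a ha => ((mR a).mp ha).2.1
      have cRA : ((R ∪ e) ∩ A).card = (R ∩ A).card + (e ∩ A).card := by
        rw [union_inter_distrib_right, card_union_of_disjoint (dRe.mono inter_subset_left inter_subset_left)]
      have hec : (e ∩ A).card ≤ k := (card_le_card inter_subset_left).trans (hH e he).le
      have := fin 𝓣 (R ∪ e) ρ (w+1) (y + (e ∩ A).card) t1 (fun T hT => ⟨disjoint_left.mpr fun a ha hb => by
          rw [mem_union, mR] at hb
          rcases hb with hb | hb
          · exact hb.1 (mS T hT a ha)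
          · exact disjoint_left.mp hSe (mS T hT a ha) hb, (t2 T hT).2⟩) (by rw [mul_add]; omega)
        (by rw [mul_add]; omega) (by rw [card_union_of_disjoint dRe, q3, hH e he]; ring)
        (by rw [cRA, q4]; ring) (Or.inr ⟨hs2, by
          rw [cRA, show i * (2 * ρ + (w+1)) = i * (2 * ρ + w) + i by ring]; omega⟩)
        (fun g hg hg' => by convert q5 g hg hg')
      have h2 := this.union t3 (by
        rw [disjoint_left]; intro a ha hb
        rw [mem_union, mem_union, mR] at ha
        rcases ha with (ha | ha) | ha
        · exact ha.2.2 hb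
        · exact disjoint_left.mp t5 hb ha
        · exact disjoint_left.mp t4 hb ha)
      convert h2
      symm
      rw [eq_univ_iff_forall]
      intro a
      simp only [mem_union, mR, ← hS]; exact ty4
  · obtain ⟨𝓣, U, t1, t2, t3, t4, t5, ρ, w, y, q1, q2, q3, q4, q5⟩ := hX ∅ (by simp) (by simp)
    set S := 𝓣.biUnion id with hS
    have hSM : Mat H S := Mat.biUnion 𝓣 id (fun T hT => (t2 T hT).2) t1
    set R := (S ∪ ∅ ∪ U)ᶜ with hR
    have mR : ∀ a, a ∈ R ↔ a ∉ S ∧ a ∉ U := fun a => by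
      rw [hR]; simp only [mem_compl, mem_union, notMem_empty]; exact ty2
    have mS : ∀ T ∈ 𝓣, ∀ a ∈ T, a ∈ S := fun T hT a ha => by
      rw [hS, mem_biUnion]; exact ⟨T, hT, ha⟩
    have hp : s = 1 ∨ (s = 2 ∧ (R ∩ A).card % 2 = (i * (2 * ρ + w)) % 2) := by
      rcases hs with hs | hs
      · exact Or.inl hs
      right
      refine ⟨hs, ?_⟩
      have hall : ∀ e ∈ H, (e ∩ A).card % 2 = i % 2 := by
        intro e he; by_contra hne; exact hs2 ⟨hs, e, he, hne⟩
      have hp := hpar A hA hA' i hall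
      have hSU : Mat H (S ∪ U) := hSM.union t3 t4.symm
      obtain ⟨c, hc1, hc2⟩ := hSU.parity hk0 hH hall
      have hRe : R = (S ∪ U)ᶜ := by rw [hR, union_empty]
      have e1 : (S ∪ U).card + R.card = Fintype.card V := by rw [hRe]; exact card_add_card_compl _
      have e2 : (R ∩ A).card + ((S ∪ U) ∩ A).card = A.card := by
        have := card_inter_add_card_sdiff A (S ∪ U)
        have h' : A \ (S ∪ U) = R ∩ A := by
          rw [hRe]; ext a; simp only [mem_sdiff, mem_inter, mem_compl]; tauto
        rw [h', inter_comm A] at this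
        omega
      have e3 : Fintype.card V / k = c + (2 * ρ + w) := by
        rw [← e1, q3, hc1, show k * c + (2 * k * ρ + k * w) = k * (c + (2 * ρ + w)) by ring,
          Nat.mul_div_cancel_left _ hk0]
      rw [e3, mul_add] at hp
      omega
    have := fin 𝓣 R ρ w y t1 (fun T hT => ⟨disjoint_left.mpr fun a ha hb =>
        ((mR a).mp hb).1 (mS T hT a ha), (t2 T hT).2⟩) (by omega) q2 q3 q4 hp
        (fun g hg hg' => by convert q5 g hg hg')
    have h2 := this.union t3 (by
        rw [disjoint_left]; intro a ha hb
        rw [mem_union, mR] at ha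
        rcases ha with ha | ha
        · exact ha.2 hb
        · exact disjoint_left.mp t4 hb ha)
    convert h2
    symm
    rw [eq_univ_iff_forall]
    intro a
    simp only [mem_union, mR, ← hS]; exact ty5

end PMx


namespace PMx

open Finset
set_option linter.unusedSectionVars false
set_option linter.unusedVariables false

section
variable {V : Type} [Fintype V] [DecidableEq V]

lemma card_tuples (T : Finset V) (m : ℕ) (hT : T.card = m) :
    (univ.filter (fun x : Fin m → V => univ.image x = T)).card = m.factorial := by
  have hc : Fintype.card (Fin m ≃ T) = m.factorial := by
    have e : Fin m ≃ T := (Fintype.equivFinOfCardEq (by rw [Fintype.card_coe, hT])).symm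
    rw [Fintype.card_equiv e, Fintype.card_fin]
  rw [← hc, ← card_univ]
  symm
  refine card_bij (fun e _ => fun i => (e i : V)) ?_ ?_ ?_
  · intro e _
    rw [mem_filter]
    refine ⟨mem_univ _, ?_⟩
    ext a
    simp only [mem_image, mem_univ, true_and]
    constructor
    · rintro ⟨i, rfl⟩; exact (e i).2
    · intro ha; exact ⟨e.symm ⟨a, ha⟩, by simp⟩
  · intro e _ e' _ h
    ext i
    exact congrFun h i
  · intro x hx
    have hx : univ.image x = T := (mem_filter.mp hx).2
    have hm : ∀ i, x i ∈ T := fun i => by rw [← hx]; simp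
    have hbij : Function.Bijective (fun i => (⟨x i, hm i⟩ : T)) := by
      rw [Fintype.bijective_iff_surjective_and_card]
      constructor
      · rintro ⟨a, ha⟩
        rw [← hx, mem_image] at ha
        obtain ⟨i, -, rfl⟩ := ha
        exact ⟨i, rfl⟩
      · rw [Fintype.card_coe, hT, Fintype.card_fin]
    exact ⟨Equiv.ofBijective _ hbij, mem_univ _, rfl⟩

def Good {d m : ℕ} (H : Finset (Finset V)) (s : Fin d → V) (x : Fin m → V) : Prop :=
  Function.Injective x ∧ (∀ i, x i ∉ univ.image s) ∧ Ed H (Sum.elim s x)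

lemma image_elim {d m : ℕ} (s : Fin d → V) (x : Fin m → V) :
    univ.image (Sum.elim s x) = univ.image s ∪ univ.image x := by
  ext a; simp [Sum.exists]

open scoped Classical in
lemma pr_good {d m k : ℕ} {H : Finset (Finset V)} (hk : k = d + m) (hH : ∀ e ∈ H, e.card = k)
    (s : Fin d → V) (hs : Function.Injective s) :
    pr (fun x : Fin m → V => Good H s x) =
      ((H.filter (fun e => univ.image s ⊆ e)).card * m.factorial : ℝ) / (Fintype.card V : ℝ)^m := by
  have hsc : (univ.image s).card = d := by rw [card_image_of_injective _ hs, card_univ, Fintype.card_fin]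
  rw [pr_eq_card]
  congr 1
  · rw [← Nat.cast_mul]
    congr 1
    rw [card_eq_sum_card_fiberwise (f := fun x : Fin m → V => univ.image (Sum.elim s x))
      (t := H.filter (fun e => univ.image s ⊆ e))]
    · rw [sum_congr rfl (g := fun _ => m.factorial), sum_const, smul_eq_mul]
      intro e he
      rw [mem_filter] at he
      have hce : (e \ univ.image s).card = m := by
        rw [card_sdiff_of_subset he.2, hH e he.1, hsc]; omega
      rw [← card_tuples (e \ univ.image s) m hce]
      congr 1
      ext x
      simp only [mem_filter, mem_univ, true_and, image_elim]
      constructor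
      · rintro ⟨⟨h1, h2, h3⟩, rfl⟩
        rw [union_sdiff_left]
        symm
        rw [Finset.sdiff_eq_self_iff_disjoint, disjoint_left]
        intro a ha
        rw [mem_image] at ha
        obtain ⟨i, -, rfl⟩ := ha
        exact h2 i
      · intro hx
        have hu : univ.image s ∪ univ.image x = e := by rw [hx]; exact union_sdiff_of_subset he.2
        refine ⟨⟨?_, ?_, ?_⟩, hu⟩
        · have : (univ.image x).card = (univ : Finset (Fin m)).card := by
            rw [hx, hce, card_univ, Fintype.card_fin]
          rw [card_image_iff] at this
          simpa using this
        · intro i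
          have : x i ∈ univ.image x := by simp
          rw [hx] at this
          exact (mem_sdiff.mp this).2
        · unfold Ed; rw [image_elim, hu]; exact he.1
    · intro x hx
      rw [mem_coe, mem_filter] at hx
      rw [mem_coe, mem_filter]
      refine ⟨hx.2.2.2, ?_⟩
      show univ.image s ⊆ univ.image (Sum.elim s x)
      rw [image_elim]; exact subset_union_left
  · rw [Fintype.card_fun, Fintype.card_fin]; push_cast; rfl

lemma prod_sign {m : ℕ} (A : Finset V) (x : Fin m → V) :
    ∏ i, (1 - 2 * ind (x i ∈ A)) = (-1:ℝ)^(pat A x).card := by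
  have : ∀ i, (1 - 2 * ind (x i ∈ A)) = if x i ∈ A then (-1:ℝ) else 1 := by
    intro i
    split_ifs with h
    · rw [ind_true h]; norm_num
    · rw [ind_false h]; norm_num
  rw [prod_congr rfl (fun i _ => this i), prod_ite, prod_const, prod_const_one, mul_one]
  rfl

lemma pr_parity [Nonempty V] {m : ℕ} (hm : 1 ≤ m) (A : Finset V)
    (hA : |(Fintype.card V : ℝ) - 2 * A.card| ≤ 2) (hn : 2 ≤ Fintype.card V) (p : ℕ) :
    1/2 - 1 / (Fintype.card V : ℝ) ≤ pr (fun x : Fin m → V => Even (p + (pat A x).card)) := by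
  have hnR : (0:ℝ) < Fintype.card V := by exact_mod_cast (by omega : 0 < Fintype.card V)
  set a : ℝ := 1 - 2 * ((A.card : ℝ) / Fintype.card V) with ha
  have h1 : ∀ x : Fin m → V, ind (Even (p + (pat A x).card)) =
      1/2 + ((-1:ℝ)^p / 2) * ∏ i, (1 - 2 * ind (x i ∈ A)) := by
    intro x
    rw [prod_sign, div_mul_eq_mul_div, ← pow_add]
    by_cases h : Even (p + (pat A x).card)
    · rw [ind_true h, h.neg_one_pow]; norm_num
    · rw [ind_false h, (Nat.not_even_iff_odd.mp h).neg_one_pow]; norm_num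
  have h2 : pr (fun x : Fin m → V => Even (p + (pat A x).card)) = 1/2 + ((-1:ℝ)^p / 2) * a^m := by
    unfold pr
    rw [ex_congr h1, ex_add, ex_const, ex_mul_left,
      ex_pi_prod (fun _ (v : V) => 1 - 2 * ind (v ∈ A))]
    have : ex (fun v : V => 1 - 2 * ind (v ∈ A)) = a := by
      rw [ex_sub, ex_const, ex_mul_left, ha]
      have := pr_mem A
      unfold pr at this
      rw [this]
    rw [prod_congr rfl (fun i _ => this), prod_const, card_univ, Fintype.card_fin]
  have ha1 : |a| ≤ 2 / Fintype.card V := by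
    have : a = ((Fintype.card V : ℝ) - 2 * A.card) / Fintype.card V := by rw [ha]; field_simp
    rw [this, abs_div, abs_of_pos hnR]
    gcongr
  have ha2 : |a|^m ≤ |a| := by
    refine pow_le_of_le_one (abs_nonneg _) (ha1.trans ?_) (by omega)
    rw [div_le_one hnR]; exact_mod_cast hn
  have h3 : |((-1:ℝ)^p / 2) * a^m| ≤ 1 / Fintype.card V := by
    rw [abs_mul, abs_div, abs_pow, abs_pow, abs_neg, abs_one, one_pow, abs_two]
    have : 2 / (Fintype.card V : ℝ) = 2 * (1 / Fintype.card V) := by ring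
    linarith
  rw [h2]
  linarith [(abs_le.mp h3).1]

lemma good_even [Nonempty V] {d m k : ℕ} (hk : k = d + m) (hm : 1 ≤ m) (A : Finset V)
    (hA : |(Fintype.card V : ℝ) - 2 * A.card| ≤ 2) (hn : 2 ≤ Fintype.card V)
    (s : Fin d → V) (hs : Function.Injective s) :
    1/2 - (1 + m^2 + m * d) / (Fintype.card V : ℝ) ≤
      pr (fun x : Fin m → V => Good ((univ.powersetCard k).filter fun e => Even (e ∩ A).card) s x) := by
  have hsc : (univ.image s).card = d := by rw [card_image_of_injective _ hs, card_univ, Fintype.card_fin]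
  have h1 := pr_parity (m := m) hm A hA hn (univ.image s ∩ A).card
  have h2 : pr (fun x : Fin m → V => ¬ Function.Injective x ∨ ∃ i, x i ∈ univ.image s) ≤
      (m^2 + m * d) / (Fintype.card V : ℝ) := by
    refine (pr_or_le _ _).trans ?_
    have a1 := pr_not_inj_le (ι := Fin m) (Ω := V)
    have a2 := pr_hit_le (ι := Fin m) (univ.image s)
    rw [Fintype.card_fin] at a1 a2
    rw [hsc] at a2
    rw [add_div]; linarith
  have h3 := pr_and_not_ge (fun x : Fin m → V => Even ((univ.image s ∩ A).card + (pat A x).card))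
    (fun x => ¬ Function.Injective x ∨ ∃ i, x i ∈ univ.image s)
  have h4 : pr (fun x : Fin m → V => Even ((univ.image s ∩ A).card + (pat A x).card) ∧
      ¬ (¬ Function.Injective x ∨ ∃ i, x i ∈ univ.image s)) ≤
      pr (fun x : Fin m → V => Good ((univ.powersetCard k).filter fun e => Even (e ∩ A).card) s x) := by
    refine pr_mono ?_
    rintro x ⟨hx, hy⟩
    push Not at hy
    obtain ⟨hy1, hy2⟩ := hy
    refine ⟨hy1, hy2, ?_⟩
    have hd : Disjoint (univ.image s) (univ.image x) := by
      rw [disjoint_right]; intro a ha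
      rw [mem_image] at ha
      obtain ⟨i, -, rfl⟩ := ha
      exact hy2 i
    unfold Ed
    rw [image_elim, mem_filter, mem_powersetCard]
    refine ⟨⟨subset_univ _, ?_⟩, ?_⟩
    · rw [card_union_of_disjoint hd, hsc, card_image_of_injective _ hy1, card_univ, Fintype.card_fin, hk]
    · rw [union_inter_distrib_right, card_union_of_disjoint (hd.mono inter_subset_left inter_subset_left)]
      have : univ.image x ∩ A = (pat A x).image x := by
        ext a
        simp only [mem_inter, mem_image, pat, mem_filter, mem_univ, true_and]
        constructor
        · rintro ⟨⟨i, rfl⟩, h⟩; exact ⟨i, h, rfl⟩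
        · rintro ⟨i, h, rfl⟩; exact ⟨⟨i, rfl⟩, h⟩
      rw [this, card_image_of_injective _ hy1]
      exact hx
  have : (1 + m^2 + m * d) / (Fintype.card V : ℝ) = 1 / Fintype.card V + (m^2 + m * d) / (Fintype.card V : ℝ) := by
    ring
  linarith

end

end PMx


namespace PMx

open Finset
set_option linter.unusedSectionVars false
set_option linter.unusedVariables false

lemma minDeg_mem {n : ℕ} (H : Finset (Finset (Fin n))) {d : ℕ} (hd : d ≤ n) :
    ∃ S : Finset (Fin n), S.card = d ∧ (H.filter fun e => S ⊆ e).card = minDeg H d := by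
  have : ({ m | ∃ S : Finset (Fin n), S.card = d ∧ (H.filter fun e => S ⊆ e).card = m } : Set ℕ).Nonempty := by
    obtain ⟨S, -, hS⟩ := exists_subset_card_eq (s := (univ : Finset (Fin n))) (n := d) (by simpa using hd)
    exact ⟨_, S, hS, rfl⟩
  exact Nat.sInf_mem this

lemma bdd (n k d : ℕ) : BddAbove { m | ∃ H ∈ Hext n k, minDeg H d = m } := by
  have : { m | ∃ H ∈ Hext n k, minDeg H d = m } = (fun H => minDeg H d) '' (Hext n k) := rfl
  rw [this]
  exact ((Set.toFinite _).image _).bddAbove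

lemma le_deltaExt {n k d : ℕ} {H : Finset (Finset (Fin n))} (h : H ∈ Hext n k) :
    minDeg H d ≤ deltaExt n k d := le_csSup (bdd n k d) ⟨H, h, rfl⟩

lemma exists_A (n : ℕ) (hn : 4 ≤ n) : ∃ A : Finset (Fin n), A.Nonempty ∧ Aᶜ.Nonempty ∧ Odd A.card ∧
    |(Fintype.card (Fin n) : ℝ) - 2 * A.card| ≤ 2 := by
  have : ∃ a : ℕ, Odd a ∧ 1 ≤ a ∧ a < n ∧ 2 * a ≤ n + 2 ∧ n ≤ 2 * a + 2 := by
    by_cases h : Odd (n/2)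
    · exact ⟨n/2, h, by omega, by omega, by omega, by omega⟩
    · refine ⟨n/2+1, ?_, by omega, by omega, by omega, by omega⟩
      rw [Nat.not_odd_iff_even] at h
      exact h.add_one
  obtain ⟨a, h1, h2, h3, h4, h5⟩ := this
  obtain ⟨A, -, hA⟩ := exists_subset_card_eq (s := (univ : Finset (Fin n))) (n := a) (by simp; omega)
  refine ⟨A, card_pos.mp (by omega), card_pos.mp ?_, hA ▸ h1, ?_⟩
  · rw [card_compl, Fintype.card_fin]; omega
  · rw [hA, Fintype.card_fin, abs_le]
    have h4 : (2:ℝ) * a ≤ n + 2 := by exact_mod_cast h4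
    have h5 : (n:ℝ) ≤ 2 * a + 2 := by exact_mod_cast h5
    constructor <;> linarith

lemma degC_of {n k d m : ℕ} (hk : k = d + m) (hm : 1 ≤ m) (hn : 4 ≤ n) (hdn : d ≤ n)
    {γ : ℝ} (hγ : (1 + (m:ℝ)^2 + m * d) / n ≤ γ) (H : Finset (Finset (Fin n)))
    (hH : ∀ e ∈ H, e.card = k)
    (hdeg : ∀ S : Finset (Fin n), S.card = d → deltaExt n k d + 1 ≤ (H.filter fun e => S ⊆ e).card) :
    DegC H d m γ := by
  intro s hs
  have hne : Nonempty (Fin n) := ⟨⟨0, by omega⟩⟩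
  obtain ⟨A, hA1, hA2, hA3, hA4⟩ := exists_A n hn
  set B : Finset (Finset (Fin n)) := (univ.powersetCard k).filter fun e => Even (e ∩ A).card with hB
  have hBe : B ∈ Hext n k := ⟨A, hA1, hA2, Or.inl ⟨hA3, rfl⟩⟩
  obtain ⟨S, hS, hSd⟩ := minDeg_mem B hdn
  let s' : Fin d → Fin n := fun i => (S.orderIsoOfFin hS i : Fin n)
  have hs' : Function.Injective s' := fun i j h => (S.orderIsoOfFin hS).injective (Subtype.ext h)
  have hs'i : univ.image s' = S := by
    refine eq_of_subset_of_card_le ?_ ?_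
    · intro a ha
      rw [mem_image] at ha
      obtain ⟨i, -, rfl⟩ := ha
      exact (S.orderIsoOfFin hS i).2
    · rw [card_image_of_injective _ hs', card_univ, Fintype.card_fin, hS]
  have h1 := good_even hk hm A hA4 (by rw [Fintype.card_fin]; omega) s' hs'
  rw [← hB, pr_good hk (fun e he => (mem_powersetCard.mp (mem_filter.mp he).1).2) s' hs', hs'i] at h1
  have h2 := pr_good hk hH s hs
  have h3 : pr (fun x : Fin m → Fin n => Good H s x) ≤ pr (fun x : Fin m → Fin n => Ed H (Sum.elim s x)) :=
    pr_mono fun x hx => hx.2.2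
  have hsc : (univ.image s).card = d := by rw [card_image_of_injective _ hs, card_univ, Fintype.card_fin]
  have h4 : (B.filter (fun e => S ⊆ e)).card ≤ (H.filter (fun e => univ.image s ⊆ e)).card := by
    have := hdeg _ hsc
    have := le_deltaExt (d := d) hBe
    omega
  have h5 : ((B.filter (fun e => S ⊆ e)).card * m.factorial : ℝ) / (Fintype.card (Fin n) : ℝ)^m ≤
      ((H.filter (fun e => univ.image s ⊆ e)).card * m.factorial : ℝ) / (Fintype.card (Fin n) : ℝ)^m := by
    gcongr
  rw [Fintype.card_fin] at h1 h2 h5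
  have h6 : 1/2 - (1 + (m:ℝ)^2 + m * d) / n ≤ pr (fun x : Fin m → Fin n => Good H s x) := by
    rw [h2]
    refine le_trans h1 ?_
    convert h5
  linarith

lemma hpar_of {n k d : ℕ} (hdn : d ≤ n) (H : Finset (Finset (Fin n)))
    (hH : ∀ e ∈ H, e.card = k)
    (hdeg : ∀ S : Finset (Fin n), S.card = d → deltaExt n k d + 1 ≤ (H.filter fun e => S ⊆ e).card)
    (A : Finset (Fin n)) (hA : A.Nonempty) (hA' : Aᶜ.Nonempty) (i : ℕ)
    (hi : ∀ e ∈ H, (e ∩ A).card % 2 = i % 2) :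
    A.card % 2 = (i * (Fintype.card (Fin n) / k)) % 2 := by
  rw [Fintype.card_fin]
  by_contra hne
  have key : ∃ B ∈ Hext n k, H ⊆ B := by
    rcases Nat.even_or_odd i with h | h
    · refine ⟨_, ⟨A, hA, hA', Or.inl ⟨?_, rfl⟩⟩, ?_⟩
      · rw [Nat.odd_iff]
        have : (i * (n/k)) % 2 = 0 := Nat.even_iff.mp (h.mul_right _)
        omega
      · intro e he
        rw [mem_filter, mem_powersetCard, Nat.even_iff, hi e he]
        exact ⟨⟨subset_univ _, hH e he⟩, Nat.even_iff.mp h⟩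
    · refine ⟨_, ⟨A, hA, hA', Or.inr ⟨?_, rfl⟩⟩, ?_⟩
      · have : (i * (n/k)) % 2 = (n/k) % 2 := by
          rw [Nat.mul_mod, Nat.odd_iff.mp h, one_mul, Nat.mod_mod]
        rw [Int.odd_iff]
        generalize n / k = c at *
        omega
      · intro e he
        rw [mem_filter, mem_powersetCard, Nat.odd_iff, hi e he]
        exact ⟨⟨subset_univ _, hH e he⟩, Nat.odd_iff.mp h⟩
  obtain ⟨B, hB, hHB⟩ := key
  obtain ⟨S, hS, hSd⟩ := minDeg_mem B hdn
  have h1 := hdeg S hS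
  have h2 : (H.filter fun e => S ⊆ e).card ≤ (B.filter fun e => S ⊆ e).card :=
    card_le_card (filter_subset_filter _ hHB)
  have h3 := le_deltaExt (d := d) hB
  omega

lemma no_pm {n k : ℕ} (hk : 0 < k) (H : Finset (Finset (Fin n))) (hH : H ∈ Hext n k) :
    ¬ HasPerfectMatching H := by
  intro hm
  have hm : Mat H univ := hm
  obtain ⟨A, hA, hA', ⟨h1, rfl⟩ | ⟨h1, rfl⟩⟩ := hH
  · obtain ⟨c, hc, hp⟩ := Mat.parity (i := 0) (A := A) hk
      (fun e he => (mem_powersetCard.mp (mem_filter.mp he).1).2)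
      (fun e he => by have := Nat.even_iff.mp (mem_filter.mp he).2; omega) hm
    rw [univ_inter] at hp
    rw [Nat.odd_iff] at h1
    omega
  · obtain ⟨c, hc, hp⟩ := Mat.parity (i := 1) (A := A) hk
      (fun e he => (mem_powersetCard.mp (mem_filter.mp he).1).2)
      (fun e he => by have := Nat.odd_iff.mp (mem_filter.mp he).2; omega) hm
    rw [univ_inter, one_mul] at hp
    rw [card_univ, Fintype.card_fin] at hc
    have : n / k = c := by rw [hc, Nat.mul_div_cancel_left _ hk]
    rw [this, Int.odd_iff] at h1
    omega

lemma ext_exists {n k d : ℕ} (hk : 0 < k) (hn : 4 ≤ n) :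
    ∃ H : Finset (Finset (Fin n)), H ⊆ Finset.univ.powersetCard k ∧
        minDeg H d = deltaExt n k d ∧ ¬ HasPerfectMatching H := by
  obtain ⟨A, hA1, hA2, hA3, hA4⟩ := exists_A n hn
  have hne : { m | ∃ H ∈ Hext n k, minDeg H d = m }.Nonempty :=
    ⟨_, _, ⟨A, hA1, hA2, Or.inl ⟨hA3, rfl⟩⟩, rfl⟩
  obtain ⟨H, hH, hHd⟩ := Nat.sSup_mem hne (bdd n k d)
  refine ⟨H, ?_, hHd, no_pm hk H hH⟩
  obtain ⟨A, hA, hA', ⟨h1, rfl⟩ | ⟨h1, rfl⟩⟩ := hH <;> exact filter_subset _ _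

end PMx

theorem stmt_3 (k d : ℕ) (hd : 1 ≤ d) (hdk : 2 * d < k)
    (hcase : (0.42 * (k : ℝ) ≤ (d : ℝ)) ∨ (k = 12 ∧ d = 5) ∨ (k = 17 ∧ d = 7)) :
    ∃ n₀ : ℕ, ∀ n : ℕ, n₀ ≤ n → k ∣ n →
      (∀ H : Finset (Finset (Fin n)), H ⊆ Finset.univ.powersetCard k →
        (∀ S : Finset (Fin n), S.card = d →
          deltaExt n k d + 1 ≤ (H.filter fun e => S ⊆ e).card) →
        HasPerfectMatching H) ∧
      (∃ H : Finset (Finset (Fin n)), H ⊆ Finset.univ.powersetCard k ∧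
        minDeg H d = deltaExt n k d ∧ ¬ HasPerfectMatching H) := by
  obtain ⟨d', rfl⟩ : ∃ d', d = d' + 1 := ⟨d - 1, by omega⟩
  obtain ⟨M, hM⟩ : ∃ M, k = (d' + 1) + (M + 1) := ⟨k - (d' + 1) - 1, by omega⟩
  have hnum := PMx.numeric k (d'+1) M hd hdk hM hcase
  obtain ⟨γ, hγ, n₀, h⟩ := PMx.core k d' M hM (by omega) (by omega) hnum
  refine ⟨n₀ + 4 + k + ⌈(1 + ((M+1:ℕ):ℝ)^2 + (M+1:ℕ) * (d'+1:ℕ)) / γ⌉₊, ?_⟩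
  intro n hn hkn
  have hk0 : 0 < k := by omega
  refine ⟨?_, PMx.ext_exists hk0 (by omega)⟩
  intro H hH hdeg
  have hu : ∀ e ∈ H, e.card = k := fun e he => (Finset.mem_powersetCard.mp (hH he)).2
  have hnR : (0:ℝ) < n := by exact_mod_cast (by omega : 0 < n)
  have hb : (1 + ((M+1:ℕ):ℝ)^2 + (M+1:ℕ) * (d'+1:ℕ)) / γ ≤ n :=
    (Nat.le_ceil _).trans (Nat.cast_le.mpr (by omega))
  have hdc : PMx.DegC H (d'+1) (M+1) γ := by
    refine PMx.degC_of hM (by omega) (by omega) (by omega) ?_ H hu hdeg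
    rw [div_le_iff₀ hγ] at hb
    rw [div_le_iff₀ hnR]; linarith
  exact h (Fin n) (by rw [Fintype.card_fin]; omega) (by rwa [Fintype.card_fin]) H hu hdc
    (fun A hA hA' i hi => PMx.hpar_of (by omega) H hu hdeg A hA hA' i hi)
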